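/- Let S be a smooth quasi-projective surface over a field k of characteristic p > 0 birational to P¹ × E, where E is an elliptic curve, and let π : S → E be the projection. Denote by Γ the group of automorphisms of E induced by Aut(S). If there exists a nonempty finite subset Z ⊂ E preserved by Γ, then the group Aut(S) is p-Jordan. -/

import Mathlib

open AlgebraicGeometry CategoryTheory TopologicalSpace MvPolynomial Matrix
/-- A group `Γ` is `p`-Jordan with constants `J` and `e` if every finite subgroup
`G ≤ Γ` contains a normal abelian subgroup `A` with `[G : A] ≤ J * |G_p| ^ e`,
where `G_p` is a Sylow `p`-subgroup of `G`. -/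
def IsPJordanWith (p J e : ℕ) (Γ : Type*) [Group Γ] : Prop :=
  ∀ G : Subgroup Γ, Finite G →
    ∃ A : Subgroup ↥G, A.Normal ∧ (∀ a b : ↥A, a * b = b * a) ∧
      ∀ P : Sylow p ↥G, A.index ≤ J * Nat.card ↥(P : Subgroup ↥G) ^ e

/-- A group `Γ` is `p`-Jordan if there are constants `J` and `e`, depending only on `Γ`,
such that every finite subgroup `G ≤ Γ` contains a normal abelian subgroup `A` with
`[G : A] ≤ J * |G_p| ^ e`, where `G_p` is a Sylow `p`-subgroup of `G`. -/
def IsPJordan (p : ℕ) (Γ : Type*) [Group Γ] : Prop :=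
  ∃ J e : ℕ, IsPJordanWith p J e Γ
attribute [local instance] MvPolynomial.gradedAlgebra

/-- The inclusion of constants into the degree-zero part of the polynomial ring. -/
noncomputable def constHom (k : Type) [CommRing k] (n : ℕ) :
    k →+* (homogeneousSubmodule (Fin (n + 1)) k 0) where
  toFun c := ⟨C c, isHomogeneous_C _ _⟩
  map_one' := by ext; simp
  map_mul' x y := by ext; simp
  map_zero' := by ext; simp
  map_add' x y := by ext; simp

/-- Projective `n`-space over `k`, as `Proj` of the standard graded polynomial ring in
`n + 1` variables. -/
noncomputable def ProjSpace (k : Type) [CommRing k] (n : ℕ) : Scheme :=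
  Proj (homogeneousSubmodule (Fin (n + 1)) k)

/-- The structure morphism of projective space over `k`. -/
noncomputable def ProjSpace.str (k : Type) [CommRing k] (n : ℕ) :
    ProjSpace k n ⟶ Spec (CommRingCat.of k) :=
  Proj.toSpecZero _ ≫ Spec.map (CommRingCat.ofHom (constHom k n))

/-- A scheme over `k` is projective over `k` if it admits a closed immersion into some
projective space over `k`, compatible with the structure morphisms. -/
def IsProjectiveOver (k : Type) [Field k] (X : Scheme)
    (sX : X ⟶ Spec (CommRingCat.of k)) : Prop :=
  ∃ (n : ℕ) (f : X ⟶ ProjSpace k n), IsClosedImmersion f ∧ f ≫ ProjSpace.str k n = sX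

/-- A scheme over `k` is quasi-projective over `k` if it admits a (locally closed)
immersion into some projective space over `k`, compatible with the structure morphisms. -/
def IsQuasiProjectiveOver (k : Type) [Field k] (X : Scheme)
    (sX : X ⟶ Spec (CommRingCat.of k)) : Prop :=
  ∃ (n : ℕ) (f : X ⟶ ProjSpace k n), IsImmersion f ∧ f ≫ ProjSpace.str k n = sX
/-- Two `k`-schemes are birational over `k` if they contain isomorphic dense open
subschemes, the isomorphism being compatible with the structure morphisms. -/
def BirationalOver (k : Type) [Field k] (X Y : Scheme)
    (sX : X ⟶ Spec (CommRingCat.of k)) (sY : Y ⟶ Spec (CommRingCat.of k)) : Prop :=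
  ∃ (U : X.Opens) (V : Y.Opens), Dense (U : Set X) ∧ Dense (V : Set Y) ∧
    ∃ e : (U : Scheme) ≅ (V : Scheme), e.hom ≫ V.ι ≫ sY = U.ι ≫ sX

/-- A morphism of schemes is birational if it restricts to an isomorphism between dense
open subschemes. -/
def IsBirationalHom {X Y : Scheme} (f : X ⟶ Y) : Prop :=
  ∃ (U : X.Opens) (V : Y.Opens), Dense (U : Set X) ∧ Dense (V : Set Y) ∧
    ∃ e : (U : Scheme) ≅ (V : Scheme), e.hom ≫ V.ι = U.ι ≫ f

/-- The product `ℙ¹ × E` over `k`, as a fibre product of schemes over `Spec k`. -/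
noncomputable def P1Prod (k : Type) [Field k] (E : Scheme)
    (sE : E ⟶ Spec (CommRingCat.of k)) : Scheme :=
  Limits.pullback (ProjSpace.str k 1) sE

/-- The structure morphism of the product `ℙ¹ × E` over `k`. -/
noncomputable def P1Prod.str (k : Type) [Field k] (E : Scheme)
    (sE : E ⟶ Spec (CommRingCat.of k)) : P1Prod k E sE ⟶ Spec (CommRingCat.of k) :=
  Limits.pullback.snd (ProjSpace.str k 1) sE ≫ sE
/-- The base change of a `k`-scheme to the algebraic closure of `k`. -/
noncomputable def BaseChangeToClosure (k : Type) [Field k] (X : Scheme)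
    (sX : X ⟶ Spec (CommRingCat.of k)) : Scheme :=
  Limits.pullback sX (Spec.map (CommRingCat.ofHom (algebraMap k (AlgebraicClosure k))))

/-- The structure morphism of the base change to the algebraic closure. -/
noncomputable def BaseChangeToClosure.str (k : Type) [Field k] (X : Scheme)
    (sX : X ⟶ Spec (CommRingCat.of k)) :
    BaseChangeToClosure k X sX ⟶ Spec (CommRingCat.of (AlgebraicClosure k)) :=
  Limits.pullback.snd _ _

/-- A `k`-scheme is geometrically non-rational if its base change to the algebraic
closure is not birational to the projective line.  For a smooth projective curve this
says exactly that the curve has positive genus. -/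
def GeometricallyNonRational (k : Type) [Field k] (X : Scheme)
    (sX : X ⟶ Spec (CommRingCat.of k)) : Prop :=
  ¬ BirationalOver (AlgebraicClosure k) (BaseChangeToClosure k X sX)
      (ProjSpace (AlgebraicClosure k) 1)
      (BaseChangeToClosure.str k X sX) (ProjSpace.str (AlgebraicClosure k) 1)

/-- A point of a scheme is a closed point. -/
def Scheme.IsClosedPoint {X : Scheme} (x : X) : Prop := IsClosed ({x} : Set X)

/-- A smooth projective integral curve over `k`. -/
structure SmoothProjectiveCurve (k : Type) [Field k] where
  X : Scheme
  str : X ⟶ Spec (CommRingCat.of k)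
  integral : IsIntegral X
  smooth : IsSmooth str
  projective : IsProjectiveOver k X str
  dim_one : topologicalKrullDim X = 1

/-- A smooth projective curve has positive genus if and only if it is not (geometrically)
rational; this is the classical characterization `genus = 0 ↔ rational` of smooth
projective curves over an algebraically closed field. -/
def SmoothProjectiveCurve.PositiveGenus {k : Type} [Field k]
    (C : SmoothProjectiveCurve k) : Prop :=
  GeometricallyNonRational k C.X C.str
/-- An elliptic curve over `k`: a smooth projective integral curve with a chosen rational
point, which geometrically (after base change to the algebraic closure) is non-rational
(genus ≥ 1) and homogeneous, i.e. its automorphism group acts transitively on closed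
points (this fails for curves of genus ≥ 2, whose automorphism groups are finite).  For
smooth projective curves over an algebraically closed field these two conditions
characterize exactly the curves of genus one, so this structure encodes a smooth
projective curve of genus `1` with a chosen point. -/
structure EllipticCurveOver (k : Type) [Field k] extends SmoothProjectiveCurve k where
  origin : Spec (CommRingCat.of k) ⟶ X
  origin_section : origin ≫ str = 𝟙 _
  geom_nonrational : GeometricallyNonRational k X str
  geom_homogeneous :
    ∀ x y : BaseChangeToClosure k X str, Scheme.IsClosedPoint x → Scheme.IsClosedPoint y →
      ∃ g : Aut (Over.mk (BaseChangeToClosure.str k X str)), g.hom.left.base x = y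

theorem Subgroup.card_mul_card_le_card_sup_mul_card_inf {G : Type*} [Group G] [Finite G]
    (H K : Subgroup G) :
    Nat.card H * Nat.card K ≤ Nat.card ↥(H ⊔ K) * Nat.card ↥(H ⊓ K) := by
  have key : ∀ {A B : Subgroup G}, A ≤ B → Nat.card A * A.relIndex B = Nat.card B := fun h => by
    simpa using Subgroup.relIndex_mul_relIndex ⊥ _ _ bot_le h
  have h1 : Nat.card ↥(H ⊓ K) * (H ⊓ K).relIndex K = Nat.card K :=
    key inf_le_right
  have h2 : Nat.card H * H.relIndex (H ⊔ K) = Nat.card ↥(H ⊔ K) :=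
    key le_sup_left
  have h3 : H.relIndex K ≤ H.relIndex (H ⊔ K) :=
    Subgroup.relIndex_le_of_le_right le_sup_right
      fun h => by rw [h, mul_zero] at h2; exact Nat.card_pos.ne h2
  rw [Subgroup.inf_relIndex_right] at h1
  rw [← h1, ← h2]
  calc _ = Nat.card H * H.relIndex K * Nat.card ↥(H ⊓ K) := by ring
    _ ≤ _ := by gcongr

/-- The Chermak–Delgado measure of a subgroup. -/
noncomputable def Subgroup.chermakDelgado {G : Type*} [Group G] (H : Subgroup G) : ℕ :=
  Nat.card H * Nat.card (Subgroup.centralizer (H : Set G))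

theorem Subgroup.chermakDelgado_mul_le {G : Type*} [Group G] [Finite G] (H K : Subgroup G) :
    H.chermakDelgado * K.chermakDelgado ≤ (H ⊔ K).chermakDelgado * (H ⊓ K).chermakDelgado := by
  have h1 := Subgroup.card_mul_card_le_card_sup_mul_card_inf H K
  have h2 := Subgroup.card_mul_card_le_card_sup_mul_card_inf
    (Subgroup.centralizer (H : Set G)) (Subgroup.centralizer (K : Set G))
  have h3 : Subgroup.centralizer (H : Set G) ⊓ Subgroup.centralizer (K : Set G) =
      Subgroup.centralizer ((H ⊔ K : Subgroup G) : Set G) := by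
    rw [Subgroup.sup_eq_closure, Subgroup.centralizer_closure]
    ext x
    simp [Subgroup.mem_centralizer_iff, or_imp, forall_and]
  have h4 : Subgroup.centralizer (H : Set G) ⊔ Subgroup.centralizer (K : Set G) ≤
      Subgroup.centralizer ((H ⊓ K : Subgroup G) : Set G) :=
    sup_le (Subgroup.centralizer_le (by simp)) (Subgroup.centralizer_le (by simp))
  have h5 := Nat.card_le_card_of_injective _ (Subgroup.inclusion_injective h4)
  rw [h3] at h2
  unfold Subgroup.chermakDelgado
  calc _ = (Nat.card H * Nat.card K) * (Nat.card (Subgroup.centralizer (H : Set G)) *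
        Nat.card (Subgroup.centralizer (K : Set G))) := by ring
    _ ≤ (Nat.card ↥(H ⊔ K) * Nat.card ↥(H ⊓ K)) * _ := Nat.mul_le_mul h1 h2
    _ ≤ (Nat.card ↥(H ⊔ K) * Nat.card ↥(H ⊓ K)) *
        (Nat.card (Subgroup.centralizer ((H ⊓ K : Subgroup G) : Set G)) *
        Nat.card (Subgroup.centralizer ((H ⊔ K : Subgroup G) : Set G))) := by gcongr
    _ = _ := by ring

theorem Subgroup.chermakDelgado_map {G : Type*} [Group G] [Finite G] (e : G ≃* G)
    (H : Subgroup G) : (H.map e.toMonoidHom).chermakDelgado = H.chermakDelgado := by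
  have : Subgroup.centralizer ((H.map e.toMonoidHom : Subgroup G) : Set G) =
      (Subgroup.centralizer (H : Set G)).map e.toMonoidHom := by
    ext x
    rw [Subgroup.mem_map_equiv]
    simp only [Subgroup.mem_centralizer_iff, Subgroup.coe_map, MulEquiv.toMonoidHom_eq_coe,
      MonoidHom.coe_coe, Set.mem_image, SetLike.mem_coe, forall_exists_index, and_imp,
      forall_apply_eq_imp_iff₂]
    refine forall₂_congr fun h _ => ?_
    rw [← e.symm.injective.eq_iff]
    simp
  unfold Subgroup.chermakDelgado
  rw [this, Subgroup.card_map_of_injective e.injective, Subgroup.card_map_of_injective e.injective]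

/-- A finite group with an abelian subgroup of index `m` has a normal abelian subgroup of index
at most `m ^ 2`. -/
theorem Subgroup.exists_normal_isMulCommutative_index_le {G : Type*} [Group G] [Finite G]
    (A : Subgroup G) [IsMulCommutative A] :
    ∃ M : Subgroup G, M.Normal ∧ IsMulCommutative M ∧ M.index ≤ A.index ^ 2 := by
  classical
  obtain ⟨H₀, hH₀⟩ := Finite.exists_max (Subgroup.chermakDelgado (G := G))
  have hne : Set.Nonempty {H : Subgroup G | H.chermakDelgado = H₀.chermakDelgado} := ⟨H₀, rfl⟩
  obtain ⟨M, hM, hmin⟩ := Set.exists_min_image _ (fun H : Subgroup G => Nat.card H)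
    (Set.toFinite _) hne
  simp only [Set.mem_ofPred_eq] at hM hmin
  have hpos : ∀ H : Subgroup G, 0 < H.chermakDelgado := fun H =>
    Nat.mul_pos Nat.card_pos Nat.card_pos
  have key : ∀ K : Subgroup G, K.chermakDelgado = H₀.chermakDelgado → M ≤ K := by
    intro K hK
    have h1 := Subgroup.chermakDelgado_mul_le M K
    have h2 : (M ⊓ K).chermakDelgado = H₀.chermakDelgado := by
      refine le_antisymm (hH₀ _) ?_
      rw [hM, hK] at h1
      by_contra! h
      have := Nat.mul_le_mul (hH₀ (M ⊔ K)) (Nat.le_sub_one_of_lt h)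
      have h3 := hpos H₀
      have h4 : H₀.chermakDelgado * (H₀.chermakDelgado - 1) <
        H₀.chermakDelgado * H₀.chermakDelgado := by
        apply Nat.mul_lt_mul_of_pos_left (by omega) h3
      omega
    have h3 := hmin _ h2
    have : M ⊓ K = M := Subgroup.eq_of_le_of_card_ge inf_le_left h3
    exact inf_eq_left.mp this
  have hc : M ≤ Subgroup.centralizer (M : Set G) := by
    apply key
    refine le_antisymm (hH₀ _) ?_
    rw [← hM]
    unfold Subgroup.chermakDelgado
    rw [mul_comm]
    gcongr
    exact Nat.card_le_card_of_injective _
      (Subgroup.inclusion_injective (Subgroup.le_centralizer_iff.mp le_rfl))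
  refine ⟨M, ?_, Subgroup.le_centralizer_iff_isMulCommutative.mp hc, ?_⟩
  · refine ⟨fun n hn g => ?_⟩
    have h := key (M.map (MulAut.conj g⁻¹).toMonoidHom)
      (by rw [Subgroup.chermakDelgado_map, hM]) hn
    rw [Subgroup.mem_map_equiv] at h
    simpa using h
  · have h1 := hH₀ A
    rw [← hM] at h1
    unfold Subgroup.chermakDelgado at h1
    have h2 := Nat.card_le_card_of_injective _
      (Subgroup.inclusion_injective A.le_centralizer)
    have h3 : Nat.card (Subgroup.centralizer (M : Set G)) ≤ Nat.card G :=
      Subgroup.card_le_card_group _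
    have h4 : Nat.card A * Nat.card A ≤ Nat.card M * Nat.card G :=
      (Nat.mul_le_mul_left _ h2).trans (h1.trans (Nat.mul_le_mul_left _ h3))
    have hA := A.card_mul_index
    have hMi := M.card_mul_index
    have hG : 0 < Nat.card G := Nat.card_pos
    have hMp : 0 < Nat.card M := Nat.card_pos
    have h5 : Nat.card G * Nat.card G * M.index ≤ Nat.card G * Nat.card G * A.index ^ 2 := by
      calc Nat.card G * Nat.card G * M.index
          = (Nat.card A * Nat.card A) * (A.index ^ 2 * M.index) := by rw [← hA]; ring
        _ ≤ (Nat.card M * Nat.card G) * (A.index ^ 2 * M.index) := by gcongr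
        _ = (Nat.card M * M.index) * Nat.card G * A.index ^ 2 := by ring
        _ = _ := by rw [hMi]
    exact Nat.le_of_mul_le_mul_left h5 (by positivity)

theorem Subgroup.card_mul_relIndex_of_le {G : Type*} [Group G] {A B : Subgroup G} (h : A ≤ B) :
    Nat.card A * A.relIndex B = Nat.card B := by
  simpa using Subgroup.relIndex_mul_relIndex ⊥ _ _ bot_le h

theorem Subgroup.relIndex_le_pow_factorization {p : ℕ} [Fact p.Prime] {H : Type*} [Group H]
    [Finite H] (K L : Subgroup H) [K.Normal]
    (hp : ∀ g ∈ L, ∃ n : ℕ, g ^ p ^ n ∈ K) :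
    K.relIndex L ≤ p ^ (Nat.card H).factorization p := by
  have hpg : IsPGroup p (L ⧸ K.subgroupOf L) := by
    intro x
    obtain ⟨g, rfl⟩ := QuotientGroup.mk_surjective x
    obtain ⟨n, hn⟩ := hp g g.2
    exact ⟨n, by rw [← QuotientGroup.mk_pow, QuotientGroup.eq_one_iff]; simpa [mem_subgroupOf]⟩
  obtain ⟨a, ha⟩ := IsPGroup.iff_card.mp hpg
  rw [← Subgroup.index_eq_card] at ha
  change K.relIndex L = _ at ha
  rw [ha]
  refine Nat.pow_le_pow_right (Fact.out (p := p.Prime)).pos ?_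
  refine ((Fact.out (p := p.Prime)).pow_dvd_iff_le_factorization Nat.card_pos.ne').mp ?_
  rw [← ha]
  exact (Subgroup.relIndex_dvd_card K L).trans (Subgroup.card_subgroup_dvd_card L)

theorem exists_isMulCommutative_index_le_of_character {p : ℕ} [Fact p.Prime] {H : Type*} [Group H]
    [Finite H] {F : Type*} [Field F] (χ : H →* Fˣ) (K₀ K' : Subgroup H) [K₀.Normal]
    (hK₀ : K₀ ≤ χ.ker) (hχ : ∀ g ∈ χ.ker, ∃ n : ℕ, g ^ p ^ n ∈ K₀) (hK' : K' ≤ K₀)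
    {d B : ℕ} (hd : Nat.card K₀ ≤ d * Nat.card K') (c : H) (hc : c ∈ K')
    (hB : Nat.card K' ≤ B * orderOf c) :
    ∃ A : Subgroup H, IsMulCommutative A ∧
      A.index ≤ (Subgroup.centralizer {c}).index * (d * B * p ^ (Nat.card H).factorization p) := by
  set G₃ := Subgroup.centralizer {c} with hG₃
  have : Finite (G₃.map χ) := Set.Finite.image χ (Set.toFinite (G₃ : Set H))
  have : IsCyclic (G₃.map χ) := isCyclic_subgroup_units _
  obtain ⟨⟨_, h, hh, rfl⟩, hgen⟩ := IsCyclic.exists_generator (α := G₃.map χ)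
  have hch : c * h = h * c := Subgroup.mem_centralizer_iff.mp hh c rfl
  set A := Subgroup.closure ({c, h} : Set H) with hA
  have hcA : c ∈ A := Subgroup.subset_closure (by simp)
  have hhA : h ∈ A := Subgroup.subset_closure (by simp)
  have hAG : A ≤ G₃ := by
    rw [hA, Subgroup.closure_le]
    rintro x (rfl | rfl)
    · simp [hG₃, Subgroup.mem_centralizer_iff]
    · exact hh
  have hAc : IsMulCommutative A := by
    apply Subgroup.isMulCommutative_closure
    rintro x (rfl | rfl) y (rfl | rfl)
    exacts [rfl, hch, hch.symm, rfl]
  set L := χ.ker ⊓ G₃ with hL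
  have hAL : G₃ ≤ A ⊔ L := by
    intro g hg
    obtain ⟨n, hn⟩ := Subgroup.mem_zpowers_iff.mp (hgen ⟨χ g, g, hg, rfl⟩)
    have hn' : χ (h ^ n) = χ g := by
      rw [map_zpow]; exact congrArg Subtype.val hn
    have : g = h ^ n * ((h ^ n)⁻¹ * g) := by group
    rw [this]
    refine Subgroup.mul_mem_sup (A.zpow_mem hhA n) ⟨?_, ?_⟩
    · simp [hn']
    · exact G₃.mul_mem (G₃.inv_mem (G₃.zpow_mem hh n)) hg
  have hLcard : Nat.card L ≤ d * B * p ^ (Nat.card H).factorization p * orderOf c := by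
    have h1 : Nat.card L ≤ Nat.card χ.ker :=
      Nat.card_le_card_of_injective _ (Subgroup.inclusion_injective inf_le_left)
    have h2 := Subgroup.card_mul_relIndex_of_le hK₀
    have h3 := Subgroup.relIndex_le_pow_factorization K₀ χ.ker hχ
    calc _ ≤ Nat.card K₀ * K₀.relIndex χ.ker := h1.trans h2.ge
      _ ≤ (d * (B * orderOf c)) * p ^ (Nat.card H).factorization p :=
        Nat.mul_le_mul (hd.trans (Nat.mul_le_mul_left _ hB)) h3
      _ = _ := by ring
  refine ⟨A, hAc, ?_⟩
  rw [← Subgroup.relIndex_mul_index hAG, mul_comm]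
  gcongr
  have hcop : A.relIndex G₃ ≤ A.relIndex L := by
    have hLG : L ≤ G₃ := inf_le_right
    have hn : (L.subgroupOf G₃).Normal := by
      have : L.subgroupOf G₃ = (χ.ker).subgroupOf G₃ := by
        rw [hL, inf_comm, Subgroup.inf_subgroupOf_left]
      rw [this]; infer_instance
    have hsup : A.subgroupOf G₃ ⊔ L.subgroupOf G₃ = ⊤ := by
      rw [← Subgroup.subgroupOf_sup hAG hLG, Subgroup.subgroupOf_eq_top]
      exact hAL
    have h4 := Subgroup.card_mul_card_le_card_sup_mul_card_inf (A.subgroupOf G₃) (L.subgroupOf G₃)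
    have h5 : ∀ {B : Subgroup H}, B ≤ G₃ → Nat.card (B.subgroupOf G₃) = Nat.card B := fun h =>
      Nat.card_congr (Subgroup.subgroupOfEquivOfLe h).toEquiv
    have h6 : Nat.card G₃ * Nat.card ↥(A ⊓ L) ≤ Nat.card A * Nat.card L := by
      have := Subgroup.relIndex_sup_left (H := A.subgroupOf G₃) (K := L.subgroupOf G₃)
      rw [sup_comm, hsup, Subgroup.relIndex_top_right] at this
      have h7 := (L.subgroupOf G₃).card_mul_index
      have h8 := Subgroup.card_mul_relIndex_of_le
        (inf_le_right : L.subgroupOf G₃ ⊓ A.subgroupOf G₃ ≤ A.subgroupOf G₃)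
      rw [Subgroup.inf_relIndex_right, ← this,
        show L.subgroupOf G₃ ⊓ A.subgroupOf G₃ = (A ⊓ L).subgroupOf G₃ by
          rw [inf_comm]; rfl, h5 hAG,
        h5 (inf_le_left.trans hAG)] at h8
      rw [h5 hLG] at h7
      rw [← h7, ← h8]
      apply le_of_eq; ring
    have h9 := Subgroup.card_mul_relIndex_of_le hAG
    have h10 := Subgroup.card_mul_relIndex_of_le (inf_le_right : A ⊓ L ≤ L)
    rw [Subgroup.inf_relIndex_right] at h10
    rw [← h9, ← h10] at h6
    have hp1 : 0 < Nat.card A := Nat.card_pos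
    have hp2 : 0 < Nat.card ↥(A ⊓ L) := Nat.card_pos
    refine le_of_mul_le_mul_left (a := Nat.card A * Nat.card ↥(A ⊓ L))
      ?_ (by positivity)
    calc _ = Nat.card A * A.relIndex G₃ * Nat.card ↥(A ⊓ L) := by ring
      _ ≤ _ := h6
      _ = _ := by ring
  refine hcop.trans ?_
  have h10 := Subgroup.card_mul_relIndex_of_le (inf_le_right : A ⊓ L ≤ L)
  rw [Subgroup.inf_relIndex_right] at h10
  have h11 : orderOf c ≤ Nat.card ↥(A ⊓ L) := by
    rw [← Nat.card_zpowers]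
    refine Nat.card_le_card_of_injective _ (Subgroup.inclusion_injective (H := Subgroup.zpowers c) ?_)
    rw [Subgroup.zpowers_le]
    exact ⟨hcA, hK₀ (hK' hc), hAG hcA⟩
  have h12 : 0 < orderOf c := orderOf_pos c
  refine le_of_mul_le_mul_left (a := orderOf c) ?_ h12
  calc _ ≤ Nat.card ↥(A ⊓ L) * A.relIndex L := by gcongr
    _ ≤ _ := by rw [h10, mul_comm]; exact hLcard

section OrbitCount

variable {K Y : Type*} [Group K] [MulAction K Y]

open MulAction in
/-- Burnside's lemma, with the fixed points of the identity counted orbit by orbit. -/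
theorem MulAction.sum_index_add_sum_fixedBy [Fintype K] [Fintype (orbitRel.Quotient K Y)]
    [Finite Y] [DecidableEq K] :
    ∑ ω : orbitRel.Quotient K Y, (stabilizer K (Quotient.out ω)).index +
      ∑ g ∈ Finset.univ.erase (1 : K), Nat.card (fixedBy Y g) =
    Fintype.card (orbitRel.Quotient K Y) * Nat.card K := by
  classical
  have := Fintype.ofFinite Y
  have h1 := sum_card_fixedBy_eq_card_orbits_mul_card_group K Y
  have h2 : ∑ ω : orbitRel.Quotient K Y, (stabilizer K (Quotient.out ω)).index = Nat.card Y := by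
    rw [Nat.card_congr (selfEquivSigmaOrbits K Y), Nat.card_sigma]
    refine Finset.sum_congr rfl fun ω _ => ?_
    rw [index_stabilizer, Set.ncard_def, Nat.card_coe_set_eq]
    rfl
  rw [Nat.card_eq_fintype_card]
  refine Eq.trans ?_ (h1.trans ?_)
  · rw [h2, ← Finset.add_sum_erase _ _ (Finset.mem_univ (1 : K))]
    congr 1
    · simp [fixedBy_one_eq_univ]
    · exact Finset.sum_congr rfl fun _ _ => Nat.card_eq_fintype_card
  · rfl

open MulAction in
/-- The set of elements of exponent `p` fixing a point, when it is a subgroup. -/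
def MulAction.unipotentStabilizer (p : ℕ) (y : Y)
    (h : ∀ g ∈ stabilizer K y, ∀ g' ∈ stabilizer K y, g ^ p = 1 → g' ^ p = 1 → (g * g') ^ p = 1) :
    Subgroup K where
  carrier := {g | g ∈ stabilizer K y ∧ g ^ p = 1}
  mul_mem' := fun ha hb => ⟨mul_mem ha.1 hb.1, h _ ha.1 _ hb.1 ha.2 hb.2⟩
  one_mem' := ⟨one_mem _, one_pow p⟩
  inv_mem' := fun ha => ⟨inv_mem ha.1, by rw [inv_pow, ha.2, inv_one]⟩

open MulAction in
open scoped Pointwise in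
/-- The wild orbit: points fixed by elements of order `p` form a single orbit. -/
theorem MulAction.exists_wild_orbit {p : ℕ} [hp : Fact p.Prime] [Finite K] [Finite Y]
    (H1 : ∀ g : K, g ≠ 1 → (g ^ p = 1 ∧ Nat.card (fixedBy Y g) = 1) ∨
      (¬ p ∣ orderOf g ∧ Nat.card (fixedBy Y g) = 2))
    (H2 : ∀ y : Y, ∀ g ∈ stabilizer K y, ∀ g' ∈ stabilizer K y,
      g ^ p = 1 → g' ^ p = 1 → (g * g') ^ p = 1)
    (hN : p ∣ Nat.card K) :
    ∃ x : Y, ∃ n : ℕ,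
      (∀ y : Y, ∀ g ∈ stabilizer K y, g ≠ 1 → g ^ p = 1 → y ∈ orbit K x) ∧
      Nat.card (stabilizer K x) = p ^ (Nat.card K).factorization p * n ∧
      Nat.card (stabilizer K x) ≤ p ^ (Nat.card K).factorization p *
        (p ^ (Nat.card K).factorization p - 1) ∧
      Nat.card {g : K // g ≠ 1 ∧ g ^ p = 1} =
        (p ^ (Nat.card K).factorization p - 1) * (stabilizer K x).index := by
  classical
  have uniq : ∀ g : K, g ≠ 1 → g ^ p = 1 → ∀ y y' : Y, g • y = y → g • y' = y' → y = y' := by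
    intro g hg1 hgp y y' hy hy'
    rcases H1 g hg1 with h | h
    · obtain ⟨h3, -⟩ := Nat.card_eq_one_iff_unique.mp h.2
      exact congrArg Subtype.val (Subsingleton.elim (⟨y, hy⟩ : fixedBy Y g) ⟨y', hy'⟩)
    · exact absurd (orderOf_eq_prime hgp hg1 ▸ dvd_rfl) h.1
  have exf : ∀ g : K, g ≠ 1 → ∃ y : Y, g • y = y := by
    intro g hg1
    have : Nat.card (fixedBy Y g) ≠ 0 := by rcases H1 g hg1 with h | h <;> simp [h.2]
    obtain ⟨⟨y, hy⟩⟩ := (Nat.card_ne_zero.mp this).1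
    exact ⟨y, hy⟩
  have hexp : ∀ g : K, p ∣ orderOf g → g ^ p = 1 := by
    intro g hg
    have : g ≠ 1 := by rintro rfl; simp at hg; exact hp.out.ne_one hg
    rcases H1 g this with h | h
    exacts [h.1, absurd hg h.1]
  have hP : ∀ P : Sylow p K, ∃ x : Y, ∃ z ∈ P, z ≠ 1 ∧ (∀ g ∈ P, g ∈ stabilizer K x) := by
    intro P
    have hPc := P.card_eq_multiplicity
    have hPnt : Nontrivial (P : Subgroup K) := by
      rw [← Finite.one_lt_card_iff_nontrivial, hPc]
      exact Nat.one_lt_pow (hp.out.factorization_pos_of_dvd Nat.card_pos.ne' hN).ne' hp.out.one_lt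
    have := IsPGroup.center_nontrivial P.isPGroup'
    obtain ⟨⟨⟨z, hzP⟩, hzc⟩, hz1⟩ := exists_ne (1 : Subgroup.center (P : Subgroup K))
    have hz1' : z ≠ 1 := fun h => hz1 (by ext; exact h)
    obtain ⟨x, hx⟩ := exf z hz1'
    refine ⟨x, z, hzP, hz1', fun g hg => ?_⟩
    have hcom : g * z = z * g := congrArg Subtype.val (Subgroup.mem_center_iff.mp hzc ⟨g, hg⟩)
    refine uniq z hz1' (hexp z ?_) _ _ ?_ hx
    · obtain ⟨k, hk⟩ := IsPGroup.iff_orderOf.mp P.isPGroup' ⟨z, hzP⟩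
      rw [Subgroup.orderOf_mk] at hk
      rw [hk]
      refine dvd_pow_self p ?_
      rintro rfl
      exact hz1' (orderOf_eq_one_iff.mp (by simpa using hk))
    · rw [← mul_smul, ← hcom, mul_smul, hx]
  obtain ⟨P⟩ : Nonempty (Sylow p K) := inferInstance
  obtain ⟨x, z, hzP, hz1, hPx⟩ := hP P
  have pexp : ∀ g ∈ P, g ^ p = 1 := by
    intro g hg
    obtain ⟨k, hk⟩ := IsPGroup.iff_orderOf.mp P.isPGroup' ⟨g, hg⟩
    rw [Subgroup.orderOf_mk] at hk
    rcases k with _ | k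
    · rw [pow_zero, orderOf_eq_one_iff] at hk
      rw [hk, one_pow]
    · exact hexp g (hk ▸ dvd_pow_self p k.succ_ne_zero)
  have wild : ∀ y : Y, ∀ g ∈ stabilizer K y, g ≠ 1 → g ^ p = 1 → ∃ s : K, s • x = y := by
    intro y g hgy hg1 hgp
    have hpg : IsPGroup p (Subgroup.zpowers g) := by
      refine IsPGroup.of_card (n := 1) ?_
      rw [Nat.card_zpowers, orderOf_eq_prime hgp hg1, pow_one]
    obtain ⟨Q, hQ⟩ := hpg.exists_le_sylow
    obtain ⟨s, rfl⟩ := MulAction.exists_smul_eq K P Q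
    have h1 : g ∈ (s • P : Sylow p K) := hQ (Subgroup.mem_zpowers g)
    have h2 : s⁻¹ * g * s ∈ (P : Subgroup K) := by
      have h3 : g ∈ MulAut.conj s • (P : Subgroup K) := h1
      rw [Subgroup.mem_pointwise_smul_iff_inv_smul_mem] at h3
      simpa [MulAut.smul_def] using h3
    refine ⟨s, uniq g hg1 hgp _ _ ?_ hgy⟩
    have h4 := hPx _ h2
    rw [mem_stabilizer_iff, mul_smul, mul_smul, inv_smul_eq_iff] at h4
    exact h4
  set N := unipotentStabilizer p x (H2 x) with hNdef
  have hPN : (P : Subgroup K) = N := by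
    refine (P.is_maximal' (Q := N) (fun g => ⟨1, ?_⟩) fun g hg => ⟨hPx g hg, pexp g hg⟩).symm
    rw [pow_one]
    exact Subtype.ext g.2.2
  set q := p ^ (Nat.card K).factorization p with hq
  have hNc : Nat.card N = q := by rw [← hPN, P.card_eq_multiplicity]
  have hNs : N ≤ stabilizer K x := fun g hg => hg.1
  obtain ⟨n, hn⟩ := Subgroup.card_dvd_of_le hNs
  have hN1 : Nat.card {v : N // v ≠ 1} = q - 1 := by
    have := Fintype.ofFinite N
    rw [Nat.card_eq_fintype_card, Fintype.card_subtype_compl, Fintype.card_subtype_eq,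
      ← Nat.card_eq_fintype_card, hNc]
  have hcent : ∀ b ∈ stabilizer K x, b * z = z * b → b ∈ N := by
    intro b hb hbz
    refine ⟨hb, ?_⟩
    by_cases hb1 : b = 1
    · rw [hb1, one_pow]
    rcases H1 b hb1 with h | h
    · exact h.1
    · exfalso
      obtain ⟨u, v, huv, huniv⟩ := Nat.card_eq_two_iff.mp h.2
      have hall : ∀ w : Y, b • w = w → w = u ∨ w = v := fun w hw => by
        have : (⟨w, hw⟩ : fixedBy Y b) ∈ ({u, v} : Set _) := huniv ▸ Set.mem_univ _
        rcases this with h | h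
        exacts [Or.inl (congrArg Subtype.val h), Or.inr (congrArg Subtype.val h)]
      have huv' : (u : Y) ≠ v := fun h => huv (Subtype.ext h)
      have hz : ∀ w : Y, b • w = w → b • z • w = z • w := fun w hw => by
        rw [← mul_smul, hbz, mul_smul, hw]
      have hzx : z • x = x := hPx z hzP
      have hzp := pexp z hzP
      rcases hall x hb with hx | hx
      · rcases hall _ (hz v v.2) with h' | h'
        · rw [← hx, ← hzx, smul_left_cancel_iff, hx] at h'
          exact huv' h'.symm
        · exact huv' (hx ▸ uniq z hz1 hzp x v hzx h')
      · rcases hall _ (hz u u.2) with h' | h'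
        · exact huv' (hx ▸ uniq z hz1 hzp u x h' hzx)
        · rw [← hx, ← hzx, smul_left_cancel_iff, hx] at h'
          exact huv' h'
  refine ⟨x, n, fun y g hgy hg1 hgp => ?_, by rw [hn, hNc], ?_, ?_⟩
  · obtain ⟨s, hs⟩ := wild y g hgy hg1 hgp
    exact ⟨s, hs⟩
  · have hzN : z ∈ N := hPN ▸ hzP
    let f : stabilizer K x → {v : N // v ≠ 1} := fun s =>
      ⟨⟨s * z * (s : K)⁻¹, mul_mem (mul_mem s.2 hzN.1) (inv_mem s.2), by
        rw [conj_pow, hzN.2, mul_one, mul_inv_cancel]⟩, fun h => hz1 (by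
        simpa using congrArg Subtype.val h)⟩
    have hfib : ∀ s t, f s = f t → ((t : K)⁻¹ * s) ∈ N := by
      intro s t hst
      refine hcent _ (mul_mem (inv_mem t.2) s.2) ?_
      have : (s : K) * z * (s : K)⁻¹ = t * z * (t : K)⁻¹ :=
        congrArg Subtype.val (congrArg Subtype.val hst)
      rw [mul_inv_eq_iff_eq_mul] at this
      rw [mul_assoc, this]
      group
    let F : stabilizer K x → N × {v : N // v ≠ 1} := fun s =>
      ⟨⟨((Function.invFun f (f s) : stabilizer K x) : K)⁻¹ * s,
        hfib _ _ (Function.invFun_eq ⟨s, rfl⟩).symm⟩, f s⟩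
    have hF : Function.Injective F := by
      intro s t hst
      have h1 : f s = f t := congrArg Prod.snd hst
      have h2 := congrArg Subtype.val (congrArg Prod.fst hst)
      simp only [F, h1] at h2
      exact Subtype.ext (mul_left_cancel h2)
    have := Nat.card_le_card_of_injective F hF
    rwa [Nat.card_prod, hNc, hN1] at this
  · let T : orbit K x → Type _ := fun y => {g : K // (g ≠ 1 ∧ g ^ p = 1) ∧ g • (y : Y) = y}
    let e : (Σ y : orbit K x, T y) → {g : K // g ≠ 1 ∧ g ^ p = 1} := fun a => ⟨a.2.1, a.2.2.1⟩
    have he : Function.Bijective e := by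
      constructor
      · rintro ⟨⟨y, hy⟩, g, hg, hgy⟩ ⟨⟨y', hy'⟩, g', hg', hgy'⟩ h
        obtain rfl : g = g' := congrArg Subtype.val h
        obtain rfl : y = y' := uniq g hg.1 hg.2 _ _ hgy hgy'
        rfl
      · rintro ⟨g, hg⟩
        obtain ⟨y, hy⟩ := exf g hg.1
        exact ⟨⟨⟨y, wild y g hy hg.1 hg.2⟩, g, hg, hy⟩, rfl⟩
    rw [← Nat.card_congr (Equiv.ofBijective e he)]
    have := Fintype.ofFinite (orbit K x)
    rw [Nat.card_sigma]
    have hT : ∀ y, Nat.card (T y) = q - 1 := by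
      rintro ⟨_, s, rfl⟩
      rw [← hN1]
      refine Nat.card_congr
        { toFun := fun g => ⟨⟨s⁻¹ * g.1 * s, ?_, ?_⟩, fun h => g.2.1.1 ?_⟩
          invFun := fun v => ⟨s * v.1.1 * s⁻¹, ⟨fun h => v.2 (Subtype.ext ?_), ?_⟩, ?_⟩
          left_inv := fun g => by ext; simp [mul_assoc]
          right_inv := fun g => by ext; simp [mul_assoc] }
      · have := g.2.2
        rw [mem_stabilizer_iff, mul_smul, mul_smul, inv_smul_eq_iff]
        exact this
      · have := conj_pow (i := p) (a := s⁻¹) (b := g.1)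
        rw [inv_inv] at this
        rw [this, g.2.1.2]; simp
      · have : s⁻¹ * g.1 * s = 1 := congrArg Subtype.val h
        simpa [mul_assoc, inv_mul_eq_one, eq_comm] using this
      · simpa using h
      · rw [conj_pow, v.1.2.2]; simp
      · have : v.1.1 • x = x := v.1.2.1
        simp [mul_smul, this]
    rw [Finset.sum_congr rfl fun y _ => hT y, Finset.sum_const, Finset.card_univ,
      index_stabilizer, smul_eq_mul, mul_comm, Set.ncard_def, ← Nat.card_eq_fintype_card,
      Nat.card_coe_set_eq]
    rfl

theorem wild_orbit_arith {q q' n m n₁ : ℕ} (hN : q * n * m = n₁ * (2 + q' * m))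
    (hq' : 0 < q') (hm : 0 < m) (hn₁ : 0 < n₁) (hqn : q * n ≤ q * q) :
    q * n * m ≤ 60 * q ^ 4 := by
  have h1 : n₁ ≤ q * n := by
    refine Nat.le_of_mul_le_mul_right (hN ▸ Nat.mul_le_mul_left _ ?_) hm
    exact (Nat.le_mul_of_pos_left m hq').trans (Nat.le_add_left _ _)
  have h2 : m ≤ 2 * n₁ := by
    have h3 : n₁ * q' < q * n := by
      by_contra! h
      have := Nat.mul_le_mul_right m h
      rw [hN, mul_add, mul_assoc] at this
      omega
    have h4 : (n₁ * q' + 1) * m ≤ q * n * m := Nat.mul_le_mul_right _ h3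
    rw [hN] at h4
    linarith
  have h5 : m ≤ 2 * (q * q) := by omega
  calc q * n * m ≤ (q * q) * (2 * (q * q)) := Nat.mul_le_mul hqn h5
    _ = 2 * q ^ 4 := by ring
    _ ≤ 60 * q ^ 4 := Nat.mul_le_mul_right _ (by norm_num)

theorem wild_orbit_arith_one {q q' n m : ℕ}
    (hN : 0 + m + 2 * (q * n * m) = (0 + 1) * (q * n * m) + 2 + (q' + 1) * m) (hq : q = q' + 2)
    (hn : 0 < n) : q * n * m ≤ 60 * q ^ 4 := by
  have h1 : q * m ≤ q * n * m := Nat.mul_le_mul_right _ (Nat.le_mul_of_pos_right _ hn)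
  have h2 : q * n * m ≤ q := by
    have h3 : m ≤ 1 := by
      rw [hq] at h1 hN
      linarith
    have h4 : q' * m ≤ q' * 1 := Nat.mul_le_mul_left _ h3
    linarith
  calc _ ≤ q := h2
    _ ≤ q ^ 4 := Nat.le_self_pow (by norm_num) q
    _ ≤ 60 * q ^ 4 := Nat.le_mul_of_pos_left _ (by norm_num)

theorem tame_orbit_arith {N a b c : ℕ} (ha : a ∣ N) (hb : b ∣ N) (hc : c ∣ N)
    (ha2 : 2 * a ≤ N) (hb2 : 2 * b ≤ N) (hc2 : 2 * c ≤ N) (hab : b ≤ a) (hbc : c ≤ b)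
    (h : a + b + c = N + 2) (hN : 0 < N) : c ≤ 2 ∨ N ≤ 60 := by
  obtain ⟨x, rfl⟩ := ha
  obtain ⟨y, hy⟩ := hb
  obtain ⟨z, hz⟩ := hc
  by_contra! hcon
  have hx2 : 2 ≤ x := by
    by_contra! h
    interval_cases x <;> omega
  have hx3 : x < 3 := by
    by_contra! h
    have : a * 3 ≤ a * x := Nat.mul_le_mul_left _ h
    omega
  obtain rfl : x = 2 := by omega
  have hy4 : y < 4 := by
    by_contra! h
    have : b * 4 ≤ b * y := Nat.mul_le_mul_left _ h
    omega
  have hz6 : z < 6 := by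
    by_contra! h
    have h1 : c * 6 ≤ c * z := Nat.mul_le_mul_left _ h
    interval_cases y <;> omega
  interval_cases y <;> interval_cases z <;> omega

open MulAction in
theorem MulAction.card_le_or_exists_index_le_two_of_finite {p : ℕ} [hp : Fact p.Prime]
    [Finite K] [Finite Y] [Nontrivial K]
    (H0 : ∀ y : Y, stabilizer K y ≠ ⊥)
    (H1 : ∀ g : K, g ≠ 1 → (g ^ p = 1 ∧ Nat.card (fixedBy Y g) = 1) ∨
      (¬ p ∣ orderOf g ∧ Nat.card (fixedBy Y g) = 2))
    (H2 : ∀ y : Y, ∀ g ∈ stabilizer K y, ∀ g' ∈ stabilizer K y,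
      g ^ p = 1 → g' ^ p = 1 → (g * g') ^ p = 1) :
    Nat.card K ≤ 60 * (p ^ (Nat.card K).factorization p) ^ 4 ∨
      ∃ y : Y, (stabilizer K y).index ≤ 2 ∧ ∀ g ∈ stabilizer K y, g ^ p = 1 → g = 1 := by
  classical
  have := Fintype.ofFinite K
  have := Fintype.ofFinite (orbitRel.Quotient K Y)
  set N := Nat.card K with hNdef
  set q := p ^ N.factorization p with hqdef
  have hNpos : 1 < N := Finite.one_lt_card
  have hqpos : 0 < q := pow_pos hp.out.pos _
  let s : orbitRel.Quotient K Y → ℕ := fun ω => (stabilizer K (Quotient.out ω)).index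
  have hs1 : ∀ ω, s ω ∣ N := fun ω => Subgroup.index_dvd_card _
  have hs2 : ∀ ω, 2 * s ω ≤ N := by
    intro ω
    have h1 := (stabilizer K (Quotient.out ω)).card_mul_index
    have h2 := (Subgroup.one_lt_card_iff_ne_bot _).mpr (H0 (Quotient.out ω))
    calc _ ≤ _ := Nat.mul_le_mul_right _ h2
      _ = N := h1
  have hs0 : ∀ ω, 0 < s ω := fun ω => Nat.pos_of_ne_zero Subgroup.index_ne_zero_of_finite
  have hsum := sum_index_add_sum_fixedBy (K := K) (Y := Y)
  change ∑ ω, s ω + _ = _ at hsum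
  rw [← hNdef] at hsum
  set W := Nat.card {g : K // g ≠ 1 ∧ g ^ p = 1} with hW
  have hfix : ∑ g ∈ Finset.univ.erase (1 : K), Nat.card (fixedBy Y g) + W = 2 * (N - 1) := by
    have hW' : W = ∑ g ∈ Finset.univ.erase (1 : K), if g ^ p = 1 then 1 else 0 := by
      rw [hW, Nat.card_eq_fintype_card, Fintype.card_subtype, Finset.sum_ite, Finset.sum_const_zero,
        add_zero, Finset.sum_const, smul_eq_mul, mul_one]
      congr 1
      ext g
      simp
    rw [hW', ← Finset.sum_add_distrib, Finset.sum_congr rfl (g := fun _ => 2), Finset.sum_const,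
      Finset.card_erase_of_mem (Finset.mem_univ _), Finset.card_univ, ← Nat.card_eq_fintype_card,
      smul_eq_mul, mul_comm]
    intro g hg
    rcases H1 g (Finset.ne_of_mem_erase hg) with h | h
    · simp [h.1, h.2]
    · rw [h.2, if_neg]
      intro h'
      exact h.1 (orderOf_eq_prime h' (Finset.ne_of_mem_erase hg) ▸ dvd_rfl)
  by_cases hpN : p ∣ N
  · obtain ⟨x, n, hwild, hst, hst', hWx⟩ := exists_wild_orbit H1 H2 hpN
    set m := (stabilizer K x).index with hm
    have hcm : Nat.card (stabilizer K x) * m = N := (stabilizer K x).card_mul_index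
    let ω₀ : orbitRel.Quotient K Y := ⟦x⟧
    have hs₀ : s ω₀ = m := by
      have h1 : Quotient.out ω₀ ∈ orbit K x := orbitRel_apply.mp (Quotient.mk_out (s := orbitRel K Y) x)
      obtain ⟨g, hg⟩ := h1
      change (stabilizer K (Quotient.out ω₀)).index = m
      rw [hm, ← hg, index_stabilizer, index_stabilizer]
      exact congrArg Set.ncard (orbit_smul g x)
    have hWx' : W = (q - 1) * m := hWx
    rw [hst] at hcm
    have hmpos : 0 < m := hs₀ ▸ hs0 ω₀
    rw [← Finset.add_sum_erase _ _ (Finset.mem_univ ω₀), hs₀] at hsum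
    have hq2 : 2 ≤ q := by
      have h1 : N.factorization p ≠ 0 :=
        (hp.out.factorization_pos_of_dvd (by omega) hpN).ne'
      calc 2 ≤ p := hp.out.two_le
        _ = p ^ 1 := (pow_one p).symm
        _ ≤ q := Nat.pow_le_pow_right hp.out.pos (by omega)
    obtain ⟨q', hq'⟩ : ∃ q', q = q' + 2 := ⟨q - 2, by omega⟩
    have hnpos : 0 < n := by
      rcases Nat.eq_zero_or_pos n with h | h
      · rw [h] at hcm
        simp at hcm
        omega
      · exact h
    have hst2 : q * n ≤ q * q := (hst ▸ hst').trans (Nat.mul_le_mul_left _ (Nat.sub_le _ _))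
    have hqW : q - 1 = q' + 1 := by omega
    rw [hqW] at hWx'
    set T := Finset.univ.erase ω₀ with hT
    have hcard : Fintype.card (orbitRel.Quotient K Y) = T.card + 1 := by
      rw [hT, Finset.card_erase_add_one (Finset.mem_univ _), Finset.card_univ]
    have hsum2 : ∑ ω ∈ T, s ω + m + 2 * N = (T.card + 1) * N + 2 + (q' + 1) * m := by
      rw [← hWx', ← hcard]
      omega
    obtain hc | hc | hc : T.card = 0 ∨ T.card = 1 ∨ 2 ≤ T.card := by omega
    · left
      rw [hc, Finset.card_eq_zero.mp hc, Finset.sum_empty] at hsum2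
      have := wild_orbit_arith_one (hcm.symm ▸ hsum2 : 0 + m + 2 * (q * n * m) = _) hq' hnpos
      rwa [hcm] at this
    · obtain ⟨ω₁, hω₁⟩ := Finset.card_eq_one.mp hc
      have hne : ω₁ ≠ ω₀ := Finset.ne_of_mem_erase (hT ▸ hω₁ ▸ Finset.mem_singleton_self ω₁)
      rw [hc, hω₁, Finset.sum_singleton] at hsum2
      have hs₁ : s ω₁ = 2 + q' * m := by linarith
      rcases Nat.eq_zero_or_pos q' with h0 | h0
      · right
        refine ⟨Quotient.out ω₁, by change s ω₁ ≤ 2; simp [hs₁, h0], fun g hg hgp => ?_⟩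
        by_contra hg1
        have h1 := hwild _ g hg hg1 hgp
        exact hne (by rw [← Quotient.out_eq ω₁]; exact Quotient.sound (orbitRel_apply.mpr h1))
      · left
        obtain ⟨n₁, hn₁⟩ := hs1 ω₁
        have hN0 : q * n * m = n₁ * (2 + q' * m) := by rw [hcm, hn₁, hs₁, mul_comm]
        have hn₁0 : 0 < n₁ := by
          rcases Nat.eq_zero_or_pos n₁ with h | h
          · simp [h] at hn₁; omega
          · exact h
        exact hcm.symm.trans_le (wild_orbit_arith hN0 h0 hmpos hn₁0 hst2)
    · exfalso
      have h1 : ∑ ω ∈ T, 2 * s ω ≤ ∑ ω ∈ T, N := Finset.sum_le_sum fun ω _ => hs2 ω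
      rw [← Finset.mul_sum, Finset.sum_const, smul_eq_mul] at h1
      obtain ⟨t, ht⟩ := Nat.exists_eq_add_of_le hc
      rw [ht] at h1 hsum2
      nlinarith [Nat.zero_le (t * N), Nat.zero_le (q' * m)]
  · have hnop : ∀ g : K, g ^ p = 1 → g = 1 := by
      intro g hg
      by_contra h
      exact hpN (orderOf_eq_prime hg h ▸ orderOf_dvd_natCard g)
    have hW0 : W = 0 := by
      rw [hW, Nat.card_eq_zero]
      exact Or.inl ⟨fun g => g.2.1 (hnop _ g.2.2)⟩
    suffices N ≤ 60 ∨ ∃ ω, s ω ≤ 2 by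
      rcases this with h | ⟨ω, h⟩
      · left
        exact h.trans (Nat.le_mul_of_pos_right _ (by positivity))
      · exact Or.inr ⟨_, h, fun g _ => hnop g⟩
    by_contra! hcon
    have hr : Fintype.card (orbitRel.Quotient K Y) < 4 := by
      have h1 : ∑ ω, 2 * s ω ≤ ∑ ω : orbitRel.Quotient K Y, N := Finset.sum_le_sum fun ω _ => hs2 ω
      rw [← Finset.mul_sum, Finset.sum_const, Finset.card_univ, smul_eq_mul] at h1
      by_contra! h
      have := Nat.mul_le_mul_right N h
      omega
    rw [← Finset.card_univ] at hr hsum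
    have h3 : ∀ ω, 3 ≤ s ω := fun ω => hcon.2 ω
    obtain hc | hc | hc | hc : (Finset.univ : Finset (orbitRel.Quotient K Y)).card = 0 ∨
        (Finset.univ : Finset (orbitRel.Quotient K Y)).card = 1 ∨
        (Finset.univ : Finset (orbitRel.Quotient K Y)).card = 2 ∨
        (Finset.univ : Finset (orbitRel.Quotient K Y)).card = 3 := by omega
    · rw [hc] at hsum
      omega
    · obtain ⟨a, ha⟩ := Finset.card_eq_one.mp hc
      rw [hc, ha, Finset.sum_singleton] at hsum
      have := h3 a
      omega
    · obtain ⟨a, b, hab, ha⟩ := Finset.card_eq_two.mp hc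
      rw [hc, ha, Finset.sum_pair hab] at hsum
      have := h3 a
      have := h3 b
      omega
    · obtain ⟨a, b, c, hab, hac, hbc, ha⟩ := Finset.card_eq_three.mp hc
      rw [hc, ha, Finset.sum_insert (by simp [hab, hac]), Finset.sum_pair hbc] at hsum
      have hsum' : s a + (s b + s c) = N + 2 := by omega
      have h3a := h3 a
      have h3b := h3 b
      have h3c := h3 c
      rcases le_total (s a) (s b) with h | h <;> rcases le_total (s b) (s c) with h' | h' <;>
        rcases le_total (s a) (s c) with h'' | h''
      all_goals first
        | (have := tame_orbit_arith (hs1 a) (hs1 b) (hs1 c) (hs2 a) (hs2 b) (hs2 c) ‹_› ‹_›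
            (by omega) (by omega); omega)
        | (have := tame_orbit_arith (hs1 a) (hs1 c) (hs1 b) (hs2 a) (hs2 c) (hs2 b) ‹_› ‹_›
            (by omega) (by omega); omega)
        | (have := tame_orbit_arith (hs1 b) (hs1 a) (hs1 c) (hs2 b) (hs2 a) (hs2 c) ‹_› ‹_›
            (by omega) (by omega); omega)
        | (have := tame_orbit_arith (hs1 b) (hs1 c) (hs1 a) (hs2 b) (hs2 c) (hs2 a) ‹_› ‹_›
            (by omega) (by omega); omega)
        | (have := tame_orbit_arith (hs1 c) (hs1 a) (hs1 b) (hs2 c) (hs2 a) (hs2 b) ‹_› ‹_›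
            (by omega) (by omega); omega)
        | (have := tame_orbit_arith (hs1 c) (hs1 b) (hs1 a) (hs2 c) (hs2 b) (hs2 a) ‹_› ‹_›
            (by omega) (by omega); omega)

/-- The points with nontrivial stabilizer. -/
def SubMulAction.nontrivialStabilizer (K Y : Type*) [Group K] [MulAction K Y] : SubMulAction K Y where
  carrier := {y | MulAction.stabilizer K y ≠ ⊥}
  smul_mem' g y hy := by
    intro h
    apply hy
    rw [MulAction.stabilizer_smul_eq_stabilizer_map_conj] at h
    exact (Subgroup.map_eq_bot_iff_of_injective _ (MulAut.conj g).injective).mp h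

open MulAction in
/-- A finite group acting so that each nontrivial element either is `p`-torsion with one fixed
point, or is `p`-regular with two fixed points, is small compared to its Sylow `p`-subgroup unless
it has a subgroup of index at most two which fixes a point and has no `p`-torsion. -/
theorem MulAction.card_le_or_exists_index_le_two {p : ℕ} [hp : Fact p.Prime]
    [Finite K] [Nontrivial K]
    (H1 : ∀ g : K, g ≠ 1 → (g ^ p = 1 ∧ Nat.card (fixedBy Y g) = 1) ∨
      (¬ p ∣ orderOf g ∧ Nat.card (fixedBy Y g) = 2))
    (H2 : ∀ y : Y, ∀ g ∈ stabilizer K y, ∀ g' ∈ stabilizer K y,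
      g ^ p = 1 → g' ^ p = 1 → (g * g') ^ p = 1) :
    Nat.card K ≤ 60 * (p ^ (Nat.card K).factorization p) ^ 4 ∨
      ∃ y : Y, (stabilizer K y).index ≤ 2 ∧ ∀ g ∈ stabilizer K y, g ^ p = 1 → g = 1 := by
  let X := SubMulAction.nontrivialStabilizer K Y
  have hstab : ∀ x : X, stabilizer K x = stabilizer K (x : Y) := fun x =>
    SubMulAction.stabilizer_of_subMul x
  have hmem : ∀ g : K, g ≠ 1 → ∀ y ∈ fixedBy Y g, y ∈ X := by
    intro g hg y hy h
    have : g ∈ stabilizer K y := hy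
    rw [h] at this
    exact hg this
  have hfin : Finite X := by
    have h1 : (⋃ g ∈ {g : K | g ≠ 1}, fixedBy Y g).Finite := by
      refine Set.Finite.biUnion (Set.toFinite _) fun g hg => ?_
      refine Set.finite_coe_iff.mp (Nat.finite_of_card_ne_zero ?_)
      rcases H1 g hg with h | h <;> rw [h.2] <;> norm_num
    refine (h1.subset fun y hy => ?_).to_subtype
    obtain ⟨g, hg⟩ := Subgroup.ne_bot_iff_exists_ne_one.mp (hy : stabilizer K y ≠ ⊥)
    exact Set.mem_biUnion (fun h => hg (Subtype.ext h)) g.2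
  have hfix : ∀ g : K, g ≠ 1 → Nat.card (fixedBy X g) = Nat.card (fixedBy Y g) := fun g hg =>
    Nat.card_congr ⟨fun x => ⟨x.1.1, congrArg Subtype.val x.2⟩,
      fun y => ⟨⟨y.1, hmem g hg y.1 y.2⟩, Subtype.ext y.2⟩, fun _ => rfl, fun _ => rfl⟩
  rcases card_le_or_exists_index_le_two_of_finite (K := K) (Y := X) (p := p)
    (fun x => by rw [hstab]; exact x.2) (fun g hg => by rw [hfix g hg]; exact H1 g hg)
    (fun x => by rw [hstab]; exact H2 x.1) with h | ⟨x, hx⟩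
  · exact Or.inl h
  · rw [hstab] at hx
    exact Or.inr ⟨x.1, hx⟩

end OrbitCount

section Moebius

namespace Matrix.GeneralLinearGroup

variable {F : Type*} [Field F]

theorem mem_center_fin_two_iff {A : GL (Fin 2) F} :
    A ∈ Subgroup.center (GL (Fin 2) F) ↔ A 1 0 = 0 ∧ A 0 1 = 0 ∧ A 0 0 = A 1 1 := by
  rw [mem_center_iff_val_mem_range_scalar]
  constructor
  · rintro ⟨a, ha⟩
    simp [← ha]
  · rintro ⟨h1, h2, h3⟩
    refine ⟨A 0 0, ?_⟩
    ext i j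
    fin_cases i <;> fin_cases j <;> simp [h1, h2, h3]

theorem smul_eq_self_of_mem_center [DecidableEq F] {A : GL (Fin 2) F}
    (hA : A ∈ Subgroup.center (GL (Fin 2) F)) (x : OnePoint F) : A • x = x := by
  obtain ⟨h1, h2, h3⟩ := mem_center_fin_two_iff.mp hA
  have h4 : A 1 1 ≠ 0 := by
    intro h
    apply A.det_ne_zero
    rw [Matrix.det_fin_two]
    simp [h1, h]
  cases x with
  | infty => exact OnePoint.smul_infty_eq_self_iff.mpr h1
  | coe c => simp [OnePoint.smul_some_eq_ite, h1, h2, h3, h4, mul_div_cancel_left₀]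

theorem exists_smul_infty_eq [DecidableEq F] (y : OnePoint F) :
    ∃ h : GL (Fin 2) F, h • (OnePoint.infty : OnePoint F) = y := by
  cases y with
  | infty => exact ⟨1, one_smul _ _⟩
  | coe c =>
    refine ⟨mkOfDetNeZero !![c, 1; 1, 0] (by simp), ?_⟩
    rw [OnePoint.smul_infty_eq_ite]
    simp [mkOfDetNeZero]

theorem pow_apply_of_upperTriangular {B : GL (Fin 2) F} (hB : B 1 0 = 0) (n : ℕ) :
    (B ^ n) 1 0 = 0 ∧ (B ^ n) 0 0 = B 0 0 ^ n ∧ (B ^ n) 1 1 = B 1 1 ^ n := by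
  induction n with
  | zero => simp
  | succ n ih =>
    rw [pow_succ, coe_mul]
    simp only [Matrix.mul_apply, Fin.sum_univ_two, hB, ih.1, ih.2.1, ih.2.2]
    refine ⟨by ring, by ring, by ring⟩

theorem pow_apply_zero_one {B : GL (Fin 2) F} (hB : B 1 0 = 0) (hB' : B 0 0 = B 1 1) (n : ℕ) :
    (B ^ n) 0 1 * B 1 1 = n * B 1 1 ^ n * B 0 1 := by
  induction n with
  | zero => simp
  | succ n ih =>
    rw [pow_succ, coe_mul, Matrix.mul_apply, Fin.sum_univ_two,
      (pow_apply_of_upperTriangular hB n).2.1, hB', add_mul, ih]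
    push_cast
    ring

theorem mul_apply_one_zero {B C : GL (Fin 2) F} (hB : B 1 0 = 0) (hC : C 1 0 = 0) :
    (B * C) 1 0 = 0 := by
  rw [coe_mul, Matrix.mul_apply, Fin.sum_univ_two, hB, hC, zero_mul, mul_zero, add_zero]

theorem mul_apply_of_upperTriangular {B C : GL (Fin 2) F} (hB : B 1 0 = 0) (hC : C 1 0 = 0) :
    (B * C) 0 0 = B 0 0 * C 0 0 ∧ (B * C) 1 1 = B 1 1 * C 1 1 := by
  rw [coe_mul, Matrix.mul_apply, Matrix.mul_apply, Fin.sum_univ_two, Fin.sum_univ_two, hB, hC]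
  constructor <;> ring

theorem apply_ne_zero_of_upperTriangular {B : GL (Fin 2) F} (hB : B 1 0 = 0) :
    B 0 0 ≠ 0 ∧ B 1 1 ≠ 0 := by
  have := B.det_ne_zero
  rw [Matrix.det_fin_two, hB, mul_zero, sub_zero] at this
  exact mul_ne_zero_iff.mp this

theorem pow_char_mem_center {p : ℕ} [CharP F p] {B : GL (Fin 2) F} (hB : B 1 0 = 0)
    (hB' : B 0 0 = B 1 1) : B ^ p ∈ Subgroup.center (GL (Fin 2) F) := by
  have h := pow_apply_of_upperTriangular hB p
  have h' := pow_apply_zero_one hB hB' p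
  rw [CharP.cast_eq_zero F p, zero_mul, zero_mul] at h'
  exact mem_center_fin_two_iff.mpr ⟨h.1,
    (mul_eq_zero.mp h').resolve_right (apply_ne_zero_of_upperTriangular hB).2, by rw [h.2.1, h.2.2, hB']⟩

theorem pow_mem_center_of_pow_mul_mem_center {p : ℕ} [Fact p.Prime] [CharP F p]
    {B : GL (Fin 2) F} (hB : B 1 0 = 0) (hB' : B 0 0 ≠ B 1 1) {n : ℕ}
    (h : B ^ (n * p) ∈ Subgroup.center (GL (Fin 2) F)) : B ^ n ∈ Subgroup.center (GL (Fin 2) F) := by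
  have h1 := (mem_center_fin_two_iff.mp h).2.2
  rw [(pow_apply_of_upperTriangular hB _).2.1, (pow_apply_of_upperTriangular hB _).2.2, pow_mul,
    pow_mul] at h1
  have h2 : B 0 0 ^ n = B 1 1 ^ n := frobenius_inj F p h1
  have h3 := pow_apply_of_upperTriangular hB n
  rw [← h3.2.1, ← h3.2.2] at h2
  refine mem_center_fin_two_iff.mpr ⟨h3.1, ?_, h2⟩
  have h4 : (B ^ n * B) 0 1 = (B * B ^ n) 0 1 := by rw [← pow_succ, pow_succ']
  rw [coe_mul, coe_mul, Matrix.mul_apply, Matrix.mul_apply, Fin.sum_univ_two, Fin.sum_univ_two] at h4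
  have h5 : (B ^ n) 0 1 * (B 0 0 - B 1 1) = 0 := by
    linear_combination B 0 1 * h2 - h4
  exact (mul_eq_zero.mp h5).resolve_right (sub_ne_zero.mpr hB')

theorem smul_coe_eq_self_iff_of_upperTriangular [DecidableEq F] {B : GL (Fin 2) F}
    (hB : B 1 0 = 0) (c : F) :
    B • (c : OnePoint F) = c ↔ B 0 0 * c + B 0 1 = c * B 1 1 := by
  have h := (apply_ne_zero_of_upperTriangular hB).2
  rw [OnePoint.smul_some_eq_ite, hB, zero_mul, zero_add, if_neg h, OnePoint.coe_eq_coe,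
    div_eq_iff h]

theorem card_fixedPoints_of_upperTriangular_of_eq [DecidableEq F] {B : GL (Fin 2) F}
    (hB : B 1 0 = 0) (hB' : B 0 0 = B 1 1) (hBc : B ∉ Subgroup.center (GL (Fin 2) F)) :
    {y : OnePoint F | B • y = y}.ncard = 1 := by
  rw [Set.ncard_eq_one]
  refine ⟨OnePoint.infty, Set.ext fun y => ?_⟩
  cases y with
  | infty => simp [OnePoint.smul_infty_eq_self_iff, hB]
  | coe c =>
    simp only [Set.mem_ofPred_eq, smul_coe_eq_self_iff_of_upperTriangular hB,
      Set.mem_singleton_iff, OnePoint.coe_ne_infty, iff_false]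
    intro h
    refine hBc (mem_center_fin_two_iff.mpr ⟨hB, ?_, hB'⟩)
    rw [hB'] at h
    linear_combination h

theorem card_fixedPoints_of_upperTriangular_of_ne [DecidableEq F] {B : GL (Fin 2) F}
    (hB : B 1 0 = 0) (hB' : B 0 0 ≠ B 1 1) :
    {y : OnePoint F | B • y = y}.ncard = 2 := by
  rw [Set.ncard_eq_two]
  refine ⟨OnePoint.infty, ((B 0 1 / (B 1 1 - B 0 0) : F) : OnePoint F), OnePoint.infty_ne_coe _,
    Set.ext fun y => ?_⟩
  have h0 : B 1 1 - B 0 0 ≠ 0 := sub_ne_zero.mpr hB'.symm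
  cases y with
  | infty => simp [OnePoint.smul_infty_eq_self_iff, hB]
  | coe c =>
    simp only [Set.mem_ofPred_eq, smul_coe_eq_self_iff_of_upperTriangular hB, Set.mem_insert_iff,
      Set.mem_singleton_iff, OnePoint.coe_ne_infty, OnePoint.coe_eq_coe, false_or, eq_div_iff h0]
    constructor <;> intro h <;> linear_combination -h

theorem exists_smul_eq_self [IsAlgClosed F] [DecidableEq F] (A : GL (Fin 2) F) :
    ∃ y : OnePoint F, A • y = y := by
  by_cases h : A 1 0 = 0
  · exact ⟨_, OnePoint.smul_infty_eq_self_iff.mpr h⟩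
  · obtain ⟨c, hc⟩ := IsAlgClosed.exists_root A.fixpointPolynomial (by
      rw [fixpointPolynomial, sub_eq_add_neg, ← Polynomial.C_neg, Polynomial.degree_quadratic h]
      norm_num)
    refine ⟨c, fixpointPolynomial_aeval_eq_zero_iff.mp ?_⟩
    rwa [Polynomial.coe_aeval_eq_eval]

theorem exists_conj_upperTriangular [DecidableEq F] (y : OnePoint F) :
    ∃ h : GL (Fin 2) F, ∀ A : GL (Fin 2) F, (A • y = y ↔ (h⁻¹ * A * h) 1 0 = 0) ∧
      {y : OnePoint F | A • y = y}.ncard = {y : OnePoint F | (h⁻¹ * A * h) • y = y}.ncard := by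
  obtain ⟨h, rfl⟩ := exists_smul_infty_eq y
  refine ⟨h, fun A => ⟨?_, ?_⟩⟩
  · rw [← OnePoint.smul_infty_eq_self_iff, mul_smul, mul_smul, inv_smul_eq_iff]
  · rw [← Set.ncard_image_of_injective _ (MulAction.injective (h⁻¹ : GL (Fin 2) F))]
    congr 1
    ext y
    simp only [Set.mem_image, Set.mem_ofPred_eq]
    constructor
    · rintro ⟨x, hx, rfl⟩
      simp [mul_smul, hx]
    · intro hy
      refine ⟨h • y, ?_, by simp⟩
      rwa [mul_smul, mul_smul, inv_smul_eq_iff] at hy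

theorem conj_mem_center_iff {G : Type*} [Group G] {A h : G} :
    h⁻¹ * A * h ∈ Subgroup.center G ↔ A ∈ Subgroup.center G := by
  constructor
  · intro hA
    have := Subgroup.Normal.conj_mem inferInstance _ hA h
    simpa [mul_assoc] using this
  · intro hA
    have := Subgroup.Normal.conj_mem inferInstance _ hA h⁻¹
    simpa [mul_assoc] using this

theorem conj_inv_pow {G : Type*} [Group G] (A h : G) (n : ℕ) :
    (h⁻¹ * A * h) ^ n = h⁻¹ * A ^ n * h := by
  simpa using conj_pow (i := n) (a := h⁻¹) (b := A)

theorem card_fixedPoints_eq_one_or_two {p : ℕ} [Fact p.Prime] [CharP F p] [IsAlgClosed F]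
    [DecidableEq F] (A : GL (Fin 2) F) (hA : A ∉ Subgroup.center (GL (Fin 2) F)) :
    (A ^ p ∈ Subgroup.center (GL (Fin 2) F) ∧ {y : OnePoint F | A • y = y}.ncard = 1) ∨
    ((∀ n, A ^ (n * p) ∈ Subgroup.center (GL (Fin 2) F) →
      A ^ n ∈ Subgroup.center (GL (Fin 2) F)) ∧ {y : OnePoint F | A • y = y}.ncard = 2) := by
  obtain ⟨y, hy⟩ := exists_smul_eq_self A
  obtain ⟨h, hh⟩ := exists_conj_upperTriangular y
  have hB := (hh A).1.mp hy
  rw [(hh A).2]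
  by_cases hB' : (h⁻¹ * A * h) 0 0 = (h⁻¹ * A * h) 1 1
  · left
    refine ⟨?_, card_fixedPoints_of_upperTriangular_of_eq hB hB' (conj_mem_center_iff.not.mpr hA)⟩
    rw [← conj_mem_center_iff (h := h), ← conj_inv_pow]
    exact pow_char_mem_center hB hB'
  · right
    refine ⟨fun n hn => ?_, card_fixedPoints_of_upperTriangular_of_ne hB hB'⟩
    rw [← conj_mem_center_iff (h := h), ← conj_inv_pow] at hn ⊢
    exact pow_mem_center_of_pow_mul_mem_center hB hB' hn

open ProjGenLinGroup in
theorem mk_eq_mk_iff_mem_center {A B : GL (Fin 2) F} :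
    ProjGenLinGroup.mk A = ProjGenLinGroup.mk B ↔ A⁻¹ * B ∈ Subgroup.center (GL (Fin 2) F) := by
  rw [← ProjGenLinGroup.mk_eq_one, map_mul, map_inv, inv_mul_eq_one]

open MulAction in
theorem card_le_or_exists_character {p : ℕ} [hp : Fact p.Prime] [CharP F p] [IsAlgClosed F]
    {N : Type*} [Group N] [Finite N] (ρ : N →* ProjGenLinGroup (Fin 2) F) (hρ : Function.Injective ρ) :
    Nat.card N ≤ 60 * (p ^ (Nat.card N).factorization p) ^ 4 ∨
      ∃ T : Subgroup N, T.index ≤ 2 ∧ ∃ χ : T →* F, Function.Injective χ ∧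
        ∀ (g : T) (A : GL (Fin 2) F), ProjGenLinGroup.mk A = ρ g →
          A.val.trace ^ 2 = A.val.det * (χ g + (χ g)⁻¹ + 2) := by
  classical
  rcases subsingleton_or_nontrivial N with hN | hN
  · left
    rw [Nat.card_unique]
    have : 0 < p := hp.out.pos
    exact Nat.mul_pos (by norm_num) (by positivity)
  choose A hA using fun g => ProjGenLinGroup.mk_surjective (ρ g)
  have hone : ∀ g, A g ∈ Subgroup.center (GL (Fin 2) F) ↔ g = 1 := fun g => by
    rw [← ProjGenLinGroup.mk_eq_one, hA, map_eq_one_iff ρ hρ]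
  have hsmul : ∀ (B C : GL (Fin 2) F), ProjGenLinGroup.mk B = ProjGenLinGroup.mk C →
      ∀ y : OnePoint F, B • y = C • y := fun B C h y => by
    rw [← inv_smul_eq_iff, ← inv_inv C, ← mul_smul]
    refine smul_eq_self_of_mem_center ?_ y
    rw [← ProjGenLinGroup.mk_eq_one, inv_inv, map_mul, map_inv, h, inv_mul_cancel]
  let : MulAction N (OnePoint F) :=
    { smul := fun g y => A g • y
      one_smul := fun y => smul_eq_self_of_mem_center ((hone 1).mpr rfl) y
      mul_smul := fun g g' y => by
        change A (g * g') • y = A g • A g' • y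
        rw [← mul_smul]
        exact hsmul _ _ (by rw [map_mul, hA, hA, hA, map_mul]) y }
  have hpow : ∀ g (n : ℕ), A g ^ n ∈ Subgroup.center (GL (Fin 2) F) ↔ g ^ n = 1 := fun g n => by
    rw [← ProjGenLinGroup.mk_eq_one, map_pow, hA, ← map_pow, map_eq_one_iff ρ hρ]
  have key : ∀ y : OnePoint F, ∃ χ : stabilizer N y →* F, (∀ g, χ g = 1 ↔ (g : N) ^ p = 1) ∧
      ∀ (g : stabilizer N y) (A : GL (Fin 2) F), ProjGenLinGroup.mk A = ρ g →
        A.val.trace ^ 2 = A.val.det * (χ g + (χ g)⁻¹ + 2) := by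
    intro y
    obtain ⟨h, hh⟩ := exists_conj_upperTriangular y
    have hB : ∀ g : stabilizer N y, (h⁻¹ * A g * h) 1 0 = 0 := fun g => (hh _).1.mp g.2
    have hB' := fun g => apply_ne_zero_of_upperTriangular (hB g)
    have hmul : ∀ g g' : stabilizer N y, ∃ z ∈ Subgroup.center (GL (Fin 2) F),
        (h⁻¹ * A g * h) * (h⁻¹ * A g' * h) * z = h⁻¹ * A (g * g' : stabilizer N y) * h := by
      intro g g'
      refine ⟨_, mk_eq_mk_iff_mem_center.mp ?_, mul_inv_cancel_left _ _⟩
      simp only [map_mul, hA, Subgroup.coe_mul, map_inv]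
      group
    refine ⟨⟨⟨fun g => (h⁻¹ * A g * h) 0 0 / (h⁻¹ * A g * h) 1 1, ?_⟩, ?_⟩, ?_, ?_⟩
    · have h1 : h⁻¹ * A (1 : stabilizer N y) * h ∈ Subgroup.center _ :=
        conj_mem_center_iff.mpr ((hone _).mpr rfl)
      rw [(mem_center_fin_two_iff.mp h1).2.2, div_self (hB' 1).2]
    · intro g g'
      obtain ⟨z, hz, hz'⟩ := hmul g g'
      obtain ⟨h1, h2⟩ := mul_apply_of_upperTriangular (hB g) (hB g')
      obtain ⟨h3, h4⟩ := mul_apply_of_upperTriangular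
        (mul_apply_one_zero (hB g) (hB g')) (mem_center_fin_two_iff.mp hz).1
      have h5 := (apply_ne_zero_of_upperTriangular (mem_center_fin_two_iff.mp hz).1).2
      change (h⁻¹ * A (g * g' : stabilizer N y) * h) 0 0 / (h⁻¹ * A (g * g' : stabilizer N y) * h) 1 1 = _
      rw [← hz', h3, h4, h1, h2, (mem_center_fin_two_iff.mp hz).2.2, mul_div_mul_right _ _ h5,
        mul_div_mul_comm]
    · intro g
      change (h⁻¹ * A g * h) 0 0 / (h⁻¹ * A g * h) 1 1 = 1 ↔ _
      rw [div_eq_one_iff_eq (hB' g).2, ← hpow, ← conj_mem_center_iff (h := h), ← conj_inv_pow]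
      refine ⟨pow_char_mem_center (hB g), fun h1 => ?_⟩
      have h2 := (mem_center_fin_two_iff.mp h1).2.2
      rw [(pow_apply_of_upperTriangular (hB g) p).2.1,
        (pow_apply_of_upperTriangular (hB g) p).2.2] at h2
      exact frobenius_inj F p h2
    · intro g C hC
      change _ = _ * ((h⁻¹ * A g * h) 0 0 / (h⁻¹ * A g * h) 1 1 +
        ((h⁻¹ * A g * h) 0 0 / (h⁻¹ * A g * h) 1 1)⁻¹ + 2)
      obtain ⟨z, hz, hz'⟩ : ∃ z ∈ Subgroup.center (GL (Fin 2) F),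
          (h⁻¹ * A g * h) * z = h⁻¹ * C * h := by
        refine ⟨_, mk_eq_mk_iff_mem_center.mp ?_, mul_inv_cancel_left _ _⟩
        simp only [map_mul, hA, map_inv, hC]
      have h1 : (h⁻¹ * C * h).val.trace = C.val.trace := by
        rw [mul_assoc, coe_mul, Matrix.trace_mul_comm, ← coe_mul, mul_assoc, mul_inv_cancel, mul_one]
      have h2 : (h⁻¹ * C * h).val.det = C.val.det := by
        rw [mul_assoc, coe_mul, Matrix.det_mul_comm, ← coe_mul, mul_assoc, mul_inv_cancel, mul_one]
      obtain ⟨h3, h4⟩ := mul_apply_of_upperTriangular (hB g) (mem_center_fin_two_iff.mp hz).1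
      have h5 := mul_apply_one_zero (hB g) (mem_center_fin_two_iff.mp hz).1
      rw [← h1, ← h2, ← hz', Matrix.trace_fin_two, Matrix.det_fin_two, h3, h4, h5,
        (mem_center_fin_two_iff.mp hz).2.2]
      obtain ⟨h6, h7⟩ := hB' g
      generalize ((h⁻¹ * A g * h : GL (Fin 2) F) : Matrix (Fin 2) (Fin 2) F) 0 0 = a at h6 ⊢
      generalize ((h⁻¹ * A g * h : GL (Fin 2) F) : Matrix (Fin 2) (Fin 2) F) 1 1 = d at h7 ⊢
      field_simp
      ring
  have H1 : ∀ g : N, g ≠ 1 → (g ^ p = 1 ∧ Nat.card (fixedBy (OnePoint F) g) = 1) ∨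
      (¬ p ∣ orderOf g ∧ Nat.card (fixedBy (OnePoint F) g) = 2) := by
    intro g hg
    have hc : Nat.card (fixedBy (OnePoint F) g) = {y : OnePoint F | A g • y = y}.ncard := rfl
    rw [hc, ← hpow]
    refine (card_fixedPoints_eq_one_or_two (p := p) (A g) ((hone g).not.mpr hg)).imp_right
      fun h => ⟨fun ⟨n, hn⟩ => ?_, h.2⟩
    have h1 := h.1 n ((hpow _ _).mpr (by rw [mul_comm, ← hn, pow_orderOf_eq_one]))
    rw [hpow] at h1
    have h2 := orderOf_dvd_of_pow_eq_one h1
    have h3 := orderOf_pos g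
    have h4 := hp.out.two_le
    rw [hn] at h2 h3
    have := Nat.le_of_dvd (Nat.pos_of_mul_pos_left h3) h2
    nlinarith [Nat.pos_of_mul_pos_left h3]
  have H2 : ∀ y : OnePoint F, ∀ g ∈ stabilizer N y, ∀ g' ∈ stabilizer N y,
      g ^ p = 1 → g' ^ p = 1 → (g * g') ^ p = 1 := by
    intro y g hg g' hg' hgp hgp'
    obtain ⟨χ, hχ, -⟩ := key y
    have h1 := (hχ ⟨g, hg⟩).mpr hgp
    have h2 := (hχ ⟨g', hg'⟩).mpr hgp'
    exact (hχ (⟨g, hg⟩ * ⟨g', hg'⟩)).mp (by rw [map_mul, h1, h2, one_mul])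
  rcases MulAction.card_le_or_exists_index_le_two (K := N) (Y := OnePoint F) (p := p) H1 H2 with
    h | ⟨y, hy, hyp⟩
  · exact Or.inl h
  · right
    obtain ⟨χ, hχ, hχ'⟩ := key y
    refine ⟨stabilizer N y, hy, χ, ?_, hχ'⟩
    rw [injective_iff_map_eq_one]
    exact fun g hg => Subtype.ext (hyp g g.2 ((hχ g).mp hg))

end Matrix.GeneralLinearGroup
end Moebius

theorem Subgroup.centralizer_index_le_two_of_conj {G : Type*} [Group G] {c : G}
    (h : ∀ g : G, g * c * g⁻¹ = c ∨ g * c * g⁻¹ = c⁻¹) : (Subgroup.centralizer {c}).index ≤ 2 := by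
  have h1 : Nat.card (G ⧸ Subgroup.centralizer {c}) ≤ Nat.card ({c, c⁻¹} : Set G) := by
    refine Nat.card_le_card_of_injective (fun q => ⟨q.out * c * q.out⁻¹, by simpa using h q.out⟩) ?_
    intro q q' hq
    have h2 : q.out * c * q.out⁻¹ = q'.out * c * q'.out⁻¹ := congrArg Subtype.val hq
    rw [← Quotient.out_eq' q, ← Quotient.out_eq' q']
    refine QuotientGroup.eq.mpr ?_
    rw [Subgroup.mem_centralizer_singleton_iff]
    calc q.out⁻¹ * q'.out * c = q.out⁻¹ * (q'.out * c * q'.out⁻¹) * q'.out := by group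
      _ = _ := by rw [← h2]; group
  refine h1.trans ?_
  rw [Nat.card_coe_set_eq]
  exact Set.ncard_insert_le _ _ |>.trans (by simp)

section Moebius

open Matrix.GeneralLinearGroup

variable {K M : Type*} [Field K] [Field M] [Algebra K M]

open Classical in
/-- `x` is the image of `t` under the Möbius transformation given by a matrix over `K`. -/
def IsMoebiusImage (t : M) (A : GL (Fin 2) K) (x : M) : Prop :=
  (x : OnePoint M) = A.map (algebraMap K M) • (t : OnePoint M)

theorem IsMoebiusImage.mk_eq {t x : M} (ht : Transcendental K t) {A B : GL (Fin 2) K}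
    (hA : IsMoebiusImage t A x) (hB : IsMoebiusImage t B x) :
    ProjGenLinGroup.mk A = ProjGenLinGroup.mk B := by
  classical
  rw [mk_eq_mk_iff_mem_center]
  have h : (A⁻¹ * B).map (algebraMap K M) • (t : OnePoint M) = t := by
    have hA' : (x : OnePoint M) = A.map (algebraMap K M) • (t : OnePoint M) := hA
    have hB' : (x : OnePoint M) = B.map (algebraMap K M) • (t : OnePoint M) := hB
    rw [map_mul, mul_smul, ← hB', hA', ← mul_smul, ← map_mul, inv_mul_cancel, map_one, one_smul]
  generalize A⁻¹ * B = D at h ⊢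
  rw [← fixpointPolynomial_aeval_eq_zero_iff] at h
  have h2 : D.fixpointPolynomial = 0 := by
    by_contra h3
    refine ht ⟨_, h3, ?_⟩
    rw [← h, fixpointPolynomial, fixpointPolynomial]
    simp
  rw [mem_center_iff_val_mem_range_scalar, ← fixpointPolynomial_eq_zero_iff, h2]

theorem isMoebiusImage_of_mem_center (t : M) {A : GL (Fin 2) K}
    (hA : A ∈ Subgroup.center (GL (Fin 2) K)) : IsMoebiusImage t A t := by
  classical
  rw [IsMoebiusImage]
  obtain ⟨h1, h2, h3⟩ := mem_center_fin_two_iff.mp hA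
  rw [smul_eq_self_of_mem_center]
  refine mem_center_fin_two_iff.mpr ⟨?_, ?_, ?_⟩ <;> simp [h1, h2, h3]

theorem IsMoebiusImage.eq_of_mem_center {t x : M} {A : GL (Fin 2) K} (h : IsMoebiusImage t A x)
    (hA : A ∈ Subgroup.center (GL (Fin 2) K)) : x = t :=
  OnePoint.coe_injective (h.trans (isMoebiusImage_of_mem_center t hA).symm)

theorem IsMoebiusImage.map_mul {t x y : M} {A B : GL (Fin 2) K} (hA : IsMoebiusImage t A x)
    (hB : IsMoebiusImage t B y) (f : M →+* M) (σ : K →+* K)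
    (hσ : ∀ a, f (algebraMap K M a) = algebraMap K M (σ a)) (hf : f t = y) :
    IsMoebiusImage t (A.map σ * B) (f x) := by
  classical
  rw [IsMoebiusImage] at *
  have h1 := congrArg (OnePoint.map f) hA
  rw [OnePoint.map_smul, OnePoint.map_some, OnePoint.map_some, hf, hB] at h1
  rw [h1, _root_.map_mul, mul_smul]
  congr 1
  ext i j
  simp [hσ]

theorem trace_map_fin_two {R S : Type*} [CommRing R] [CommRing S] (f : R →+* S)
    (A : GL (Fin 2) R) : (A.map f).val.trace = f A.val.trace := by
  simp [Matrix.trace_fin_two]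

theorem det_map_fin_two {R S : Type*} [CommRing R] [CommRing S] (f : R →+* S)
    (A : GL (Fin 2) R) : (A.map f).val.det = f A.val.det := by
  simp [Matrix.det_fin_two]

theorem exists_card_le_centralizer_index_le_two {p : ℕ} [hp : Fact p.Prime] [CharP K p] {t : M}
    (ht : Transcendental K t) {G : Type*} [Group G] [Finite G] [MulSemiringAction G M]
    (σ : G → (K →+* K)) (hσ : ∀ g a, g • algebraMap K M a = algebraMap K M (σ g a))
    (N : Subgroup G) [N.Normal] (hN : ∀ g ∈ N, ∀ a, σ g a = a)
    (hinj : ∀ g ∈ N, g • t = t → g = 1)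
    (hgen : ∀ g : G, ∃ A : GL (Fin 2) K, IsMoebiusImage t A (g • t))
    (hfix : ∀ g (a : K) (z : AlgebraicClosure K) (n : ℕ), 0 < n → z ^ n = 1 →
      algebraMap K (AlgebraicClosure K) a = z + z⁻¹ → σ g a = a) :
    ∃ c ∈ N, Nat.card N ≤ 60 * (p ^ (Nat.card N).factorization p) ^ 4 * orderOf c ∧
      (Subgroup.centralizer {c}).index ≤ 2 := by
  classical
  choose A hA using hgen
  have hcomp : ∀ g h B C, IsMoebiusImage t B (g • t) → IsMoebiusImage t C (h • t) →
      IsMoebiusImage t (C.map (σ g) * B) ((g * h) • t) := fun g h B C hB hC => by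
    rw [mul_smul]
    exact hC.map_mul hB (MulSemiringAction.toRingHom G M g) (σ g) (hσ g) rfl
  have hmapid : ∀ g ∈ N, ∀ B : GL (Fin 2) K, B.map (σ g) = B := fun g hg B => by
    ext i j
    simp [hN g hg]
  have : CharP (AlgebraicClosure K) p := charP_of_injective_algebraMap
    (algebraMap K (AlgebraicClosure K)).injective p
  let ρ : N →* ProjGenLinGroup (Fin 2) (AlgebraicClosure K) :=
    MonoidHom.mk' (fun g =>
      ProjGenLinGroup.mk ((A (g : G)⁻¹).map (algebraMap K (AlgebraicClosure K)))) fun g h => by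
        rw [← map_mul, ← map_mul, ← ProjGenLinGroup.map_mk, ← ProjGenLinGroup.map_mk]
        congr 1
        refine (hA _).mk_eq ht ?_
        have := hcomp _ _ _ _ (hA (h : G)⁻¹) (hA (g : G)⁻¹)
        rwa [hmapid _ (inv_mem h.2), ← _root_.mul_inv_rev] at this
  have hρ : Function.Injective ρ := by
    rw [injective_iff_map_eq_one]
    intro g hg
    have h1 := mem_center_fin_two_iff.mp (ProjGenLinGroup.mk_eq_one.mp hg)
    have h2 : A (g : G)⁻¹ ∈ Subgroup.center _ := by
      rw [mem_center_fin_two_iff]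
      simpa using h1
    exact Subtype.ext (inv_eq_one.mp (hinj _ (inv_mem g.2) ((hA _).eq_of_mem_center h2)))
  rcases card_le_or_exists_character (p := p) ρ hρ with h | ⟨T, hT, χ, hχ, hχ'⟩
  · refine ⟨1, one_mem _, by rwa [orderOf_one, mul_one], ?_⟩
    exact Subgroup.centralizer_index_le_two_of_conj fun g => by simp
  have hcyc : IsCyclic T := isCyclic_of_injective_ringHom χ hχ
  obtain ⟨c, hc⟩ := IsCyclic.exists_generator (α := T)
  have hTsq : ∀ g : N, g ^ 2 ∈ T := by
    intro g
    have h0 : T.index ≠ 0 := Subgroup.index_ne_zero_of_finite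
    obtain h | h : T.index = 1 ∨ T.index = 2 := by omega
    · rw [Subgroup.index_eq_one.mp h]
      trivial
    · exact Subgroup.sq_mem_of_index_two h g
  have hord : orderOf ((c : N) : G) = Nat.card T := by
    rw [Subgroup.orderOf_coe, Subgroup.orderOf_coe, orderOf_eq_card_of_forall_mem_zpowers hc]
  refine ⟨((c ^ 2 : T) : N), SetLike.coe_mem _, ?_, ?_⟩
  · have h1 : orderOf ((c : N) : G) ≤ 2 * orderOf (((c : N) : G) ^ 2) := by
      refine Nat.le_of_dvd (Nat.mul_pos two_pos (orderOf_pos _)) ?_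
      rw [orderOf_dvd_iff_pow_eq_one, pow_mul, pow_orderOf_eq_one]
    have h2 : Nat.card T * T.index = Nat.card N := T.card_mul_index
    have h3 : Nat.card N ≤ 4 * orderOf (((c : N) : G) ^ 2) := by
      rw [← h2, ← hord]
      calc _ ≤ 2 * orderOf (((c : N) : G) ^ 2) * 2 := Nat.mul_le_mul h1 hT
        _ = _ := by ring
    refine h3.trans (Nat.mul_le_mul_right _ ?_)
    have : 0 < p ^ (Nat.card N).factorization p := pow_pos hp.out.pos _
    nlinarith [pow_pos this 4]
  · refine Subgroup.centralizer_index_le_two_of_conj fun g => ?_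
    have hcN : ((c : N) : G) ∈ N := SetLike.coe_mem _
    let u : T := ⟨⟨g * (c : N) * g⁻¹, Subgroup.Normal.conj_mem inferInstance _ hcN g⟩ ^ 2, hTsq _⟩
    have hu : ((u : N) : G) = g * ((c ^ 2 : T) : N) * g⁻¹ := by
      simp [u, conj_pow]
    rw [← hu]
    suffices u = c ^ 2 ∨ u = (c ^ 2)⁻¹ from
      this.imp (fun h => by rw [h]) (fun h => by rw [h]; simp)
    set C := A (((c ^ 2 : T) : N) : G)⁻¹ with hC
    have h1 := hχ' (c ^ 2) (C.map (algebraMap K (AlgebraicClosure K))) rfl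
    have hU : IsMoebiusImage t ((A g⁻¹ * C).map (σ g) * A g) (((u : N) : G)⁻¹ • t) := by
      have h2 := hcomp _ _ _ _ (hA (((c ^ 2 : T) : N) : G)⁻¹) (hA g⁻¹)
      rw [hmapid _ (inv_mem (SetLike.coe_mem _))] at h2
      have h3 := hcomp _ _ _ _ (hA g) h2
      rwa [show g * ((((c ^ 2 : T) : N) : G)⁻¹ * g⁻¹) = ((u : N) : G)⁻¹ by rw [hu]; group] at h3
    have hB : ProjGenLinGroup.mk ((A g⁻¹).map (σ g)) = (ProjGenLinGroup.mk (A g))⁻¹ := by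
      have h2 := hcomp _ _ _ _ (hA g) (hA g⁻¹)
      rw [mul_inv_cancel, one_smul] at h2
      have h3 := h2.mk_eq ht (isMoebiusImage_of_mem_center t (one_mem _))
      rwa [map_mul, map_one, mul_eq_one_iff_eq_inv] at h3
    have hmk : ProjGenLinGroup.mk (((A g)⁻¹ * C.map (σ g) * A g).map
        (algebraMap K (AlgebraicClosure K))) = ρ u := by
      change _ = ProjGenLinGroup.mk ((A ((u : N) : G)⁻¹).map _)
      rw [← ProjGenLinGroup.map_mk, ← ProjGenLinGroup.map_mk, (hA _).mk_eq ht hU]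
      simp only [map_mul, map_inv, hB]
    have h2 := hχ' u _ hmk
    have htr : ((A g)⁻¹ * C.map (σ g) * A g).val.trace = σ g C.val.trace := by
      rw [mul_assoc, GeneralLinearGroup.coe_mul, Matrix.trace_mul_comm,
        ← GeneralLinearGroup.coe_mul, mul_assoc, mul_inv_cancel, mul_one,
        trace_map_fin_two]
    have hdet : ((A g)⁻¹ * C.map (σ g) * A g).val.det = σ g C.val.det := by
      rw [mul_assoc, GeneralLinearGroup.coe_mul, Matrix.det_mul_comm,
        ← GeneralLinearGroup.coe_mul, mul_assoc, mul_inv_cancel, mul_one,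
        det_map_fin_two]
    rw [trace_map_fin_two, det_map_fin_two] at h1 h2
    rw [htr, hdet] at h2
    have hC0 : C.val.det ≠ 0 := C.det_ne_zero
    have hχ0 : ∀ g, χ g ≠ 0 := fun g => left_ne_zero_of_mul_eq_one (b := χ g⁻¹) (by
      rw [← map_mul, mul_inv_cancel, map_one])
    have h3 : algebraMap K (AlgebraicClosure K) (C.val.trace ^ 2 / C.val.det - 2) =
        χ (c ^ 2) + (χ (c ^ 2))⁻¹ := by
      rw [map_sub, map_div₀, map_pow, h1, mul_div_cancel_left₀ _ (by simpa using hC0), map_ofNat]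
      ring
    have h4 := hfix g _ _ (orderOf (c ^ 2)) (orderOf_pos _)
      (by rw [← map_pow, pow_orderOf_eq_one, map_one]) h3
    have h5 : algebraMap K (AlgebraicClosure K) (σ g (C.val.trace ^ 2 / C.val.det - 2)) =
        χ u + (χ u)⁻¹ := by
      rw [map_sub, map_div₀, map_pow, map_sub, map_div₀, map_pow, h2,
        mul_div_cancel_left₀ _ (by simpa using hC0), map_ofNat, map_ofNat]
      ring
    rw [h4, h3] at h5
    have h6 : (χ u - χ (c ^ 2)) * (χ u * χ (c ^ 2) - 1) = 0 := by
      have hu0 := hχ0 u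
      have hc0 := hχ0 (c ^ 2)
      field_simp at h5
      linear_combination -h5
    rcases mul_eq_zero.mp h6 with h | h
    · exact Or.inl (hχ (sub_eq_zero.mp h))
    · right
      rw [eq_inv_iff_mul_eq_one]
      exact hχ (by rw [map_mul, map_one, sub_eq_zero.mp h])

end Moebius

section Moebius

open Matrix.GeneralLinearGroup

theorem RatFunc.exists_isMoebiusImage {K : Type*} [Field K] {x : RatFunc K}
    (hx : IntermediateField.adjoin K {x} = ⊤) :
    ∃ A : GL (Fin 2) K, IsMoebiusImage (RatFunc.X : RatFunc K) A x := by
  classical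
  have h1 : max x.num.natDegree x.denom.natDegree = 1 := by
    rw [← RatFunc.finrank_eq_max_natDegree, hx, IntermediateField.finrank_top]
  obtain ⟨a, b, hnum⟩ := Polynomial.exists_eq_X_add_C_of_natDegree_le_one
    ((le_max_left _ _).trans h1.le)
  obtain ⟨c, d, hden⟩ := Polynomial.exists_eq_X_add_C_of_natDegree_le_one
    ((le_max_right _ _).trans h1.le)
  have hx' := x.num_div_denom
  rw [hnum, hden] at hx'
  have hden0 := x.denom_ne_zero
  rw [hden] at hden0
  have hdet : a * d - b * c ≠ 0 := by
    intro h
    suffices ∃ e, x = RatFunc.C e by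
      obtain ⟨e, rfl⟩ := this
      simp at h1
    rcases eq_or_ne c 0 with rfl | hc
    · have hd : d ≠ 0 := by
        rintro rfl
        simp at hden0
      have ha : a = 0 := by simpa [hd] using h
      refine ⟨b / d, ?_⟩
      rw [← hx', ha]
      simp
    · refine ⟨a / c, ?_⟩
      rw [← hx', div_eq_iff ((RatFunc.algebraMap_ne_zero hden0)), map_div₀, div_mul_eq_mul_div,
        eq_div_iff (by simpa using hc), ← RatFunc.algebraMap_C, ← RatFunc.algebraMap_C, ← map_mul,
        ← map_mul]
      congr 1
      have h' := congrArg Polynomial.C h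
      simp only [map_sub, map_mul, map_zero] at h'
      linear_combination -h'
  refine ⟨mkOfDetNeZero !![a, b; c, d] (by simpa [Matrix.det_fin_two] using hdet), ?_⟩
  rw [IsMoebiusImage, OnePoint.smul_some_eq_ite, if_neg]
  · rw [OnePoint.coe_eq_coe, ← hx']
    simp [mkOfDetNeZero, RatFunc.algebraMap_eq_C]
  · intro h
    apply hden0
    apply RatFunc.algebraMap_injective K
    simpa [mkOfDetNeZero, RatFunc.algebraMap_eq_C] using h

end Moebius

section LocalRingAction

open IsLocalRing

variable {p : ℕ} [Fact p.Prime] {O : Type*} [CommRing O] [IsLocalRing O]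
  {G : Type*} [Group G] [MulSemiringAction G O]

/-- Elements of order prime to `p` acting trivially on the graded pieces act trivially. -/
lemma smul_eq_of_smul_mul_sub_mem_pow [IsNoetherianRing O] [CharP O p] {u : O}
    (hu : maximalIdeal O = Ideal.span {u}) {h : G} {m : ℕ} (hm : h ^ m = 1) (hpm : ¬ p ∣ m)
    (htriv : ∀ a : O, h • a - a ∈ maximalIdeal O) {c : O} (hc : h • u = c * u)
    (hc1 : c - 1 ∈ maximalIdeal O) (a : O) : h • a = a := by
  have hgr : ∀ i (b : O), b ∈ maximalIdeal O ^ i → h • b - b ∈ maximalIdeal O ^ (i + 1) := by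
    intro i b hb
    rw [hu, Ideal.span_singleton_pow, Ideal.mem_span_singleton'] at hb
    obtain ⟨b, rfl⟩ := hb
    have hci : c ^ i - 1 ∈ maximalIdeal O := by
      obtain ⟨d, hd⟩ := sub_one_dvd_pow_sub_one c i
      rw [hd]
      exact Ideal.mul_mem_right _ _ hc1
    have h1 : h • (b * u ^ i) - b * u ^ i
        = ((h • b - b) * c ^ i + b * (c ^ i - 1)) * u ^ i := by
      rw [smul_mul', smul_pow', hc]; ring
    rw [h1, pow_succ']
    refine Ideal.mul_mem_mul (Ideal.add_mem _ (Ideal.mul_mem_right _ _ (htriv b))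
      (Ideal.mul_mem_left _ _ hci)) ?_
    rw [hu]
    exact Ideal.pow_mem_pow (Ideal.mem_span_singleton_self u) i
  have hmem : ∀ i, h • a - a ∈ maximalIdeal O ^ (i + 1) := by
    intro i
    induction i with
    | zero => simpa using htriv a
    | succ i ih =>
      have hj : ∀ j : ℕ, h ^ j • a - a - j * (h • a - a) ∈ maximalIdeal O ^ (i + 2) := by
        intro j
        induction j with
        | zero => simp
        | succ j ihj =>
          have h1 : h ^ (j + 1) • a - a - ((j + 1 : ℕ) : O) * (h • a - a)
              = (h • (h ^ j • a - a) - (h ^ j • a - a))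
                + (h ^ j • a - a - j * (h • a - a)) := by
            rw [pow_succ', mul_smul, smul_sub]; push_cast; ring
          rw [h1]
          refine Ideal.add_mem _ (hgr (i + 1) _ ?_) ihj
          have h2 := Ideal.add_mem _ (Ideal.pow_le_pow_right (by omega) ihj)
            (Ideal.mul_mem_left _ (j : O) ih)
          simpa using h2
      have h3 := hj m
      rw [hm, one_smul, sub_self, zero_sub, neg_mem_iff] at h3
      have hmu : IsUnit (m : O) := by
        have : IsUnit ((m : ZMod p)) :=
          ((ZMod.isUnit_iff_coprime m p).2
            (((Fact.out : p.Prime).coprime_iff_not_dvd.2 hpm).symm))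
        simpa using this.map (ZMod.castHom (dvd_refl p) O)
      exact (Ideal.unit_mul_mem_iff_mem _ hmu).1 h3
  have hbot : h • a - a ∈ (⨅ i : ℕ, maximalIdeal O ^ i) := by
    rw [Ideal.mem_iInf]
    intro i
    exact Ideal.pow_le_pow_right (by omega) (hmem i)
  rw [Ideal.iInf_pow_eq_bot_of_isLocalRing _ (maximalIdeal.isMaximal O).ne_top] at hbot
  exact sub_eq_zero.1 hbot

/-- A group of automorphisms of a local domain with principal maximal ideal, acting trivially on
the residue field, has a character whose kernel consists of elements of `p`-power order up to
elements acting trivially. -/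
theorem IsLocalRing.exists_character_of_smul_sub_mem [IsDomain O] [IsNoetherianRing O] [CharP O p]
    [Finite G] (hprin : (maximalIdeal O).IsPrincipal)
    (htriv : ∀ (g : G) (a : O), g • a - a ∈ maximalIdeal O) :
    ∃ χ : G →* (ResidueField O)ˣ, (∀ g ∈ χ.ker, ∃ n, ∀ a : O, g ^ p ^ n • a = a) ∧
      ∀ g : G, (∀ a : O, g • a = a) → g ∈ χ.ker := by
  obtain ⟨u, hu⟩ := hprin
  change maximalIdeal O = Ideal.span {u} at hu
  have hc : ∀ g : G, ∃ c : O, g • u = c * u := by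
    intro g
    have h1 : g • u ∈ maximalIdeal O := by
      have := Ideal.add_mem _ (htriv g u) (hu ▸ Ideal.mem_span_singleton_self u)
      simpa using this
    rw [hu, Ideal.mem_span_singleton'] at h1
    obtain ⟨c, hc⟩ := h1
    exact ⟨c, hc.symm⟩
  choose c hc using hc
  have key : ∀ (g : G) (c : O), g • u = c * u → c - 1 ∈ maximalIdeal O →
      ∃ n, ∀ a : O, g ^ p ^ n • a = a := by
    intro g c hc hc1
    obtain ⟨n, m, hpm, hnm⟩ := Nat.exists_eq_pow_mul_and_not_dvd
      (orderOf_pos g).ne' p (Fact.out : p.Prime).ne_one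
    have hpow : ∀ i : ℕ, ∃ d : O, g ^ i • u = d * u ∧ d - 1 ∈ maximalIdeal O := by
      intro i
      induction i with
      | zero => exact ⟨1, by simp, by simp⟩
      | succ i ih =>
        obtain ⟨d, hd, hd1⟩ := ih
        refine ⟨(g • d) * c, ?_, ?_⟩
        · rw [pow_succ', mul_smul, hd, smul_mul', hc, mul_assoc]
        · have : (g • d) * c - 1 = (g • d - d) * c + (d - 1) * c + (c - 1) := by ring
          rw [this]
          exact Ideal.add_mem _ (Ideal.add_mem _ (Ideal.mul_mem_right _ _ (htriv g d))
            (Ideal.mul_mem_right _ _ hd1)) hc1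
    obtain ⟨d, hd, hd1⟩ := hpow (p ^ n)
    refine ⟨n, smul_eq_of_smul_mul_sub_mem_pow hu (m := m) ?_ hpm (htriv _) hd hd1⟩
    rw [← pow_mul, ← hnm, pow_orderOf_eq_one]
  rcases eq_or_ne u 0 with rfl | hu0
  · exact ⟨1, fun g _ => key g 1 (by simp) (by simp), fun g _ => by simp⟩
  · have hone : c 1 = 1 := mul_right_cancel₀ hu0 (by rw [← hc, one_smul, one_mul])
    have hmul : ∀ g h, c (g * h) = (g • c h) * c g := fun g h => mul_right_cancel₀ hu0 (by
      rw [← hc, mul_smul, hc h, smul_mul', hc g, mul_assoc])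
    let χ₀ : G →* ResidueField O :=
      { toFun := fun g => residue O (c g)
        map_one' := by simp [hone]
        map_mul' := fun g h => by
          have h1 : residue O (g • c h) = residue O (c h) :=
            Ideal.Quotient.eq.2 (htriv g (c h))
          rw [hmul, map_mul, h1, mul_comm] }
    refine ⟨χ₀.toHomUnits, fun g hg => key g (c g) (hc g) ?_, fun g hg => ?_⟩
    swap
    · have h1 : c g = 1 := mul_right_cancel₀ hu0 (by rw [← hc, hg, one_mul])
      exact MonoidHom.mem_ker.2 (Units.ext (by simp [χ₀, h1]))
    have h1 : residue O (c g) = 1 := by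
      have := congrArg Units.val (MonoidHom.mem_ker.1 hg)
      simpa [χ₀] using this
    rw [← map_one (residue O)] at h1
    exact Ideal.Quotient.eq.1 h1

end LocalRingAction

section Core

open IsLocalRing IntermediateField

/-- The automorphisms of `RatFunc K` preserving the constants are given by Möbius maps. -/
lemma IsMoebiusImage.of_ringEquiv {K L : Type*} [Field K] [Field L] [Algebra K L]
    (e : RatFunc K ≃ₐ[K] L) (g : L ≃+* L)
    (hg : ∀ a : K, ∃ b : K, algebraMap K L b = g (algebraMap K L a)) :
    ∃ A : GL (Fin 2) K, IsMoebiusImage (e RatFunc.X) A (g (e RatFunc.X)) := by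
  have hC : ∀ a : K, e (RatFunc.C a) = algebraMap K L a := fun a => by
    rw [← RatFunc.algebraMap_eq_C, AlgEquiv.commutes]
  have hpol : ∀ f : Polynomial K,
      g (e (algebraMap _ (RatFunc K) f)) ∈ K⟮g (e RatFunc.X)⟯ := by
    intro f
    induction f using Polynomial.induction_on' with
    | add a b ha hb => rw [map_add, map_add, map_add]; exact add_mem ha hb
    | monomial n a =>
      rw [← Polynomial.C_mul_X_pow_eq_monomial, _root_.map_mul, _root_.map_mul,
        _root_.map_mul, _root_.map_pow, _root_.map_pow, _root_.map_pow, RatFunc.algebraMap_X,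
          RatFunc.algebraMap_C, hC]
      obtain ⟨b, hb⟩ := hg a
      rw [← hb]
      exact mul_mem (IntermediateField.algebraMap_mem _ _)
        (pow_mem (IntermediateField.mem_adjoin_simple_self _ _) _)
  have htop : K⟮g (e RatFunc.X)⟯ = ⊤ := by
    rw [eq_top_iff]
    intro y _
    obtain ⟨y, rfl⟩ := (e.toRingEquiv.trans g).surjective y
    change g (e y) ∈ _
    rw [← y.num_div_denom, map_div₀, map_div₀]
    exact div_mem (hpol _) (hpol _)
  obtain ⟨A, hA⟩ := RatFunc.exists_isMoebiusImage (x := e.symm (g (e RatFunc.X))) (by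
    have := congrArg (IntermediateField.map e.symm.toAlgHom) htop
    rw [IntermediateField.adjoin_map, Set.image_singleton] at this
    rw [show (e.symm (g (e RatFunc.X))) = e.symm.toAlgHom (g (e RatFunc.X)) from rfl, this]
    rw [← AlgHom.fieldRange_eq_map]
    exact AlgHom.fieldRange_eq_top.2 e.symm.surjective)
  refine ⟨A, ?_⟩
  classical
  rw [IsMoebiusImage] at *
  have h1 := congrArg (OnePoint.map (e : RatFunc K →+* L)) hA
  rw [OnePoint.map_smul, OnePoint.map_some, OnePoint.map_some] at h1
  simp only [RingHom.coe_coe, AlgEquiv.apply_symm_apply] at h1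
  rw [h1]
  congr 1
  ext i j
  simpa using hC (A i j)

lemma exists_algebraMap_eq_of_isAlgebraic_of_ratFunc_algEquiv {K L : Type*} [Field K] [Field L]
    [Algebra K L] (e : RatFunc K ≃ₐ[K] L) {y : L} (hy : IsAlgebraic K y) :
    ∃ b : K, algebraMap K L b = y := by
  have h1 : IsAlgebraic K (e.symm y) := hy.algHom e.symm.toAlgHom
  by_contra h
  refine RatFunc.transcendental_of_ne_C (f := e.symm y) ?_ h1
  rintro ⟨c, hc⟩
  refine h ⟨c, ?_⟩
  rw [← e.commutes, RatFunc.algebraMap_eq_C, ← hc, e.apply_symm_apply]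

/-- An automorphism of a field `L ≃ K(t)` which preserves a domain `O ⊆ K` over which `K` is
algebraic preserves `K`. -/
lemma exists_algebraMap_eq_ringEquiv_apply {O K L : Type*} [CommRing O] [IsDomain O] [Field K]
    [Field L] [Algebra K L] (e : RatFunc K ≃ₐ[K] L) [Algebra O K]
    [Algebra.IsAlgebraic O K] [FaithfulSMul O K] (g : L ≃+* L) (τ : O →+* O)
    (hτi : Function.Injective τ)
    (hτ : ∀ a, algebraMap K L (algebraMap O K (τ a)) = g (algebraMap K L (algebraMap O K a)))
    (a : K) : ∃ b : K, algebraMap K L b = g (algebraMap K L a) := by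
  apply exists_algebraMap_eq_of_isAlgebraic_of_ratFunc_algEquiv e
  obtain ⟨P, hP0, hP⟩ := Algebra.IsAlgebraic.isAlgebraic (R := O) a
  refine ⟨(P.map τ).map (algebraMap O K), ?_, ?_⟩
  · rw [Polynomial.map_ne_zero_iff (FaithfulSMul.algebraMap_injective O K),
      Polynomial.map_ne_zero_iff hτi]
    exact hP0
  · have h1 := congrArg (fun x => g (algebraMap K L x)) hP
    simp only [map_zero] at h1
    rw [← h1, Polynomial.aeval_def, Polynomial.aeval_def, Polynomial.eval₂_map,
      Polynomial.eval₂_map, Polynomial.hom_eval₂]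
    change _ = (g : L →+* L) _
    rw [Polynomial.hom_eval₂]
    congr 1
    ext x
    exact hτ x

theorem exists_isMulCommutative_index_le_of_smul_sub_mem {p : ℕ} [Fact p.Prime] {k O F K L : Type*}
    [Field k] [CommRing O] [IsDomain O] [IsLocalRing O] [IsNoetherianRing O] [Field F] [Field K]
    [Field L] [CharP k p] [Algebra k O] [Algebra k K] [Algebra O F] [IsFractionRing O F]
    [Algebra O K] [Algebra F K] [IsScalarTower O F K] [IsScalarTower k O K] [Module.Finite F K]
    (hk : ∀ x : K, IsAlgebraic k x → ∃ c, algebraMap k K c = x)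
    [Algebra K L] (e : RatFunc K ≃ₐ[K] L) (hprin : (maximalIdeal O).IsPrincipal)
    {H : Type*} [Group H] [Finite H] [MulSemiringAction H L] [FaithfulSMul H L]
    [MulSemiringAction H O]
    (hHk : ∀ (h : H) (c : k), h • algebraMap k O c = algebraMap k O c)
    (hHO : ∀ (h : H) (a : O), algebraMap K L (algebraMap O K (h • a))
      = h • algebraMap K L (algebraMap O K a))
    (htriv : ∀ (h : H) (a : O), h • a - a ∈ maximalIdeal O) :
    ∃ A : Subgroup H, IsMulCommutative A ∧ A.index ≤ 2 * (Module.finrank F K *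
      (60 * (p ^ (Nat.card H).factorization p) ^ 4) * p ^ (Nat.card H).factorization p) := by
  have hinjF := FaithfulSMul.algebraMap_injective O F
  have hOK : Function.Injective (algebraMap O K) := by
    rw [IsScalarTower.algebraMap_eq O F K]
    exact (algebraMap F K).injective.comp hinjF
  have : FaithfulSMul O K := (faithfulSMul_iff_algebraMap_injective O K).2 hOK
  have : Algebra.IsAlgebraic O F := IsLocalization.isAlgebraic F (nonZeroDivisors O)
  have : Algebra.IsAlgebraic O K := Algebra.IsAlgebraic.trans O F K
  have hKL := (algebraMap K L).injective
  have : CharP O p := charP_of_injective_algebraMap (algebraMap k O).injective p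
  have : CharP K p := charP_of_injective_algebraMap (algebraMap k K).injective p
  have hpres : ∀ (h : H) (a : K), ∃ b : K, algebraMap K L b = h • algebraMap K L a := fun h a =>
    exists_algebraMap_eq_ringEquiv_apply e (MulSemiringAction.toRingEquiv H L h)
      (MulSemiringAction.toRingHom H O h) (MulAction.injective h) (fun a => hHO h a) a
  choose s hs using hpres
  let σ : H → (K →+* K) := fun h =>
    { toFun := s h
      map_one' := hKL (by rw [hs, _root_.map_one, smul_one])
      map_mul' := fun a b => hKL (by rw [hs, _root_.map_mul, _root_.map_mul, smul_mul', hs, hs])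
      map_zero' := hKL (by rw [hs, _root_.map_zero, smul_zero])
      map_add' := fun a b => hKL (by rw [hs, _root_.map_add, _root_.map_add, smul_add, hs, hs]) }
  have hσ : ∀ (h : H) (a : K), h • algebraMap K L a = algebraMap K L (σ h a) :=
    fun h a => (hs h a).symm
  have hσO : ∀ (h : H) (a : O), σ h (algebraMap O K a) = algebraMap O K (h • a) := fun h a =>
    hKL (by rw [← hσ, hHO])
  have hσmul : ∀ (g h : H) (a : K), σ (g * h) a = σ g (σ h a) := fun g h a => hKL (by
    rw [← hσ, ← hσ, ← hσ, mul_smul])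
  have hσone : ∀ a : K, σ 1 a = a := fun a => hKL (by rw [← hσ, one_smul])
  let σH : H →* (K →+* K) := { toFun := σ, map_one' := RingHom.ext hσone,
                               map_mul' := fun g h => RingHom.ext (hσmul g h) }
  let K₀ : Subgroup H := (MulSemiringAction.toRingAut H O).ker
  have hK₀ : ∀ h, h ∈ K₀ ↔ ∀ a : O, h • a = a := fun h => by
    rw [MonoidHom.mem_ker]
    exact RingEquiv.ext_iff
  have hK₀F : ∀ h ∈ K₀, ∀ a : F, σ h (algebraMap F K a) = algebraMap F K a := by
    intro h hh a
    have : ((σ h).comp (algebraMap F K)) = algebraMap F K := by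
      apply IsFractionRing.ringHom_ext (A := O)
      intro a
      rw [RingHom.comp_apply, ← IsScalarTower.algebraMap_apply, hσO, (hK₀ h).1 hh]
    exact RingHom.congr_fun this a
  let K' : Subgroup H := σH.ker
  have hK' : ∀ h, h ∈ K' ↔ ∀ a : K, σ h a = a := fun h => by
    rw [MonoidHom.mem_ker]
    exact RingHom.ext_iff
  have hle : K' ≤ K₀ := fun h hh => (hK₀ h).2 fun a => hOK (by rw [← hσO, (hK' h).1 hh])
  obtain ⟨χ, hχ, hχ'⟩ := IsLocalRing.exists_character_of_smul_sub_mem (p := p) hprin htriv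
  obtain ⟨c, hcN, hcard, hcent⟩ := exists_card_le_centralizer_index_le_two (p := p)
    (t := e RatFunc.X) (K := K) (M := L) (G := H)
    (fun h => RatFunc.transcendental_X ((isAlgebraic_algHom_iff e.toAlgHom e.injective).1 h))
      σ hσ K' (fun g hg => (hK' g).1 hg)
    (by
      intro g hg hgt
      apply FaithfulSMul.eq_of_smul_eq_smul (α := L)
      intro y
      rw [one_smul]
      have hpol : ∀ f : Polynomial K,
          g • (e (algebraMap _ (RatFunc K) f)) = e (algebraMap _ (RatFunc K) f) := by
        intro f
        induction f using Polynomial.induction_on' with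
        | add a b ha hb => rw [_root_.map_add, _root_.map_add, smul_add, ha, hb]
        | monomial n a =>
          rw [← Polynomial.C_mul_X_pow_eq_monomial, _root_.map_mul, _root_.map_mul,
            _root_.map_pow, _root_.map_pow, RatFunc.algebraMap_X, RatFunc.algebraMap_C,
            ← RatFunc.algebraMap_eq_C, AlgEquiv.commutes, smul_mul', smul_pow', hgt, hσ,
            (hK' g).1 hg]
      obtain ⟨y, rfl⟩ := e.surjective y
      rw [← y.num_div_denom, map_div₀, smul_div₀', hpol, hpol])
    (fun g => IsMoebiusImage.of_ringEquiv e (MulSemiringAction.toRingEquiv H L g)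
      (fun a => ⟨σ g a, (hσ g a).symm⟩))
    (by
      intro g a z n hn hzn ha
      have hz : IsAlgebraic k z := ⟨Polynomial.X ^ n - 1,
        Polynomial.X_pow_sub_C_ne_zero hn 1, by simp [hzn]⟩
      have h1 : IsAlgebraic k (algebraMap K (AlgebraicClosure K) a) := by
        rw [ha]; exact hz.add hz.inv
      obtain ⟨c, rfl⟩ := hk a ((isAlgebraic_algebraMap_iff
        (algebraMap K (AlgebraicClosure K)).injective).1 h1)
      rw [IsScalarTower.algebraMap_apply k O K, hσO, hHk])
  have hK₀n : K₀.Normal := MonoidHom.normal_ker _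
  have hcardd : Nat.card K₀ ≤ Module.finrank F K * Nat.card K' := by
    let ρ : K₀ →* (K →ₐ[F] K) :=
      { toFun := fun h => { σ h with commutes' := hK₀F h h.2 }
        map_one' := AlgHom.ext hσone
        map_mul' := fun g h => AlgHom.ext (hσmul g h) }
    have hρ : ρ.toHomUnits.ker = K'.subgroupOf K₀ := by
      ext h
      rw [MonoidHom.mem_ker, Subgroup.mem_subgroupOf, hK', Units.ext_iff, AlgHom.ext_iff]
      rfl
    have : Finite (K →ₐ[F] K)ˣ := Finite.of_injective _ Units.val_injective
    rw [← Subgroup.card_mul_relIndex_of_le hle, mul_comm, Subgroup.relIndex, ← hρ,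
      Subgroup.index_ker]
    gcongr
    calc Nat.card ρ.toHomUnits.range ≤ Nat.card (K →ₐ[F] K)ˣ :=
          Nat.card_le_card_of_injective _ Subtype.val_injective
      _ ≤ Nat.card (K →ₐ[F] K) := Nat.card_le_card_of_injective _ Units.val_injective
      _ ≤ Module.finrank F K := by
        rw [Nat.card_eq_fintype_card]
        exact AlgHom.card_le
  obtain ⟨A, hA, hAi⟩ := exists_isMulCommutative_index_le_of_character (p := p) χ K₀ K'
    (fun g hg => hχ' g ((hK₀ g).1 hg)) (fun g hg => (hχ g hg).imp fun n hn => (hK₀ _).2 hn)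
    hle hcardd c hcN hcard
  refine ⟨A, hA, hAi.trans (Nat.mul_le_mul hcent ?_)⟩
  gcongr
  · exact (Fact.out : p.Prime).one_le
  · exact (Nat.factorization_le_iff_dvd Nat.card_pos.ne' Nat.card_pos.ne').2
      K'.card_subgroup_dvd_card p
end Core

section Core

open IsLocalRing

lemma IsPJordan.of_forall_finite {p : ℕ} [Fact p.Prime] {Γ : Type*} [Group Γ] (Γ₀ : Subgroup Γ)
    [Γ₀.FiniteIndex] (C e : ℕ)
    (h : ∀ H : Subgroup Γ, Finite H → H ≤ Γ₀ → ∃ A : Subgroup H, IsMulCommutative A ∧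
      A.index ≤ C * p ^ (e * (Nat.card H).factorization p)) : IsPJordan p Γ := by
  refine ⟨(Γ₀.index * C) ^ 2, e * 2, fun G hG => ?_⟩
  have hHfin : Finite (G ⊓ Γ₀ : Subgroup Γ) :=
    Finite.of_injective _ (Subgroup.inclusion_injective (inf_le_left (a := G) (b := Γ₀)))
  obtain ⟨A, hA, hAi⟩ := h (G ⊓ Γ₀) hHfin inf_le_right
  let ι := Subgroup.inclusion (inf_le_left (a := G) (b := Γ₀))
  have hι : Function.Injective ι := Subgroup.inclusion_injective _
  let B : Subgroup G := A.map ι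
  have hB : IsMulCommutative B := by
    refine ⟨⟨?_⟩⟩
    rintro ⟨_, a, ha, rfl⟩ ⟨_, b, hb, rfl⟩
    have := setLike_mul_comm ha hb
    ext1
    change ι a * ι b = ι b * ι a
    rw [← _root_.map_mul, this, _root_.map_mul]
  obtain ⟨M, hM, hMc, hMi⟩ := Subgroup.exists_normal_isMulCommutative_index_le B
  refine ⟨M, hM, fun a b => mul_comm' a b, fun P => hMi.trans ?_⟩
  rw [Sylow.card_eq_multiplicity, pow_mul, ← mul_pow]
  refine Nat.pow_le_pow_left ?_ 2
  have h1 : B.index ≤ A.index * Γ₀.index := by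
    rw [Subgroup.index_map_of_injective _ hι, Subgroup.inclusion_range]
    gcongr
    rw [← Subgroup.relIndex, Subgroup.inf_relIndex_left]
    rw [← Subgroup.relIndex_top_right Γ₀]
    exact Subgroup.relIndex_le_of_le_right le_top (by
      rw [Subgroup.relIndex_top_right]; exact Subgroup.FiniteIndex.index_ne_zero)
  refine h1.trans ?_
  rw [mul_comm, mul_assoc, ← pow_mul, mul_comm _ e]
  gcongr
  refine hAi.trans ?_
  gcongr
  · exact (Fact.out : p.Prime).one_le
  · exact (Nat.factorization_le_iff_dvd Nat.card_pos.ne' Nat.card_pos.ne').2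
      (Subgroup.card_dvd_of_le inf_le_left) p

theorem IsPJordan.of_mulSemiringAction {p : ℕ} [Fact p.Prime] {k O F K L : Type*}
    [Field k] [CommRing O] [IsDomain O] [IsLocalRing O] [IsNoetherianRing O] [Field F] [Field K]
    [Field L] [CharP k p] [Algebra k O] [Algebra k K] [Algebra O F] [IsFractionRing O F]
    [Algebra O K] [Algebra F K] [IsScalarTower O F K] [IsScalarTower k O K] [Module.Finite F K]
    (hk : ∀ x : K, IsAlgebraic k x → ∃ c, algebraMap k K c = x)
    [Algebra K L] (e : RatFunc K ≃ₐ[K] L) (hprin : (maximalIdeal O).IsPrincipal)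
    [Module.Finite k (ResidueField O)]
    {Γ : Type*} [Group Γ] [MulSemiringAction Γ L] [FaithfulSMul Γ L]
    (hΓk : ∀ (g : Γ) (c : k), g • algebraMap K L (algebraMap k K c)
      = algebraMap K L (algebraMap k K c))
    (Γ₀ : Subgroup Γ) [Γ₀.FiniteIndex]
    (hΓO : ∀ g ∈ Γ₀, ∀ (a : O), ∃ b : O, algebraMap K L (algebraMap O K b)
      = g • algebraMap K L (algebraMap O K a)) : IsPJordan p Γ := by
  have hOL : Function.Injective (fun a => algebraMap K L (algebraMap O K a)) := by
    refine (algebraMap K L).injective.comp ?_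
    rw [IsScalarTower.algebraMap_eq O F K]
    exact (algebraMap F K).injective.comp (FaithfulSMul.algebraMap_injective O F)
  refine IsPJordan.of_forall_finite (p := p) Γ₀
    (Module.finrank k (ResidueField O) * (2 * (Module.finrank F K * 60))) 5 fun H hH hHΓ => ?_
  choose s hs using fun g : H => hΓO g (hHΓ g.2)
  let act : MulSemiringAction H O :=
    { smul := fun g a => s g a
      one_smul := fun a => hOL (by
        change algebraMap K L (algebraMap O K (s 1 a)) = algebraMap K L (algebraMap O K a)
        simp [hs])
      mul_smul := fun g h a => hOL (by
        change algebraMap K L (algebraMap O K (s (g * h) a))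
          = algebraMap K L (algebraMap O K (s g (s h a)))
        rw [hs, hs, hs, smul_smul]; rfl)
      smul_zero := fun g => hOL (by
        change algebraMap K L (algebraMap O K (s g 0)) = algebraMap K L (algebraMap O K 0)
        simp [hs])
      smul_add := fun g a b => hOL (by
        change algebraMap K L (algebraMap O K (s g (a + b)))
          = algebraMap K L (algebraMap O K (s g a + s g b))
        simp [hs])
      smul_one := fun g => hOL (by
        change algebraMap K L (algebraMap O K (s g 1)) = algebraMap K L (algebraMap O K 1)
        simp [hs])
      smul_mul := fun g a b => hOL (by
        change algebraMap K L (algebraMap O K (s g (a * b)))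
          = algebraMap K L (algebraMap O K (s g a * s g b))
        simp [hs]) }
  have hact : ∀ (h : H) (a : O), algebraMap K L (algebraMap O K (h • a))
      = h • algebraMap K L (algebraMap O K a) := hs
  have hHk : ∀ (h : H) (c : k), h • algebraMap k O c = algebraMap k O c := fun h c => hOL (by
    change algebraMap K L (algebraMap O K _) = algebraMap K L (algebraMap O K _)
    rw [hact, ← IsScalarTower.algebraMap_apply k O K]
    exact hΓk h c)
  let ρ : H →* (ResidueField O →ₐ[k] ResidueField O) :=
    { toFun := fun h => { MulSemiringAction.toRingHom H (ResidueField O) h with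
        commutes' := fun c => congrArg (residue O) (hHk h c) }
      map_one' := AlgHom.ext fun a => one_smul H a
      map_mul' := fun g h => AlgHom.ext fun a => mul_smul g h a }
  let G := ρ.toHomUnits.ker
  have hG : ∀ (h : G) (a : O), h • a - a ∈ maximalIdeal O := by
    intro h a
    refine Ideal.Quotient.eq.1 ?_
    have := congrArg Units.val (MonoidHom.mem_ker.1 h.2)
    exact AlgHom.congr_fun this (residue O a)
  have hGi : G.index ≤ Module.finrank k (ResidueField O) := by
    have : Finite (ResidueField O →ₐ[k] ResidueField O)ˣ :=
      Finite.of_injective _ Units.val_injective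
    rw [Subgroup.index_ker]
    calc Nat.card ρ.toHomUnits.range ≤ Nat.card (ResidueField O →ₐ[k] ResidueField O)ˣ :=
          Nat.card_le_card_of_injective _ Subtype.val_injective
      _ ≤ Nat.card (ResidueField O →ₐ[k] ResidueField O) :=
          Nat.card_le_card_of_injective _ Units.val_injective
      _ ≤ Module.finrank k (ResidueField O) := by
        rw [Nat.card_eq_fintype_card]
        exact AlgHom.card_le
  obtain ⟨A, hA, hAi⟩ := exists_isMulCommutative_index_le_of_smul_sub_mem (p := p) (H := G)
    (F := F) hk e hprin (fun h c => hHk h c) (fun h a => hact h a) hG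
  refine ⟨A.map G.subtype, inferInstance, ?_⟩
  have hv := (Nat.factorization_le_iff_dvd Nat.card_pos.ne' Nat.card_pos.ne').2
      G.card_subgroup_dvd_card p
  calc (A.map G.subtype).index = A.index * G.index := Subgroup.index_map_subtype _
    _ ≤ (2 * (Module.finrank F K * (60 * (p ^ (Nat.card H).factorization p) ^ 4)
          * p ^ (Nat.card H).factorization p)) * Module.finrank k (ResidueField O) := by
      gcongr
      refine hAi.trans ?_
      have := (Fact.out : p.Prime).one_le
      gcongr
    _ = _ := by ring

end Core

section DimensionOne

open IsLocalRing

theorem MvPolynomial.le_one_of_krullDimLE_of_isIntegral {k B : Type*} [Field k] [CommRing B]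
    [IsDomain B] [Ring.KrullDimLE 1 B] [Algebra k B] {n : ℕ} (g : MvPolynomial (Fin n) k →ₐ[k] B)
    (hg : Function.Injective g) (hinteg : g.IsIntegral) : n ≤ 1 := by
  algebraize [g.toRingHom]
  have : Algebra.IsIntegral (MvPolynomial (Fin n) k) B := ⟨hinteg⟩
  have : Ring.KrullDimLE 1 (MvPolynomial (Fin n) k) := by
    refine Ring.KrullDimLE.mk₁' fun I hI hIp ↦ ?_
    obtain ⟨Q, -, hQ, hQI⟩ := Ideal.exists_ideal_over_prime_of_isIntegral I (⊥ : Ideal B) (by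
      intro x hx
      have : x = 0 := hg (by rw [_root_.map_zero]; exact hx)
      simp [this])
    have hQ0 : Q ≠ ⊥ := by
      rintro rfl
      refine hI (eq_bot_iff.mpr fun x hx ↦ ?_)
      rw [← hQI] at hx
      exact hg (by rw [_root_.map_zero]; exact hx)
    have := hQ.isMaximal_of_ne_bot hQ0
    rw [← hQI]
    exact Ideal.isMaximal_comap_of_isIntegral_of_isMaximal Q
  have h := (Ring.krullDimLE_iff (R := MvPolynomial (Fin n) k) (n := 1)).mp this
  rw [MvPolynomial.ringKrullDim_of_isNoetherianRing, ringKrullDim_eq_zero_of_field] at h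
  simpa using h

theorem Algebra.trdeg_le_one_of_krullDimLE (k : Type*) {B : Type*} [Field k] [CommRing B]
    [IsDomain B] [Ring.KrullDimLE 1 B] [Algebra k B] [Algebra.FiniteType k B] :
    Algebra.trdeg k B ≤ 1 := by
  obtain ⟨n, g, hg, hinteg⟩ := exists_integral_inj_algHom_of_fg k B
  have hn := MvPolynomial.le_one_of_krullDimLE_of_isIntegral g hg hinteg
  algebraize [g.toRingHom]
  have : Algebra.IsIntegral (MvPolynomial (Fin n) k) B := ⟨hinteg⟩
  have : FaithfulSMul (MvPolynomial (Fin n) k) B :=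
    (faithfulSMul_iff_algebraMap_injective _ _).mpr hg
  have h := lift_trdeg_add_eq k (MvPolynomial (Fin n) k) B
  rw [trdeg_eq_zero (R := MvPolynomial (Fin n) k) (A := B),
    MvPolynomial.trdeg_of_isDomain] at h
  simp only [Cardinal.lift_zero, add_zero,
    Cardinal.lift_natCast, Cardinal.mk_fintype, Fintype.card_fin] at h
  have h1 : (Cardinal.lift (Algebra.trdeg k B)) = n := h.symm
  rw [← Cardinal.lift_le, h1]
  simpa using hn

theorem MvPolynomial.isPrincipalIdealRing_of_le_one {k : Type*} [Field k] {n : ℕ} (hn : n ≤ 1) :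
    IsPrincipalIdealRing (MvPolynomial (Fin n) k) := by
  obtain rfl | rfl : n = 0 ∨ n = 1 := by omega
  · exact IsPrincipalIdealRing.of_surjective (MvPolynomial.isEmptyRingEquiv k (Fin 0)).symm
      (RingEquiv.surjective _)
  · exact IsPrincipalIdealRing.of_surjective (MvPolynomial.uniqueAlgEquiv k (Fin 1)).symm
      (AlgEquiv.surjective _)

theorem Algebra.Smooth.isPrincipal_maximalIdeal (k : Type*) {B : Type*} [Field k] [CommRing B]
    [IsDomain B] [Ring.KrullDimLE 1 B] [Algebra k B] [Algebra.Smooth k B]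
    (P : Ideal B) [P.IsPrime] (O : Type*) [CommRing O] [Algebra B O] [IsLocalRing O]
    [IsLocalization.AtPrime O P] :
    (maximalIdeal O).IsPrincipal := by
  have : Algebra.IsSmoothAt k P := inferInstance
  obtain ⟨f, hf, n, _, _, _⟩ :=
    Algebra.IsSmoothAt.exists_isStandardEtale_mvPolynomial (R := k) (p := P)
  have hf0 : f ≠ 0 := fun h ↦ hf (h ▸ P.zero_mem)
  have hM : Submonoid.powers f ≤ nonZeroDivisors B :=
    powers_le_nonZeroDivisors_of_noZeroDivisors hf0
  have : IsDomain (Localization.Away f) := IsLocalization.isDomain_localization hM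
  have hn : n ≤ 1 := by
    have hinj : Function.Injective (algebraMap (MvPolynomial (Fin n) k) (Localization.Away f)) := by
      have : Module.Flat (MvPolynomial (Fin n) k) (Localization.Away f) :=
        Algebra.Smooth.flat _ _
      have := Module.Flat.isTorsionFree (R := MvPolynomial (Fin n) k) (M := Localization.Away f)
      have : FaithfulSMul (MvPolynomial (Fin n) k) (Localization.Away f) :=
        Module.IsTorsionFree.to_faithfulSMul
      exact FaithfulSMul.algebraMap_injective _ _
    have h1 := lift_trdeg_le_of_injective
      (IsScalarTower.toAlgHom k (MvPolynomial (Fin n) k) (Localization.Away f)) hinj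
    have : Algebra.IsAlgebraic B (Localization.Away f) :=
      IsLocalization.isAlgebraic (Localization.Away f) (Submonoid.powers f)
    have : FaithfulSMul B (Localization.Away f) :=
      (faithfulSMul_iff_algebraMap_injective _ _).mpr (IsLocalization.injective _ hM)
    have h2 := trdeg_add_eq k B (A := Localization.Away f)
    rw [trdeg_eq_zero (R := B), add_zero] at h2
    rw [← h2, MvPolynomial.trdeg_of_isDomain] at h1
    have h3 := h1.trans (Cardinal.lift_le.mpr (Algebra.trdeg_le_one_of_krullDimLE k (B := B)))
    simpa using h3
  have := MvPolynomial.isPrincipalIdealRing_of_le_one (k := k) hn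
  have hdisj : Disjoint (Submonoid.powers f : Set B) P := by
    rw [Set.disjoint_left]
    rintro _ ⟨m, rfl⟩ h
    exact hf (‹P.IsPrime›.mem_of_pow_mem m h)
  let Q := P.map (algebraMap B (Localization.Away f))
  have hQ : Q.IsPrime := IsLocalization.isPrime_of_isPrime_disjoint (.powers f) _ P ‹_› hdisj
  have hQP : Q.comap (algebraMap B (Localization.Away f)) = P :=
    IsLocalization.under_map_of_isPrime_disjoint (.powers f) _ ‹_› hdisj
  let p := Q.under (MvPolynomial (Fin n) k)
  let := Localization.AtPrime.algebraOfLiesOver p Q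
  have h := ((Algebra.isUnramifiedAt_iff_map_eq (MvPolynomial (Fin n) k) p Q).mp inferInstance).2
  have hpr : (maximalIdeal (Localization.AtPrime Q)).IsPrincipal := by
    rw [← h]
    infer_instance
  have hloc : IsLocalization.AtPrime (Localization.AtPrime Q) P := by
    have := IsLocalization.isLocalization_isLocalization_atPrime_isLocalization
      (.powers f) (Localization.AtPrime Q) Q
    simpa only [hQP] using this
  let e := (IsLocalization.algEquiv P.primeCompl (Localization.AtPrime Q) O).toRingEquiv
  have : ((maximalIdeal (Localization.AtPrime Q)).map e).IsMaximal :=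
    Ideal.map_isMaximal_of_equiv e
  rw [← IsLocalRing.eq_maximalIdeal this]
  exact Submodule.IsPrincipal.map_ringHom e.toRingHom hpr

theorem Algebra.Smooth.exists_algebraMap_eq_of_isAlgebraic {k B K : Type*} [Field k] [CommRing B]
    [IsDomain B] [Ring.KrullDimLE 1 B] [Algebra k B] [Algebra.Smooth k B] [Field K] [Algebra B K]
    [IsFractionRing B K] [Algebra k K] [IsScalarTower k B K] (ε : B →ₐ[k] k) {x : K}
    (hx : IsAlgebraic k x) : ∃ c : k, algebraMap k K c = x := by
  have : IsNoetherianRing B := Algebra.FiniteType.isNoetherianRing k B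
  let P := RingHom.ker ε
  have : P.IsPrime := RingHom.ker_isPrime _
  let O := Localization.AtPrime P
  have hM : P.primeCompl ≤ nonZeroDivisors B := P.primeCompl_le_nonZeroDivisors
  let : Algebra O K := IsLocalization.localizationAlgebraOfSubmonoidLe O K _ _ hM
  have : IsScalarTower B O K := IsLocalization.localization_isScalarTower_of_submonoid_le O K _ _ hM
  have : IsFractionRing O K :=
    IsFractionRing.isFractionRing_of_isDomain_of_isLocalization P.primeCompl O K
  have : IsScalarTower k O K := .of_algebraMap_eq' <| by
    rw [IsScalarTower.algebraMap_eq k B O, ← RingHom.comp_assoc,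
      ← IsScalarTower.algebraMap_eq B O K, ← IsScalarTower.algebraMap_eq k B K]
  have : IsDomain O := IsLocalization.isDomain_localization hM
  have : IsNoetherianRing O := IsLocalization.isNoetherianRing P.primeCompl O inferInstance
  have : IsPrincipalIdealRing O :=
    ((tfae_of_isNoetherianRing_of_isLocalRing_of_isDomain O).out 4 0).mp
      (Algebra.Smooth.isPrincipal_maximalIdeal k P O)
  have lift {y : K} (hy : IsAlgebraic k y) : ∃ o : O, algebraMap O K o = y :=
    IsIntegrallyClosed.isIntegral_iff.mp (hy.isIntegral.tower_top)
  let ρ : O →+* k := IsLocalization.lift (M := P.primeCompl) (g := ε.toRingHom) fun s ↦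
    isUnit_iff_ne_zero.mpr s.2
  have hρ (c : k) : ρ (algebraMap k O c) = c := by
    rw [IsScalarTower.algebraMap_apply k B O, IsLocalization.lift_eq]
    exact ε.commutes c
  obtain ⟨o, rfl⟩ := lift hx
  refine ⟨ρ o, ?_⟩
  by_contra hne
  have hne' : algebraMap k K (ρ o) - algebraMap O K o ≠ 0 := sub_ne_zero.mpr hne
  obtain ⟨u, hu⟩ := lift ((isAlgebraic_algebraMap (ρ o)).sub hx).inv
  have h1 : (algebraMap k O (ρ o) - o) * u = 1 := by
    apply IsFractionRing.injective O K
    rw [_root_.map_mul, _root_.map_sub, hu, ← IsScalarTower.algebraMap_apply, _root_.map_one,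
      mul_inv_cancel₀ hne']
  have h2 := congrArg ρ h1
  rw [_root_.map_mul, _root_.map_sub, hρ, sub_self, zero_mul, _root_.map_one] at h2
  exact zero_ne_one h2

end DimensionOne

section GeometricallyIntegral

open scoped TensorProduct Polynomial IntermediateField

theorem Polynomial.natDegree_eq_zero_of_isIntegral {k : Type*} [Field k] {f : k[X]}
    (hf : IsIntegral k f) : f.natDegree = 0 := by
  have h := minpoly.aeval k f
  have h' : (minpoly k f).comp f = 0 := h
  have h2 := congrArg Polynomial.natDegree h'
  rw [Polynomial.natDegree_comp, Polynomial.natDegree_zero] at h2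
  exact (mul_eq_zero.mp h2).resolve_left (minpoly.natDegree_pos hf).ne'

theorem Algebra.Smooth.isReduced (k S : Type*) [Field k] [CommRing S] [Algebra k S]
    [Algebra.Smooth k S] : IsReduced S := by
  refine ⟨fun x hx ↦ ?_⟩
  have hmem : x ⊗ₜ[k] (Polynomial.X : k[X]) ∈ integralClosure S (S ⊗[k] k[X]) := by
    obtain ⟨n, hn⟩ := hx
    refine ⟨Polynomial.X ^ n, Polynomial.monic_X_pow n, ?_⟩
    rw [Polynomial.eval₂_X_pow, Algebra.TensorProduct.tmul_pow, hn, TensorProduct.zero_tmul]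
  obtain ⟨z, hz⟩ := (TensorProduct.toIntegralClosure_bijective_of_smooth (R := k) (S := S)
    (B := k[X])).2 ⟨_, hmem⟩
  let c : S ⊗[k] k[X] →ₗ[k] S ⊗[k] k := LinearMap.lTensor S (Polynomial.lcoeff k 1)
  have hc (z : S ⊗[k] integralClosure k k[X]) :
      c (TensorProduct.toIntegralClosure k S k[X] z : S ⊗[k] k[X]) = 0 := by
    induction z with
    | zero => simp
    | add a b ha hb => simp [ha, hb]
    | tmul s f =>
      change c (s ⊗ₜ (f : k[X])) = 0
      have : (f : k[X]).coeff 1 = 0 := Polynomial.coeff_eq_zero_of_natDegree_lt (by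
        rw [Polynomial.natDegree_eq_zero_of_isIntegral f.2]; exact one_pos)
      simp [c, this]
  have h := hc z
  rw [hz] at h
  have h' : (_root_.TensorProduct.rid k S) (c (x ⊗ₜ[k] (Polynomial.X : k[X]))) = 0 := by
    rw [h, _root_.map_zero]
  simpa [c] using h'

theorem Irreducible.map_of_forall_isAlgebraic {k K : Type*} [Field k] [Field K] [Algebra k K]
    (hk : ∀ x : K, IsAlgebraic k x → ∃ c, algebraMap k K c = x) {f : k[X]} (hf : Irreducible f) :
    Irreducible (f.map (algebraMap k K)) := by
  have hdeg : (f.map (algebraMap k K)).degree ≠ 0 := by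
    rw [Polynomial.degree_map]
    exact hf.degree_pos.ne'
  obtain ⟨g₀, hg₀, hg₀f⟩ := WfDvdMonoid.exists_irreducible_factor
    (a := f.map (algebraMap k K)) (fun h ↦ hdeg (Polynomial.degree_eq_zero_of_isUnit h))
    (by simpa using hf.ne_zero)
  obtain ⟨g, hg, hassoc, hgm⟩ : ∃ g, Irreducible g ∧ Associated g₀ g ∧ g.Monic := by
    have hu : IsUnit (Polynomial.C g₀.leadingCoeff⁻¹) := by
      simpa using hg₀.ne_zero
    have : Associated g₀ (g₀ * Polynomial.C g₀.leadingCoeff⁻¹) :=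
      (associated_mul_unit_left _ _ hu).symm
    exact ⟨_, this.irreducible hg₀, this, Polynomial.monic_mul_leadingCoeff_inv hg₀.ne_zero⟩
  have hgf : g ∣ (f * Polynomial.C f.leadingCoeff⁻¹).map (algebraMap k K) := by
    rw [Polynomial.map_mul]
    exact (hassoc.symm.dvd.trans hg₀f).mul_right _
  have hmon : (f * Polynomial.C f.leadingCoeff⁻¹).Monic :=
    Polynomial.monic_mul_leadingCoeff_inv hf.ne_zero
  obtain ⟨q, hq⟩ := (Polynomial.mem_lifts _).mp
    (integralClosure.mem_lifts_of_monic_of_dvd_map K hmon hgm hgf)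
  obtain ⟨r, hr⟩ : ∃ r : k[X], r.map (algebraMap k K) = g := by
    rw [← Polynomial.mem_lifts, Polynomial.lifts_iff_coeff_lifts]
    intro n
    rw [← hq, Polynomial.coeff_map]
    obtain ⟨c, hc⟩ := hk _ (q.coeff n).2.isAlgebraic
    exact ⟨c, hc⟩
  have hrf : r ∣ f := by
    rw [← Polynomial.map_dvd_map' (algebraMap k K), hr]
    exact hassoc.symm.dvd.trans hg₀f
  have hru : ¬ IsUnit r := fun h ↦ hg.not_isUnit (hr ▸ h.map (Polynomial.mapRingHom (algebraMap k K)))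
  obtain ⟨u, hu⟩ := (hf.dvd_iff.mp hrf).resolve_left hru
  refine Associated.irreducible ?_ (hr ▸ hg)
  exact (Associated.map (Polynomial.mapRingHom (algebraMap k K)) ⟨u, hu⟩).symm

theorem isDomain_tensorProduct_of_isSeparable {k K M : Type*} [Field k] [Field K] [Algebra k K]
    (hk : ∀ x : K, IsAlgebraic k x → ∃ c, algebraMap k K c = x) [Field M] [Algebra k M]
    [FiniteDimensional k M] [Algebra.IsSeparable k M] : IsDomain (M ⊗[k] K) := by
  let E := AlgebraicClosure K
  have : Algebra.IsAlgebraic k M := inferInstance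
  let fa : M →ₐ[k] E := IsAlgClosed.lift
  obtain ⟨a, ha⟩ := Field.exists_primitive_element k M
  have hA : fa.fieldRange = k⟮fa a⟯ := by
    rw [AlgHom.fieldRange_eq_map, ← ha, IntermediateField.adjoin_map, Set.image_singleton]
  have hinteg : IsIntegral k (fa a) := (Algebra.IsIntegral.isIntegral a).map fa
  have hmin : (minpoly k (fa a)).map (algebraMap k K) = minpoly K (fa a) := by
    refine minpoly.eq_of_irreducible_of_monic
      ((minpoly.irreducible hinteg).map_of_forall_isAlgebraic hk) ?_ ((minpoly.monic hinteg).map _)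
    rw [Polynomial.aeval_map_algebraMap, minpoly.aeval]
  have hdisj : k⟮fa a⟯.LinearDisjoint K := by
    refine IntermediateField.LinearDisjoint.of_basis_left
      (IntermediateField.adjoin.powerBasis hinteg).basis ?_
    have h := linearIndependent_pow (K := K) (fa a)
    have hd : (IntermediateField.adjoin.powerBasis hinteg).dim = (minpoly K (fa a)).natDegree := by
      rw [← hmin, Polynomial.natDegree_map]
      rfl
    have h2 := h.comp (Fin.cast hd) (Fin.cast_injective hd)
    convert h2 using 1
    funext i
    simp
  have := hdisj.isDomain
  let e : M ≃ₐ[k] k⟮fa a⟯ := (AlgEquiv.ofInjectiveField fa).trans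
    (IntermediateField.equivOfEq hA)
  exact (Algebra.TensorProduct.congr e (AlgEquiv.refl : K ≃ₐ[k] K)).toMulEquiv.isDomain

end GeometricallyIntegral

section GeometricallyIntegralSmooth

open scoped TensorProduct IntermediateField

theorem range_map_val_mono {k Ω B : Type*} [Field k] [Field Ω] [Algebra k Ω] [CommRing B]
    [Algebra k B] {M N : IntermediateField k Ω} (h : M ≤ N) :
    (Algebra.TensorProduct.map M.val (AlgHom.id k B)).range ≤
      (Algebra.TensorProduct.map N.val (AlgHom.id k B)).range := by
  have : Algebra.TensorProduct.map M.val (AlgHom.id k B) =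
      (Algebra.TensorProduct.map N.val (AlgHom.id k B)).comp
        (Algebra.TensorProduct.map (IntermediateField.inclusion h) (AlgHom.id k B)) := by
    ext <;> simp
  rw [this]
  exact AlgHom.range_comp_le_range _ _

theorem exists_pow_expChar_pow_mem_range_map_val {k Ω B : Type*} [Field k] [Field Ω] [Algebra k Ω]
    [Algebra.IsAlgebraic k Ω] [CommRing B] [Algebra k B] [Nontrivial B] (q : ℕ) [ExpChar k q]
    (x : Ω ⊗[k] B) :
    ∃ (n : ℕ) (M : IntermediateField k Ω), FiniteDimensional k M ∧ Algebra.IsSeparable k M ∧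
      x ^ q ^ n ∈ (Algebra.TensorProduct.map M.val (AlgHom.id k B)).range := by
  have : ExpChar (Ω ⊗[k] B) q :=
    expChar_of_injective_algebraMap (algebraMap k (Ω ⊗[k] B)).injective q
  have : ExpChar (separableClosure k Ω) q :=
    expChar_of_injective_algebraMap (algebraMap k (separableClosure k Ω)).injective q
  induction x with
  | zero =>
    refine ⟨0, ⊥, inferInstance, inferInstance, ?_⟩
    simp
  | tmul c b =>
    obtain ⟨n, y, hy⟩ := IsPurelyInseparable.pow_mem (separableClosure k Ω) q c
    have hs : IsSeparable k (c ^ q ^ n) := by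
      rw [← hy]
      exact mem_separableClosure_iff.mp y.2
    have := (IntermediateField.isSeparable_adjoin_simple_iff_isSeparable k Ω).mpr hs
    refine ⟨n, k⟮c ^ q ^ n⟯, IntermediateField.adjoin.finiteDimensional hs.isIntegral,
      this, ?_⟩
    refine ⟨⟨c ^ q ^ n, IntermediateField.mem_adjoin_simple_self k _⟩ ⊗ₜ (b ^ q ^ n), ?_⟩
    simp [Algebra.TensorProduct.tmul_pow]
  | add x y hx hy =>
    obtain ⟨n, M, _, _, hn⟩ := hx
    obtain ⟨m, N, _, _, hm⟩ := hy
    refine ⟨n + m, M ⊔ N, inferInstance, inferInstance, ?_⟩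
    rw [add_pow_expChar_pow]
    refine add_mem ?_ ?_
    · rw [pow_add, pow_mul]
      exact pow_mem (range_map_val_mono le_sup_left hn) _
    · rw [pow_add, mul_comm, pow_mul]
      exact pow_mem (range_map_val_mono le_sup_right hm) _

theorem Algebra.Smooth.isDomain_tensorProduct {k Ω B K : Type*} [Field k] [Field Ω] [Algebra k Ω]
    [Algebra.IsAlgebraic k Ω] [CommRing B] [IsDomain B] [Algebra k B] [Algebra.Smooth k B]
    [Field K] [Algebra k K] [Algebra B K] [IsScalarTower k B K] [IsFractionRing B K]
    (hk : ∀ x : K, IsAlgebraic k x → ∃ c, algebraMap k K c = x) : IsDomain (Ω ⊗[k] B) := by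
  obtain ⟨q, _⟩ := ExpChar.exists k
  have : IsReduced (Ω ⊗[k] B) := Algebra.Smooth.isReduced Ω (Ω ⊗[k] B)
  suffices NoZeroDivisors (Ω ⊗[k] B) from NoZeroDivisors.to_isDomain _
  refine ⟨fun {x y} hxy ↦ ?_⟩
  obtain ⟨n, M, _, _, hn⟩ := exists_pow_expChar_pow_mem_range_map_val q x
  obtain ⟨m, N, _, _, hm⟩ := exists_pow_expChar_pow_mem_range_map_val q y
  obtain ⟨x', hx'⟩ := range_map_val_mono (le_sup_left (b := N)) hn
  obtain ⟨y', hy'⟩ := range_map_val_mono (le_sup_right (a := M)) hm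
  have hinj : Function.Injective
      (Algebra.TensorProduct.map (M ⊔ N).val (AlgHom.id k B)) :=
    Module.Flat.rTensor_preserves_injective_linearMap (M := B) (M ⊔ N).val.toLinearMap
      (M ⊔ N).val.injective
  have hinj2 : Function.Injective
      (Algebra.TensorProduct.map (AlgHom.id k ↥(M ⊔ N)) (IsScalarTower.toAlgHom k B K)) :=
    Module.Flat.lTensor_preserves_injective_linearMap (M := ↥(M ⊔ N))
      (IsScalarTower.toAlgHom k B K).toLinearMap (IsFractionRing.injective B K)
  have := isDomain_tensorProduct_of_isSeparable hk (M := ↥(M ⊔ N))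
  have : IsDomain (↥(M ⊔ N) ⊗[k] B) := hinj2.isDomain _
  have h0 : x' ^ q ^ m * y' ^ q ^ n = 0 := by
    apply hinj
    rw [_root_.map_mul, _root_.map_pow, _root_.map_pow, _root_.map_zero]
    change (Algebra.TensorProduct.map (M ⊔ N).val (AlgHom.id k B)).toRingHom x' ^ _ *
      (Algebra.TensorProduct.map (M ⊔ N).val (AlgHom.id k B)).toRingHom y' ^ _ = 0
    rw [hx', hy', ← pow_mul, ← pow_mul, mul_comm (q ^ m), ← mul_pow, hxy, zero_pow]
    exact (mul_pos (expChar_pow_pos k q _) (expChar_pow_pos k q _)).ne'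
  rcases mul_eq_zero.mp h0 with h | h
  · left
    rw [pow_eq_zero_iff (expChar_pow_pos k q _).ne'] at h
    rw [h, _root_.map_zero] at hx'
    exact eq_zero_of_pow_eq_zero hx'.symm
  · right
    rw [pow_eq_zero_iff (expChar_pow_pos k q _).ne'] at h
    rw [h, _root_.map_zero] at hy'
    exact eq_zero_of_pow_eq_zero hy'.symm

end GeometricallyIntegralSmooth

section RatFuncSpecialization

open scoped TensorProduct Polynomial IntermediateField

theorem IsAlgClosed.exists_algebraMap_eq_of_isAlgebraic {Ω K : Type*} [Field Ω] [IsAlgClosed Ω]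
    [Field K] [Algebra Ω K] {x : K} (hx : IsAlgebraic Ω x) : ∃ c, algebraMap Ω K c = x := by
  have : Algebra.IsAlgebraic Ω Ω⟮x⟯ := IntermediateField.isAlgebraic_adjoin_simple hx.isIntegral
  have h := IntermediateField.eq_bot_of_isAlgClosed_of_isAlgebraic Ω⟮x⟯
  exact IntermediateField.mem_bot.mp (h ▸ IntermediateField.mem_adjoin_simple_self Ω x)

theorem Algebra.FiniteType.exists_algHom_apply_ne_zero {k Ω B : Type*} [Field k] [Field Ω]
    [IsAlgClosed Ω] [Algebra k Ω] [CommRing B] [IsDomain B] [Algebra k B] [Algebra.FiniteType k B]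
    {D : B} (hD : D ≠ 0) : ∃ χ : B →ₐ[k] Ω, χ D ≠ 0 := by
  let A := Localization.Away D
  have : Nontrivial A := (IsLocalization.injective A (powers_le_nonZeroDivisors_of_noZeroDivisors
    hD)).nontrivial
  have : Algebra.FiniteType k A := .trans (S := B) inferInstance
    (IsLocalization.finiteType_of_monoid_fg (.powers D) A)
  obtain ⟨m, hm⟩ := Ideal.exists_maximal A
  let _ : Field (A ⧸ m) := Ideal.Quotient.field m
  have : Module.Finite k (A ⧸ m) := finite_of_finite_type_of_isJacobsonRing k (A ⧸ m)
  let f : A ⧸ m →ₐ[k] Ω := IsAlgClosed.lift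
  refine ⟨(f.comp (Ideal.Quotient.mkₐ k m)).comp (IsScalarTower.toAlgHom k B A), ?_⟩
  exact (((IsLocalization.Away.algebraMap_isUnit (S := A) D).map (Ideal.Quotient.mkₐ k m)).map
    f).ne_zero

/-- The map `B[X] → K(X)` induced by `B → K`. -/
noncomputable def Polynomial.toRatFunc (B K : Type*) [CommRing B] [Field K] [Algebra B K] :
    B[X] →+* RatFunc K :=
  (algebraMap K[X] (RatFunc K)).comp (Polynomial.mapRingHom (algebraMap B K))

theorem Polynomial.isFractionRing_toRatFunc (B K : Type*) [CommRing B] [Field K]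
    [Algebra B K] [IsFractionRing B K] :
    @IsFractionRing B[X] _ (RatFunc K) _ (Polynomial.toRatFunc B K).toAlgebra := by
  let _ := (Polynomial.toRatFunc B K).toAlgebra
  have hinj : Function.Injective (Polynomial.toRatFunc B K) :=
    (RatFunc.algebraMap_injective K).comp
      (Polynomial.map_injective _ (IsFractionRing.injective B K))
  have : FaithfulSMul B[X] (RatFunc K) := (faithfulSMul_iff_algebraMap_injective _ _).mpr hinj
  have hnum (f : K[X]) : ∃ (b : B) (g : B[X]), b ≠ 0 ∧
      f * Polynomial.C (algebraMap B K b) = g.map (algebraMap B K) := by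
    have : IsDomain B := (IsFractionRing.injective B K).isDomain _
    obtain ⟨b, hbm, hb⟩ := IsLocalization.integerNormalization_spec (nonZeroDivisors B) f
    refine ⟨b, IsLocalization.integerNormalization (nonZeroDivisors B) f,
      nonZeroDivisors.ne_zero hbm, ?_⟩
    rw [hb, mul_comm, ← Polynomial.smul_eq_C_mul, algebraMap_smul]
  refine IsFractionRing.of_field _ _ fun z ↦ ?_
  obtain ⟨b, g, hb, hg⟩ := hnum z.num
  obtain ⟨c, h, hc, hh⟩ := hnum z.denom
  have hmap (f : B[X]) : algebraMap B[X] (RatFunc K) f =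
    algebraMap K[X] (RatFunc K) (f.map (algebraMap B K)) := rfl
  have hb' : algebraMap K[X] (RatFunc K) (Polynomial.C (algebraMap B K b)) ≠ 0 := by
    simpa using hb
  have hc' : algebraMap K[X] (RatFunc K) (Polynomial.C (algebraMap B K c)) ≠ 0 := by
    simpa using hc
  refine ⟨g * Polynomial.C c, h * Polynomial.C b, ?_⟩
  rw [hmap, hmap, Polynomial.map_mul, Polynomial.map_mul, ← hg, ← hh, Polynomial.map_C,
    Polynomial.map_C, _root_.map_mul, _root_.map_mul, _root_.map_mul, _root_.map_mul]
  nth_rw 1 [← z.num_div_denom]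
  have := RatFunc.algebraMap_ne_zero z.denom_ne_zero
  field_simp

theorem Polynomial.exists_coeff_mul_sub_ne_zero {B K : Type*} [CommRing B] [Field K]
    [Algebra B K] [IsFractionRing B K] {f g : B[X]} (hg : g ≠ 0) {x : RatFunc K}
    (hx : ∀ c, algebraMap K (RatFunc K) c ≠ x)
    (hfg : Polynomial.toRatFunc B K f = Polynomial.toRatFunc B K g * x) :
    ∃ i j, f.coeff i * g.coeff j - f.coeff j * g.coeff i ≠ 0 := by
  by_contra! h
  obtain ⟨j, hj⟩ : ∃ j, g.coeff j ≠ 0 := by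
    by_contra! h'
    exact hg (Polynomial.ext (by simpa using h'))
  have hj' : algebraMap B K (g.coeff j) ≠ 0 := by simpa using hj
  refine hx (algebraMap B K (f.coeff j) / algebraMap B K (g.coeff j)) ?_
  have hg' : Polynomial.toRatFunc B K g ≠ 0 := by
    simpa [Polynomial.toRatFunc] using
      (Polynomial.map_ne_zero_iff (IsFractionRing.injective B K)).mpr hg
  refine mul_left_cancel₀ hg' (Eq.trans ?_ hfg)
  have key : g * Polynomial.C (f.coeff j) = f * Polynomial.C (g.coeff j) := by
    ext i
    simpa [mul_comm] using (sub_eq_zero.mp (h i j)).symm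
  have key' := congrArg (Polynomial.toRatFunc B K) key
  have hC (b : B) : Polynomial.toRatFunc B K (Polynomial.C b) =
      algebraMap K (RatFunc K) (algebraMap B K b) := by
    simp [Polynomial.toRatFunc]
  rw [_root_.map_mul, _root_.map_mul, hC, hC] at key'
  rw [map_div₀, mul_div_assoc', key', mul_div_assoc, div_self, mul_one]
  simpa using hj

theorem isUnit_map_of_mem_powers {F A P : Type*} [Monoid A] [Monoid P] [FunLike F A P]
    [MonoidHomClass F A P] (σ : F) {g : A} (h : IsUnit (σ g)) (y : Submonoid.powers g) :
    IsUnit (σ y) := by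
  obtain ⟨_, n, rfl⟩ := y
  simpa using h.pow n

/-- The canonical map from a localization away from `g` to the fraction field. -/
noncomputable def Localization.Away.toFractionField (k F : Type*) {C : Type*} [CommRing k]
    [CommRing C] [IsDomain C] [Algebra k C] [Field F] [Algebra k F] [Algebra C F]
    [IsScalarTower k C F] [IsFractionRing C F] {g : C} (hg : g ≠ 0) :
    Localization.Away g →ₐ[k] F :=
  IsLocalization.liftAlgHom (M := .powers g) (f := IsScalarTower.toAlgHom k C F)
    (isUnit_map_of_mem_powers _ (by simpa using hg))

section toFractionField

variable {k C F : Type*} [CommRing k] [CommRing C] [IsDomain C] [Algebra k C] [Field F]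
  [Algebra k F] [Algebra C F] [IsScalarTower k C F] [IsFractionRing C F] {g : C} (hg : g ≠ 0)

theorem Localization.Away.toFractionField_algebraMap (c : C) :
    toFractionField k F hg (algebraMap C (Localization.Away g) c) = algebraMap C F c := by
  simp [toFractionField]

theorem Localization.Away.toFractionField_injective :
    Function.Injective (toFractionField k F hg) := by
  refine (IsLocalization.lift_injective_iff (M := .powers g) (g := algebraMap C F)
    (isUnit_map_of_mem_powers _ (by simpa using hg))).mpr fun x y ↦ ?_
  rw [(IsLocalization.injective (Localization.Away g)
    (powers_le_nonZeroDivisors_of_noZeroDivisors hg)).eq_iff,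
    (IsFractionRing.injective C F).eq_iff]

end toFractionField

/-- A homomorphism from a finitely generated algebra to the fraction field of `C` factors
through a localization of `C` away from one element. -/
theorem Algebra.FiniteType.exists_algHom_localizationAway {k A C F : Type*} [CommRing k]
    [CommRing A] [Algebra k A] [Algebra.FiniteType k A] [CommRing C] [IsDomain C] [Algebra k C]
    [Field F] [Algebra k F] [Algebra C F] [IsScalarTower k C F] [IsFractionRing C F]
    (θ : A →ₐ[k] F) :
    ∃ (g : C) (hg : g ≠ 0) (θ' : A →ₐ[k] Localization.Away g),
      ∀ a, Localization.Away.toFractionField k F hg (θ' a) = θ a := by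
  classical
  obtain ⟨s, hs⟩ := Algebra.FiniteType.out (R := k) (A := A)
  obtain ⟨⟨g, hg⟩, hgs⟩ := IsLocalization.exist_integer_multiples_of_finset
    (nonZeroDivisors C) (s.image θ)
  replace hgs (b : A) (hb : b ∈ s) : ∃ f : C, algebraMap C F f = algebraMap C F g * θ b := by
    obtain ⟨f, hf⟩ := hgs _ (Finset.mem_image_of_mem θ hb)
    exact ⟨f, hf.trans (Algebra.smul_def _ _)⟩
  have hg0 : g ≠ 0 := nonZeroDivisors.ne_zero hg
  have hgu : IsUnit (algebraMap C F g) := by simpa using hg0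
  let ι := Localization.Away.toFractionField k F hg0
  have hι : Function.Injective ι := Localization.Away.toFractionField_injective hg0
  have hrange (b : A) : θ b ∈ ι.range := by
    have h1 : (⊤ : Subalgebra k A) ≤ ι.range.comap θ := by
      rw [← hs, Algebra.adjoin_le_iff]
      intro b hb
      obtain ⟨f, hf⟩ := hgs b hb
      refine ⟨IsLocalization.mk' _ f (⟨g, Submonoid.mem_powers g⟩ : Submonoid.powers g), ?_⟩
      refine hgu.mul_left_cancel ?_
      change _ * ι _ = _ * θ b
      rw [← hf, ← Localization.Away.toFractionField_algebraMap (k := k) hg0,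
        ← Localization.Away.toFractionField_algebraMap (k := k) hg0, ← _root_.map_mul]
      exact congrArg ι (IsLocalization.mk'_spec' _ f (⟨g, Submonoid.mem_powers g⟩ :
        Submonoid.powers g))
    exact h1 trivial
  refine ⟨g, hg0, ((AlgEquiv.ofInjective ι hι).symm : ι.range →ₐ[k] _).comp
    (θ.codRestrict ι.range hrange), fun b ↦ ?_⟩
  have := (AlgEquiv.ofInjective ι hι).apply_symm_apply (θ.codRestrict ι.range hrange b)
  exact congrArg Subtype.val this

theorem exists_algHom_ratFunc_of_algHom_ratFunc {k Ω B K : Type*} [Field k] [Field Ω]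
    [IsAlgClosed Ω] [Algebra k Ω] [CommRing B] [IsDomain B] [Algebra k B] [Algebra.FiniteType k B]
    [Field K] [Algebra k K] [Algebra B K] [IsScalarTower k B K] [IsFractionRing B K]
    (θ : B →ₐ[k] RatFunc K) {b₀ : B} (hb₀ : ∀ c, algebraMap K (RatFunc K) c ≠ θ b₀) :
    ∃ ψ : B →ₐ[k] RatFunc Ω, ∀ c, algebraMap Ω (RatFunc Ω) c ≠ ψ b₀ := by
  classical
  let _ := (Polynomial.toRatFunc B K).toAlgebra
  have := Polynomial.isFractionRing_toRatFunc B K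
  have : IsScalarTower k B[X] (RatFunc K) := .of_algebraMap_eq fun c ↦ by
    change _ = Polynomial.toRatFunc B K _
    rw [Polynomial.toRatFunc, RingHom.comp_apply, Polynomial.algebraMap_apply,
      Polynomial.coe_mapRingHom, Polynomial.map_C, ← IsScalarTower.algebraMap_apply k B K,
      IsScalarTower.algebraMap_apply k K[X] (RatFunc K), Polynomial.algebraMap_apply]
  obtain ⟨g, hg0, θ', hθ'⟩ :=
    Algebra.FiniteType.exists_algHom_localizationAway (C := B[X]) θ
  let A := Localization.Away g
  obtain ⟨f, n, h1⟩ : ∃ (f : B[X]) (n : ℕ), algebraMap B[X] A (g ^ (n + 1)) * θ' b₀ =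
      algebraMap B[X] A f := by
    obtain ⟨⟨f, _, n, rfl⟩, hf⟩ := IsLocalization.surj (.powers g) (θ' b₀)
    refine ⟨f * g, n, ?_⟩
    rw [_root_.map_mul _ f, ← hf, pow_succ, _root_.map_mul]
    ring
  have hf : Polynomial.toRatFunc B K f = Polynomial.toRatFunc B K (g ^ (n + 1)) * θ b₀ := by
    have h := congrArg (Localization.Away.toFractionField k (RatFunc K) hg0) h1
    rw [_root_.map_mul, Localization.Away.toFractionField_algebraMap,
      Localization.Away.toFractionField_algebraMap, hθ'] at h
    exact h.symm
  obtain ⟨i, j, hD⟩ :=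
    Polynomial.exists_coeff_mul_sub_ne_zero (pow_ne_zero (n + 1) hg0) hb₀ hf
  obtain ⟨χ, hχ⟩ := Algebra.FiniteType.exists_algHom_apply_ne_zero (k := k) (Ω := Ω) hD
  let σ : B[X] →ₐ[k] RatFunc Ω :=
    (IsScalarTower.toAlgHom k (Polynomial Ω) (RatFunc Ω)).comp (Polynomial.mapAlgHom χ)
  have hgχ : g.map (χ : B →+* Ω) ≠ 0 := by
    intro h
    apply hχ
    have h' (m : ℕ) : χ ((g ^ (n + 1)).coeff m) = 0 := by
      change (χ : B →+* Ω) _ = 0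
      rw [← Polynomial.coeff_map, Polynomial.map_pow, h, zero_pow n.succ_ne_zero,
        Polynomial.coeff_zero]
    simp [h']
  have hσ (q : B[X]) : σ q = algebraMap (Polynomial Ω) (RatFunc Ω) (q.map (χ : B →+* Ω)) := rfl
  have hσg : IsUnit (σ g) := by
    rw [hσ]
    exact (RatFunc.algebraMap_ne_zero hgχ).isUnit
  let κ : A →ₐ[k] RatFunc Ω := IsLocalization.liftAlgHom (M := .powers g) (f := σ)
    (isUnit_map_of_mem_powers _ hσg)
  have hκ (q : B[X]) : κ (algebraMap B[X] A q) = σ q := by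
    simp [κ]
  refine ⟨κ.comp θ', fun c hc ↦ hχ ?_⟩
  have h2 := congrArg κ h1
  rw [_root_.map_mul, hκ, hκ, hσ, hσ, ← AlgHom.comp_apply, ← hc,
    IsScalarTower.algebraMap_apply Ω (Polynomial Ω) (RatFunc Ω), ← _root_.map_mul] at h2
  have h3 := RatFunc.algebraMap_injective Ω h2
  have h4 (m : ℕ) : χ (f.coeff m) = χ ((g ^ (n + 1)).coeff m) * c := by
    simpa [-Polynomial.map_pow] using (congrArg (Polynomial.coeff · m) h3).symm
  rw [_root_.map_sub, _root_.map_mul, _root_.map_mul, h4, h4]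
  ring

end RatFuncSpecialization

section LurothSpreading

open scoped TensorProduct IntermediateField

theorem Algebra.TensorProduct.lift_injective_of_not_constant {k Ω B : Type*} [Field k] [Field Ω]
    [IsAlgClosed Ω] [Algebra k Ω] [Algebra.IsAlgebraic k Ω] [CommRing B] [IsDomain B]
    [Algebra k B] [Algebra.FiniteType k B] [Ring.KrullDimLE 1 B] [IsDomain (Ω ⊗[k] B)]
    (ψ : B →ₐ[k] RatFunc Ω) {b₀ : B} (hb₀ : ∀ c, algebraMap Ω (RatFunc Ω) c ≠ ψ b₀) :
    Function.Injective
      (Algebra.TensorProduct.lift (Algebra.ofId Ω (RatFunc Ω)) ψ fun _ _ ↦ .all _ _) := by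
  set Ψ := Algebra.TensorProduct.lift (Algebra.ofId Ω (RatFunc Ω)) ψ fun _ _ ↦ .all _ _
  have hinteg : (Algebra.TensorProduct.includeRight : B →ₐ[k] Ω ⊗[k] B).toRingHom.IsIntegral := by
    intro x
    obtain ⟨P, hP, h⟩ := Algebra.IsIntegral.isIntegral (R := B)
      (Algebra.TensorProduct.comm k Ω B x)
    refine ⟨P, hP, ?_⟩
    let c : B ⊗[k] Ω →+* Ω ⊗[k] B := (Algebra.TensorProduct.comm k Ω B).symm.toRingEquiv.toRingHom
    have hc : c.comp (algebraMap B (B ⊗[k] Ω)) =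
        (Algebra.TensorProduct.includeRight : B →ₐ[k] Ω ⊗[k] B).toRingHom := by
      ext b
      exact Algebra.TensorProduct.comm_symm_tmul (R := k) _ _
    have hx : c (Algebra.TensorProduct.comm k Ω B x) = x :=
      (Algebra.TensorProduct.comm k Ω B).symm_apply_apply x
    have h' := congrArg c h
    rwa [Polynomial.hom_eval₂, _root_.map_zero, hc, hx] at h'
  rw [injective_iff_map_eq_zero]
  by_contra! h
  obtain ⟨x, hx, hx0⟩ := h
  let _ : Algebra B (Ω ⊗[k] B) :=
    (Algebra.TensorProduct.includeRight : B →ₐ[k] Ω ⊗[k] B).toRingHom.toAlgebra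
  have h1 := Ideal.comap_ne_bot_of_integral_mem (R := B) (I := RingHom.ker Ψ) hx0 hx (hinteg x)
  have h2 : (RingHom.ker Ψ).comap (algebraMap B (Ω ⊗[k] B)) = RingHom.ker ψ := by
    ext b
    change Ψ (1 ⊗ₜ b) = 0 ↔ ψ b = 0
    simp [Ψ]
  rw [h2] at h1
  have hprime : (RingHom.ker ψ).IsPrime := RingHom.ker_isPrime _
  have hmax : (RingHom.ker ψ).IsMaximal :=
    Ring.krullDimLE_one_iff_of_isPrime_bot.mp ‹_› _ h1 hprime
  let _ : Field (B ⧸ RingHom.ker ψ) := Ideal.Quotient.field _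
  have : Module.Finite k (B ⧸ RingHom.ker ψ) :=
    finite_of_finite_type_of_isJacobsonRing k (B ⧸ RingHom.ker ψ)
  have h3 : IsAlgebraic k (ψ b₀) :=
    (Algebra.IsAlgebraic.isAlgebraic (R := k) (Ideal.Quotient.mk (RingHom.ker ψ) b₀)).algHom
      (Ideal.kerLiftAlg ψ)
  obtain ⟨c, hc⟩ := IsAlgClosed.exists_algebraMap_eq_of_isAlgebraic (h3.tower_top Ω)
  exact hb₀ c hc

/-- By Lüroth's theorem, an algebra embedding into `Ω(t)`, with nonconstant image, has
fraction field isomorphic to `Ω(t)`. -/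
theorem RatFunc.exists_algHom_surj_of_injective {Ω B : Type*} [Field Ω] [CommRing B]
    [Algebra Ω B] (Ψ : B →ₐ[Ω] RatFunc Ω) (hΨ : Function.Injective Ψ) {b₀ : B}
    (hb₀ : ∀ c, algebraMap Ω (RatFunc Ω) c ≠ Ψ b₀) :
    ∃ Φ : B →ₐ[Ω] RatFunc Ω, Function.Injective Φ ∧ ∀ z, ∃ x y, z = Φ x / Φ y := by
  let E := IntermediateField.adjoin Ω (Set.range Ψ)
  have hmem (b : B) : Ψ b ∈ E := IntermediateField.subset_adjoin _ _ ⟨b, rfl⟩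
  have hE : E ≠ ⊥ := by
    intro h
    obtain ⟨c, hc⟩ := IntermediateField.mem_bot.mp (h ▸ hmem b₀)
    exact hb₀ c hc
  let e := RatFunc.Luroth.algEquiv hE
  let Ψ' : B →ₐ[Ω] E := Ψ.codRestrict E.toSubalgebra hmem
  refine ⟨(e.symm : E →ₐ[Ω] RatFunc Ω).comp Ψ', e.symm.injective.comp fun x y h ↦
    hΨ (congrArg Subtype.val h), fun z ↦ ?_⟩
  obtain ⟨x, hx, y, hy, h⟩ := IntermediateField.mem_adjoin_iff_div.mp (e z).2
  have hr : Algebra.adjoin Ω (Set.range Ψ) = Ψ.range := by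
    rw [← AlgHom.coe_range, Algebra.adjoin_eq]
  rw [hr] at hx hy
  obtain ⟨x, rfl⟩ := hx
  obtain ⟨y, rfl⟩ := hy
  refine ⟨x, y, ?_⟩
  apply e.injective
  rw [map_div₀]
  apply Subtype.ext
  refine h.trans ?_
  change _ = ((e (e.symm (Ψ' x)) : E) : RatFunc Ω) / ((e (e.symm (Ψ' y)) : E) : RatFunc Ω)
  rw [e.apply_symm_apply, e.apply_symm_apply]
  rfl

/-- Finitely generated domains with the same fraction field have a common localization. -/
theorem exists_common_localization {k : Type*} {B C F : Type*} [CommRing k] [CommRing B]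
    [IsDomain B] [Algebra k B] [Algebra.FiniteType k B] [CommRing C] [IsDomain C] [Algebra k C]
    [Algebra.FiniteType k C] [Field F] [Algebra k F] [Algebra B F] [IsScalarTower k B F]
    [IsFractionRing B F] [Algebra C F] [IsScalarTower k C F] [IsFractionRing C F] :
    ∃ (f : B) (g : C) (θ : Localization.Away g →ₐ[k] Localization.Away f)
      (a : Localization.Away g), f ≠ 0 ∧
      @IsLocalization.Away _ _ a (Localization.Away f) _ θ.toRingHom.toAlgebra := by
  obtain ⟨g, hg, β, hβ⟩ := Algebra.FiniteType.exists_algHom_localizationAway (k := k) (A := B)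
    (C := C) (IsScalarTower.toAlgHom k B F)
  have : Algebra.FiniteType k (Localization.Away g) := .trans (S := C) inferInstance
    (IsLocalization.finiteType_of_monoid_fg (.powers g) _)
  obtain ⟨f, hf, θ, hθ⟩ := Algebra.FiniteType.exists_algHom_localizationAway (C := B)
    (Localization.Away.toFractionField k F hg)
  refine ⟨f, g, θ, β f, hf, ?_⟩
  let _ := θ.toRingHom.toAlgebra
  have hι := Localization.Away.toFractionField_injective (k := k) (F := F) hf
  have hθβ (b : B) : θ (β b) = algebraMap B (Localization.Away f) b := by
    apply hι
    rw [hθ, hβ, Localization.Away.toFractionField_algebraMap]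
    rfl
  have hθi : Function.Injective θ := by
    refine .of_comp (f := Localization.Away.toFractionField k F hf) ?_
    have : Localization.Away.toFractionField k F hf ∘ θ =
      Localization.Away.toFractionField k F hg := funext hθ
    rw [this]
    exact Localization.Away.toFractionField_injective hg
  refine (isLocalization_iff _ _).mpr ⟨?_, fun z ↦ ?_, fun {x y} h ↦ ⟨1, by rw [hθi h]⟩⟩
  · refine isUnit_map_of_mem_powers θ ?_
    rw [hθβ]
    exact IsLocalization.Away.algebraMap_isUnit f
  · obtain ⟨⟨b, _, n, rfl⟩, hb⟩ := IsLocalization.surj (.powers f) z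
    refine ⟨(β b, ⟨β f ^ n, n, rfl⟩), ?_⟩
    change z * θ _ = θ _
    rw [hθβ, ← hb, _root_.map_pow, hθβ, _root_.map_pow]

end LurothSpreading

open TensorProduct in
theorem exists_common_localization_tensorProduct {k Ω B K : Type*} [Field k] [Field Ω]
    [IsAlgClosed Ω] [Algebra k Ω] [Algebra.IsAlgebraic k Ω] [CommRing B] [IsDomain B]
    [Algebra k B] [Algebra.Smooth k B] [Ring.KrullDimLE 1 B] [Field K] [Algebra k K]
    [Algebra B K] [IsFractionRing B K] [IsScalarTower k B K]
    (hk : ∀ x : K, IsAlgebraic k x → ∃ c, algebraMap k K c = x) (θ : B →ₐ[k] RatFunc K) {b₀ : B}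
    (hb₀ : ∀ c, algebraMap K (RatFunc K) c ≠ θ b₀) :
    IsDomain (Ω ⊗[k] B) ∧ ∃ (f : Ω ⊗[k] B) (g : Polynomial Ω)
      (τ : Localization.Away g →ₐ[Ω] Localization.Away f) (a : Localization.Away g), f ≠ 0 ∧
      @IsLocalization.Away _ _ a (Localization.Away f) _ τ.toRingHom.toAlgebra := by
  have hdom : IsDomain (Ω ⊗[k] B) := Algebra.Smooth.isDomain_tensorProduct hk
  refine ⟨hdom, ?_⟩
  obtain ⟨ψ, hψ⟩ := exists_algHom_ratFunc_of_algHom_ratFunc (Ω := Ω) θ hb₀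
  have hinj := Algebra.TensorProduct.lift_injective_of_not_constant ψ hψ
  obtain ⟨Φ, hΦ, hsurj⟩ := RatFunc.exists_algHom_surj_of_injective _ hinj
    (b₀ := (1 : Ω) ⊗ₜ[k] b₀) (by simpa using hψ)
  let : Algebra (Ω ⊗[k] B) (RatFunc Ω) := Φ.toRingHom.toAlgebra
  have : IsScalarTower Ω (Ω ⊗[k] B) (RatFunc Ω) := .of_algebraMap_eq fun x ↦ (Φ.commutes x).symm
  have : FaithfulSMul (Ω ⊗[k] B) (RatFunc Ω) := (faithfulSMul_iff_algebraMap_injective _ _).2 hΦ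
  have : IsFractionRing (Ω ⊗[k] B) (RatFunc Ω) := IsFractionRing.of_field _ _ hsurj
  exact exists_common_localization (F := RatFunc Ω)

universe u in
theorem Module.finite_of_trdeg_eq_of_essFiniteType (k : Type*) {K K' : Type u} [Field k] [Field K]
    [Field K'] [Algebra k K] [Algebra k K'] [Algebra K K'] [IsScalarTower k K K']
    [Algebra.EssFiniteType k K'] (h : Algebra.trdeg k K = Algebra.trdeg k K')
    (hfin : Algebra.trdeg k K' < Cardinal.aleph0) : Module.Finite K K' := by
  have h1 := trdeg_add_eq k K (A := K')
  have h2 : Algebra.trdeg K K' = 0 := by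
    rw [h] at h1
    exact Cardinal.eq_of_add_eq_add_left (h1.trans (add_zero _).symm) hfin
  have := trdeg_eq_zero_iff.mp h2
  have := Algebra.EssFiniteType.of_comp k K K'
  obtain ⟨s, hs⟩ := IntermediateField.fg_top K K'
  have := IntermediateField.finiteDimensional_adjoin (K := K) (S := (s : Set K'))
    fun x _ ↦ Algebra.IsIntegral.isIntegral x
  rw [hs] at this
  exact Module.Finite.equiv (IntermediateField.topEquiv (F := K) (E := K')).toLinearEquiv

universe u in
theorem AlgHom.finite_of_krullDimLE_one {k : Type*} (B : Type u) {F K : Type u} [Field k]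
    [CommRing B] [IsDomain B] [Algebra k B] [Algebra.FiniteType k B] [Ring.KrullDimLE 1 B]
    [Field F] [Algebra k F] [Algebra B F] [IsFractionRing B F] [IsScalarTower k B F]
    [Field K] [Algebra k K] [Algebra B K] [IsFractionRing B K] [IsScalarTower k B K]
    (i : F →ₐ[k] K) : i.toRingHom.Finite := by
  have : Algebra.EssFiniteType B K := .of_isLocalization _ (nonZeroDivisors B)
  have : Algebra.EssFiniteType k K := .comp k B K
  have : Algebra.IsAlgebraic B K := IsLocalization.isAlgebraic _ (nonZeroDivisors B)
  have : Algebra.IsAlgebraic B F := IsLocalization.isAlgebraic _ (nonZeroDivisors B)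
  have hK := trdeg_add_eq k B (A := K)
  have hF := trdeg_add_eq k B (A := F)
  rw [trdeg_eq_zero (R := B), add_zero] at hK hF
  algebraize [i.toRingHom]
  have : IsScalarTower k F K := .of_algebraMap_eq fun x ↦ (i.commutes x).symm
  exact Module.finite_of_trdeg_eq_of_essFiniteType k (hF.symm.trans hK)
    (hK ▸ (Algebra.trdeg_le_one_of_krullDimLE k).trans_lt Cardinal.one_lt_aleph0)

/-- The (left) action by ring automorphisms attached to a right action by endomorphisms. -/
abbrev MulSemiringAction.ofEndomorphisms {Γ L : Type*} [Group Γ] [Semiring L] (γ : Γ → L →+* L)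
    (h₁ : γ 1 = RingHom.id L) (hmul : ∀ f g, γ (f * g) = (γ g).comp (γ f)) :
    MulSemiringAction Γ L where
  smul g x := γ g⁻¹ x
  one_smul x := by change γ 1⁻¹ x = x; simp [h₁]
  mul_smul f g x := by
    change γ (f * g)⁻¹ x = γ f⁻¹ (γ g⁻¹ x)
    simp [hmul]
  smul_zero g := _root_.map_zero (γ g⁻¹)
  smul_add g := _root_.map_add (γ g⁻¹)
  smul_one g := _root_.map_one (γ g⁻¹)
  smul_mul g := _root_.map_mul (γ g⁻¹)

open IsLocalRing in
theorem IsPJordan.of_endomorphisms_ratFunc {p : ℕ} [Fact p.Prime] {k O F K : Type*} [Field k]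
    [CommRing O] [IsDomain O] [IsLocalRing O] [IsNoetherianRing O] [Field F] [Field K] [CharP k p]
    [Algebra k O] [Algebra k K] [Algebra O F] [IsFractionRing O F]
    (hk : ∀ x : K, IsAlgebraic k x → ∃ c, algebraMap k K c = x)
    (i : F →+* K) (hi : i.Finite) (hik : ∀ c, i (algebraMap O F (algebraMap k O c)) =
      algebraMap k K c) (hprin : (maximalIdeal O).IsPrincipal) [Module.Finite k (ResidueField O)]
    {Γ : Type*} [Group Γ] (γ : Γ → RatFunc K →+* RatFunc K) (h₁ : γ 1 = RingHom.id _)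
    (hmul : ∀ f g, γ (f * g) = (γ g).comp (γ f)) (hinj : ∀ g, γ g = RingHom.id _ → g = 1)
    (hΓk : ∀ g c, γ g (RatFunc.C (algebraMap k K c)) = RatFunc.C (algebraMap k K c))
    (Γ₀ : Subgroup Γ) [Γ₀.FiniteIndex] (hΓO : ∀ g ∈ Γ₀, ∀ a : O, ∃ b : O,
      RatFunc.C (i (algebraMap O F b)) = γ g (RatFunc.C (i (algebraMap O F a)))) :
    IsPJordan p Γ := by
  let := MulSemiringAction.ofEndomorphisms γ h₁ hmul
  let := i.toAlgebra
  let : Algebra O K := (i.comp (algebraMap O F)).toAlgebra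
  have : IsScalarTower O F K := .of_algebraMap_eq fun _ ↦ rfl
  have : IsScalarTower k O K := .of_algebraMap_eq fun c ↦ (hik c).symm
  have : Module.Finite F K := hi
  have : FaithfulSMul Γ (RatFunc K) := by
    refine ⟨fun {f g} h ↦ ?_⟩
    have h2 : γ (f⁻¹ * g) = RingHom.id _ := by
      ext x
      have h3 : γ f⁻¹ x = γ g⁻¹ x := h x
      rw [hmul, RingHom.comp_apply, h3, ← RingHom.comp_apply, ← hmul, inv_mul_cancel, h₁]
    exact inv_mul_eq_one.mp (hinj _ h2)
  exact IsPJordan.of_mulSemiringAction (O := O) (F := F) hk (AlgEquiv.refl (A₁ := RatFunc K)) hprin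
    (fun g c ↦ hΓk g⁻¹ c) Γ₀ fun g hg ↦ hΓO g⁻¹ (inv_mem hg)

section GenericPoints

open IsLocalRing

/-- The ring homomorphism from the local ring at a specialization of the image of the closed point
induced by a morphism from the spectrum of a local ring. -/
noncomputable def AlgebraicGeometry.Scheme.stalkToOfSpecializes {X : Scheme} {R : CommRingCat}
    [IsLocalRing R] (f : Spec R ⟶ X) {x : X} (h : f (closedPoint R) ⤳ x) :
    X.presheaf.stalk x ⟶ R :=
  X.presheaf.stalkSpecializes h ≫ Scheme.stalkClosedPointTo f

theorem AlgebraicGeometry.Scheme.SpecMap_stalkToOfSpecializes {X : Scheme} {R : CommRingCat}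
    [IsLocalRing R] (f : Spec R ⟶ X) {x : X} (h : f (closedPoint R) ⤳ x) :
    Spec.map (Scheme.stalkToOfSpecializes f h) ≫ X.fromSpecStalk x = f := by
  rw [stalkToOfSpecializes, Spec.map_comp, Category.assoc, SpecMap_stalkSpecializes_fromSpecStalk,
    Spec_stalkClosedPointTo_fromSpecStalk]

theorem AlgebraicGeometry.Scheme.hom_ext_of_SpecMap_comp_fromSpecStalk {X : Scheme}
    {R : CommRingCat} {x : X} {a b : X.presheaf.stalk x ⟶ R}
    (h : Spec.map a ≫ X.fromSpecStalk x = Spec.map b ≫ X.fromSpecStalk x) : a = b :=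
  Spec.map_injective ((cancel_mono _).mp h)

theorem AlgebraicGeometry.Scheme.mono_of_isIso_stalkClosedPointTo {X : Scheme} {R : CommRingCat}
    [IsLocalRing R] (j : Spec R ⟶ X) [IsIso (Scheme.stalkClosedPointTo j)] : Mono j := by
  rw [← Scheme.Spec_stalkClosedPointTo_fromSpecStalk j]
  infer_instance

theorem AlgebraicGeometry.Scheme.exists_SpecMap_comp_eq {X : Scheme} {R R' : CommRingCat}
    [IsLocalRing R] [IsLocalRing R'] (j : Spec R ⟶ X) [IsIso (Scheme.stalkClosedPointTo j)]
    (f : Spec R' ⟶ X) (h : f (closedPoint R') = j (closedPoint R)) :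
    ∃ γ : R ⟶ R', Spec.map γ ≫ j = f := by
  refine ⟨inv (Scheme.stalkClosedPointTo j) ≫ Scheme.stalkToOfSpecializes f (h ▸ specializes_rfl),
    ?_⟩
  refine (congrArg (_ ≫ ·) (Scheme.Spec_stalkClosedPointTo_fromSpecStalk j).symm).trans ?_
  rw [← Category.assoc, ← Spec.map_comp, IsIso.hom_inv_id_assoc]
  exact Scheme.SpecMap_stalkToOfSpecializes f (h ▸ specializes_rfl)

theorem AlgebraicGeometry.Scheme.specializes_of_isDominant {X : Scheme} {F : Type} [Field F]
    (f : Spec (.of F) ⟶ X) [IsDominant f] (x : X) : f (closedPoint F) ⤳ x := by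
  rw [specializes_iff_mem_closure]
  have h := f.denseRange x
  have hr : Set.range f = {f (closedPoint F)} := by
    ext y
    constructor
    · rintro ⟨a, rfl⟩
      exact congrArg f (Subsingleton.elim (α := PrimeSpectrum F) _ _)
    · rintro rfl
      exact ⟨_, rfl⟩
  rwa [hr] at h

theorem AlgebraicGeometry.Scheme.apply_closedPoint_eq_of_isDominant {X : Scheme} {F F' : Type}
    [Field F] [Field F'] (f : Spec (.of F) ⟶ X) [IsDominant f] (j : Spec (.of F') ⟶ X)
    [IsDominant j] : f (closedPoint F) = j (closedPoint F') :=
  ((specializes_of_isDominant f _).antisymm (specializes_of_isDominant j _)).eq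

theorem AlgebraicGeometry.exists_endomorphisms_of_isDominant {F : Type} [Field F] {S T : Scheme}
    (sS : S ⟶ T) [IsReduced S] [IsSeparated sS] (j : Spec (.of F) ⟶ S) [IsDominant j]
    [IsIso (Scheme.stalkClosedPointTo j)] :
    ∃ γ : Aut (Over.mk sS) → (F →+* F),
      (∀ g, Spec.map (CommRingCat.ofHom (γ g)) ≫ j = j ≫ g.hom.left) ∧ γ 1 = RingHom.id F ∧
      (∀ f g, γ (f * g) = (γ g).comp (γ f)) ∧ ∀ g, γ g = RingHom.id F → g = 1 := by
  have := Scheme.mono_of_isIso_stalkClosedPointTo j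
  have hex (g : Aut (Over.mk sS)) :
      ∃ γ : F →+* F, Spec.map (CommRingCat.ofHom γ) ≫ j = j ≫ g.hom.left := by
    have : IsIso (X := S) (Y := S) g.hom.left :=
      inferInstanceAs (IsIso ((Over.forget T).mapIso g).hom)
    have : IsDominant (j ≫ (g.hom.left : S ⟶ S)) := inferInstance
    obtain ⟨γ, hγ⟩ := Scheme.exists_SpecMap_comp_eq j (R' := .of F) (j ≫ g.hom.left)
      (Scheme.apply_closedPoint_eq_of_isDominant _ _)
    exact ⟨γ.hom, hγ⟩
  choose γ hγ using hex
  have hext {a b : F →+* F}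
      (h : Spec.map (CommRingCat.ofHom a) ≫ j = Spec.map (CommRingCat.ofHom b) ≫ j) : a = b :=
    congrArg CommRingCat.Hom.hom (Spec.map_injective ((cancel_mono _).mp h))
  refine ⟨γ, hγ, hext ?_, fun f g ↦ hext ?_, fun g hg ↦ ?_⟩
  · rw [hγ, CommRingCat.ofHom_id, Spec.map_id]
    exact (Category.comp_id j).symm
  · rw [hγ, CommRingCat.ofHom_comp, Spec.map_comp, Category.assoc, hγ, ← Category.assoc, hγ]
    exact (Category.assoc _ _ _).symm
  · have h := hγ g
    rw [hg, CommRingCat.ofHom_id, Spec.map_id, Category.id_comp] at h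
    have h2 : g.hom.left = 𝟙 S := ext_of_isDominant_of_isSeparated (X := S) (Y := S) sS
      ((Over.w g.hom).trans (Category.id_comp _).symm) j (h.symm.trans (Category.comp_id j).symm)
    exact Iso.ext (Over.OverMorphism.ext h2)

end GenericPoints

section Equivariance

open IsLocalRing

theorem AlgebraicGeometry.Scheme.exists_stalkToOfSpecializes_eq {X : Scheme} {R : CommRingCat}
    [IsLocalRing R] (f : Spec R ⟶ X) (γ : R ⟶ R) (h : X ⟶ X) (hγ : Spec.map γ ≫ f = f ≫ h)
    {z : X} (hz : h z = z) (hs : f (closedPoint R) ⤳ z) (a : X.presheaf.stalk z) :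
    ∃ b, Scheme.stalkToOfSpecializes f hs b = γ (Scheme.stalkToOfSpecializes f hs a) := by
  have key : ∀ z' (hz : h z = z') (hs' : f (closedPoint R) ⤳ z') (a : X.presheaf.stalk z'),
      ∃ b, Scheme.stalkToOfSpecializes f hs b = γ (Scheme.stalkToOfSpecializes f hs' a) := by
    rintro _ rfl hs' a
    refine ⟨h.stalkMap z a, ?_⟩
    suffices h.stalkMap z ≫ Scheme.stalkToOfSpecializes f hs =
        Scheme.stalkToOfSpecializes f hs' ≫ γ from congr($this a)
    apply Scheme.hom_ext_of_SpecMap_comp_fromSpecStalk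
    rw [Spec.map_comp, Category.assoc, Scheme.SpecMap_stalkMap_fromSpecStalk, ← Category.assoc,
      Scheme.SpecMap_stalkToOfSpecializes, Spec.map_comp, Category.assoc,
      Scheme.SpecMap_stalkToOfSpecializes, hγ]
  exact key z hz hs a

theorem AlgebraicGeometry.Scheme.stalkSpecializes_stalkToOfSpecializes {X : Scheme}
    {R : CommRingCat} [IsLocalRing R] (f : Spec R ⟶ X) {x y : X} (h : f (closedPoint R) ⤳ x)
    (h' : x ⤳ y) : X.presheaf.stalkSpecializes h' ≫ Scheme.stalkToOfSpecializes f h =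
      Scheme.stalkToOfSpecializes f (h.trans h') := by
  simp [stalkToOfSpecializes]

theorem RingHom.exists_comp_eq_of_range_subset {A B C : Type*} [Ring A] [Ring B] [Ring C]
    (f : A →+* C) (g : B →+* C) (hg : Function.Injective g) (h : ∀ a, ∃ b, g b = f a) :
    ∃ i : A →+* B, g.comp i = f := by
  let e := RingEquiv.ofLeftInverse (Function.leftInverse_invFun hg)
  refine ⟨e.symm.toRingHom.comp (f.codRestrict g.range h), RingHom.ext fun a ↦ ?_⟩
  exact congrArg Subtype.val (e.apply_symm_apply (f.codRestrict g.range h a))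

theorem Subgroup.finiteIndex_of_forall_mem_iff {Γ α : Type*} [Group Γ] (Γ₀ : Subgroup Γ)
    (a : Γ → α → α) (h₁ : ∀ x, a 1 x = x) (hmul : ∀ f g x, a (f * g) x = a f (a g x)) {Z : Set α}
    (hZ : Z.Finite) {z : α} (hpres : ∀ g, a g z ∈ Z)
    (h : ∀ g, g ∈ Γ₀ ↔ a g z = z) : Γ₀.FiniteIndex := by
  let : MulAction Γ α := { smul := a, one_smul := h₁, mul_smul := hmul }
  have h0 : Γ₀ = MulAction.stabilizer Γ z := Subgroup.ext h
  have : Finite (MulAction.orbit Γ z) := hZ.subset (by rintro _ ⟨g, rfl⟩; exact hpres g)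
  have : Finite (Γ ⧸ Γ₀) := by
    rw [h0]
    exact Finite.of_equiv _ (MulAction.orbitEquivQuotientStabilizer Γ z)
  exact Subgroup.finiteIndex_of_finite_quotient

end Equivariance

section Constants

open IsLocalRing

/-- The constants in the sections over an open subset of a scheme over `k`. -/
noncomputable def AlgebraicGeometry.Scheme.constants {k : Type} [CommRing k] {X : Scheme}
    (sX : X ⟶ Spec (.of k)) (U : X.Opens) : CommRingCat.of k ⟶ Γ(X, U) :=
  (Scheme.ΓSpecIso (.of k)).inv ≫ sX.appLE ⊤ U le_top

/-- The constants in the stalk at a point of a scheme over `k`. -/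
noncomputable def AlgebraicGeometry.Scheme.stalkConstants {k : Type} [CommRing k] {X : Scheme}
    (sX : X ⟶ Spec (.of k)) (x : X) : CommRingCat.of k ⟶ X.presheaf.stalk x :=
  Scheme.constants sX ⊤ ≫ X.presheaf.germ ⊤ x trivial

theorem AlgebraicGeometry.Scheme.constants_germ {k : Type} [CommRing k] {X : Scheme}
    (sX : X ⟶ Spec (.of k)) (U : X.Opens) (x : X) (hx : x ∈ U) :
    Scheme.constants sX U ≫ X.presheaf.germ U x hx = Scheme.stalkConstants sX x := by
  have h := Scheme.Hom.appLE_map sX (U := ⊤) (V := ⊤) le_top (homOfLE le_top : U ⟶ ⊤).op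
  rw [stalkConstants, ← X.presheaf.germ_res (homOfLE le_top : U ⟶ ⊤) x hx, ← Category.assoc]
  congr 1
  rw [constants, constants, Category.assoc]
  exact congrArg _ h.symm

theorem AlgebraicGeometry.Scheme.SpecMap_constants {k : Type} [CommRing k] {X : Scheme}
    (sX : X ⟶ Spec (.of k)) {U : X.Opens} (hU : IsAffineOpen U) :
    Spec.map (Scheme.constants sX U) = hU.fromSpec ≫ sX := by
  have h := IsAffineOpen.SpecMap_appLE_fromSpec sX (isAffineOpen_top _) hU le_top
  rw [← h, constants, Spec.map_comp, IsAffineOpen.fromSpec_top, Scheme.isoSpec_Spec_inv]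

theorem AlgebraicGeometry.Scheme.SpecMap_stalkConstants {k : Type} [CommRing k] {X : Scheme}
    (sX : X ⟶ Spec (.of k)) (x : X) :
    Spec.map (Scheme.stalkConstants sX x) = X.fromSpecStalk x ≫ sX := by
  obtain ⟨_, ⟨U, hU, rfl⟩, hxU, -⟩ := X.isBasis_affineOpens.exists_subset_of_mem_open
    (Set.mem_univ x) isOpen_univ
  rw [← constants_germ sX U x hxU, Spec.map_comp, SpecMap_constants sX hU,
    ← hU.fromSpecStalk_eq_fromSpecStalk hxU, ← Category.assoc]
  rfl

theorem AlgebraicGeometry.Scheme.smooth_constants {k : Type} [CommRing k] {X : Scheme}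
    (sX : X ⟶ Spec (.of k)) [Smooth sX] {U : X.Opens} (hU : IsAffineOpen U) :
    (Scheme.constants sX U).hom.Smooth := by
  have h : (sX.appLE ⊤ U le_top).hom.Smooth :=
    Smooth.smooth_appLE sX (isAffineOpen_top _) hU le_top
  exact RingHom.Smooth.respectsIso.2 _ (Scheme.ΓSpecIso (.of k)).symm.commRingCatIsoToRingEquiv h

theorem AlgebraicGeometry.IsAffineOpen.krullDimLE {X : Scheme} {U : X.Opens} (hU : IsAffineOpen U)
    {n : ℕ} (h : topologicalKrullDim X ≤ n) : Ring.KrullDimLE n Γ(X, U) := by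
  rw [Ring.krullDimLE_iff, ← PrimeSpectrum.topologicalKrullDim_eq_ringKrullDim]
  exact (hU.fromSpec.isOpenEmbedding.isInducing.topologicalKrullDim_le).trans h

theorem AlgebraicGeometry.Smooth.stalk_of_isClosed {k : Type} [Field k] {X : Scheme}
    (sX : X ⟶ Spec (.of k)) [IsIntegral X] [Smooth sX] (hdim : topologicalKrullDim X ≤ 1) {z : X}
    (hz : IsClosed {z}) : (maximalIdeal (X.presheaf.stalk z)).IsPrincipal ∧
      IsNoetherianRing (X.presheaf.stalk z) ∧
      ((residue (X.presheaf.stalk z)).comp (Scheme.stalkConstants sX z).hom).Finite := by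
  obtain ⟨_, ⟨U, hU, rfl⟩, hzU, -⟩ := X.isBasis_affineOpens.exists_subset_of_mem_open
    (Set.mem_univ z) isOpen_univ
  have : Nonempty U := ⟨⟨z, hzU⟩⟩
  algebraize [(Scheme.constants sX U).hom]
  have : Algebra.Smooth k Γ(X, U) := Scheme.smooth_constants sX hU
  have : Ring.KrullDimLE 1 Γ(X, U) := hU.krullDimLE hdim
  obtain ⟨x, rfl⟩ : ∃ x : U, x.1 = z := ⟨⟨z, hzU⟩, rfl⟩
  have hloc := hU.isLocalization_stalk x
  have hmax := hU.primeIdealOf_isMaximal_of_isClosed x hz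
  have : IsNoetherianRing Γ(X, U) := Algebra.FiniteType.isNoetherianRing k _
  refine ⟨Algebra.Smooth.isPrincipal_maximalIdeal k (hU.primeIdealOf x).asIdeal _,
    IsLocalization.isNoetherianRing (hU.primeIdealOf x).asIdeal.primeCompl _ inferInstance, ?_⟩
  have hsurj : Function.Surjective
      ((residue (X.presheaf.stalk x.1)).comp (X.presheaf.germ U x x.2).hom) := by
    intro y
    obtain ⟨y, rfl⟩ :=
      (IsLocalization.AtPrime.equivQuotMaximalIdeal (hU.primeIdealOf x).asIdeal _).surjective y
    obtain ⟨y, rfl⟩ := Ideal.Quotient.mk_surjective y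
    exact ⟨y, rfl⟩
  have hft : (((residue (X.presheaf.stalk x.1)).comp (X.presheaf.germ U x x.2).hom).comp
      (Scheme.constants sX U).hom).FiniteType :=
    (RingHom.FiniteType.of_surjective _ hsurj).comp
      (show Algebra.FiniteType k Γ(X, U) from inferInstance)
  rw [← Scheme.constants_germ sX U x x.2]
  let := ((residue (X.presheaf.stalk x.1)).comp
    (Scheme.constants sX U ≫ X.presheaf.germ U x x.2).hom).toAlgebra
  have : Algebra.FiniteType k (ResidueField (X.presheaf.stalk x.1)) := hft
  exact finite_of_finite_type_of_isJacobsonRing k (ResidueField (X.presheaf.stalk x.1))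

end Constants

section ProjectiveLine

theorem MvPolynomial.IsHomogeneous.aeval_mul_left {σ k R : Type*} [CommRing k] [CommRing R]
    [Algebra k R] {x : MvPolynomial σ k} {n : ℕ} (hx : x.IsHomogeneous n) (r : R) (a : σ → R) :
    MvPolynomial.aeval (fun i ↦ r * a i) x = r ^ n * MvPolynomial.aeval a x := by
  simp only [aeval_def, MvPolynomial.eval₂_eq, Finset.mul_sum]
  refine Finset.sum_congr rfl fun d hd ↦ ?_
  have hdeg : ∑ i ∈ d.support, d i = n := by
    rw [← hx (mem_support_iff.mp hd), Finsupp.weight_apply, Finsupp.sum]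
    simp
  simp only [mul_pow, Finset.prod_mul_distrib, Finset.prod_pow_eq_pow_sum, hdeg]
  ring

theorem isHomogeneous_X_zero (k : Type) [CommRing k] :
    (X 0 : MvPolynomial (Fin 2) k) ∈ homogeneousSubmodule (Fin 2) k 1 :=
  isHomogeneous_X k 0

/-- Dehomogenization on the standard chart of the projective line. -/
noncomputable def dehomogenize (k : Type) [CommRing k] :
    HomogeneousLocalization.Away (homogeneousSubmodule (Fin 2) k) (X 0) →+* Polynomial k :=
  (IsLocalization.Away.lift (S := Localization.Away (X 0 : MvPolynomial (Fin 2) k)) (X 0)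
    (g := (aeval ![1, Polynomial.X] : MvPolynomial (Fin 2) k →ₐ[k] Polynomial k).toRingHom)
    (by simp)).comp (algebraMap _ _)

/-- Homogenization on the standard chart of the projective line. -/
noncomputable def homogenize (k : Type) [CommRing k] :
    Polynomial k →+* HomogeneousLocalization.Away (homogeneousSubmodule (Fin 2) k) (X 0) :=
  Polynomial.eval₂RingHom ((HomogeneousLocalization.fromZeroRingHom _ _).comp (constHom k 1))
    (HomogeneousLocalization.Away.mk _ (isHomogeneous_X_zero k) 1 (X 1)
      (by simpa using isHomogeneous_X k (1 : Fin 2)))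

theorem dehomogenize_mk (k : Type) [CommRing k] (n : ℕ) (x : MvPolynomial (Fin 2) k)
    (hx : x ∈ homogeneousSubmodule (Fin 2) k (n • 1)) :
    dehomogenize k (.mk _ (isHomogeneous_X_zero k) n x hx) = aeval ![1, Polynomial.X] x := by
  rw [dehomogenize, RingHom.comp_apply, HomogeneousLocalization.algebraMap_apply,
    HomogeneousLocalization.Away.val_mk, Localization.mk_eq_mk', IsLocalization.Away.lift,
    IsLocalization.lift_mk'_spec]
  simp

theorem dehomogenize_fromZeroRingHom (k : Type) [CommRing k] (c : k) :
    dehomogenize k (HomogeneousLocalization.fromZeroRingHom _ _ (constHom k 1 c)) =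
      Polynomial.C c := by
  have : HomogeneousLocalization.fromZeroRingHom _ _ (constHom k 1 c) =
      HomogeneousLocalization.Away.mk _ (isHomogeneous_X_zero k) 0 (MvPolynomial.C c)
        (by simp) := by
    apply HomogeneousLocalization.val_injective
    rw [HomogeneousLocalization.Away.val_mk]
    simp only [pow_zero]
    rfl
  rw [this, dehomogenize_mk]
  simp

theorem homogenize_dehomogenize (k : Type) [CommRing k] (y) :
    homogenize k (dehomogenize k y) = y := by
  obtain ⟨n, x, hx, rfl⟩ := HomogeneousLocalization.Away.mk_surjective _ (isHomogeneous_X_zero k) y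
  rw [dehomogenize_mk]
  apply HomogeneousLocalization.val_injective
  let R := Localization.Away (X 0 : MvPolynomial (Fin 2) k)
  let t : R := Localization.mk (X 1) ⟨X 0 ^ 1, 1, rfl⟩
  have h1 : (algebraMap _ R).comp ((homogenize k).comp
      (aeval ![1, Polynomial.X] : MvPolynomial (Fin 2) k →ₐ[k] Polynomial k).toRingHom) =
      (aeval ![1, t] : MvPolynomial (Fin 2) k →ₐ[k] R).toRingHom := by
    apply MvPolynomial.ringHom_ext
    · intro c
      simp [homogenize]
      rfl
    · intro i
      fin_cases i
      · simp [homogenize]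
      · simp only [Fin.mk_one, RingHom.comp_apply, AlgHom.toRingHom_eq_coe, RingHom.coe_coe,
          aeval_X, Matrix.cons_val_one, Matrix.cons_val_fin_one, homogenize,
          Polynomial.coe_eval₂RingHom, Polynomial.eval₂_X]
        rfl
  have h2 := congr($h1 x)
  have h3 : IsUnit (algebraMap (MvPolynomial (Fin 2) k) R (X 0) ^ n) :=
    (IsLocalization.Away.algebraMap_isUnit _).pow n
  refine h2.trans (h3.mul_left_cancel ?_)
  rw [HomogeneousLocalization.Away.val_mk]
  have hx' : x.IsHomogeneous n := by simpa using hx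
  refine (hx'.aeval_mul_left _ _).symm.trans ?_
  have h4 : (fun i ↦ algebraMap (MvPolynomial (Fin 2) k) R (X 0) * ![1, t] i) =
      fun i ↦ algebraMap (MvPolynomial (Fin 2) k) R (X i) := by
    funext i
    fin_cases i
    · simp
    · refine Eq.trans ?_ (IsLocalization.mk'_spec' R (X 1)
        (⟨X 0 ^ 1, 1, rfl⟩ : Submonoid.powers (X 0 : MvPolynomial (Fin 2) k)))
      rw [← Localization.mk_eq_mk']
      simp [t]
  rw [h4, Localization.mk_eq_mk', ← _root_.map_pow]
  refine Eq.trans ?_ (IsLocalization.mk'_spec' R x _).symm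
  have h5 := MvPolynomial.aeval_algebraMap_apply R (X : Fin 2 → MvPolynomial (Fin 2) k) x
  exact h5.trans (by rw [MvPolynomial.aeval_X_left_apply])

theorem dehomogenize_homogenize (k : Type) [CommRing k] (y) :
    dehomogenize k (homogenize k y) = y := by
  suffices (dehomogenize k).comp (homogenize k) = RingHom.id _ from congr($this y)
  ext c
  · simp [homogenize, dehomogenize_fromZeroRingHom]
  · simp [homogenize, dehomogenize_mk]

end ProjectiveLine

theorem AlgebraicGeometry.Proj.dense_basicOpen {σ A : Type} [CommRing A] [IsDomain A]
    [SetLike σ A] [AddSubgroupClass σ A] (𝒜 : ℕ → σ) [GradedRing 𝒜] {f : A} (hf : f ≠ 0)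
    {m : ℕ} (f_deg : f ∈ 𝒜 m) (hm : 0 < m) : Dense (Proj.basicOpen 𝒜 f : Set (Proj 𝒜)) := by
  have hbot : (⊥ : HomogeneousIdeal 𝒜).toIdeal.IsPrime := by
    rw [HomogeneousIdeal.toIdeal_bot]; exact Ideal.isPrime_bot
  let η : ProjectiveSpectrum 𝒜 := ⟨⊥, hbot, fun h ↦ hf <| by
    have : f ∈ HomogeneousIdeal.irrelevant 𝒜 := by
      rw [HomogeneousIdeal.mem_irrelevant_iff, GradedRing.proj_apply,
        DirectSum.decompose_of_mem_ne 𝒜 f_deg hm.ne']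
    exact h this⟩
  refine (ProjectiveSpectrum.isTopologicalBasis_basic_opens 𝒜).dense_iff.mpr ?_
  rintro _ ⟨g, rfl⟩ ⟨x, hx⟩
  refine ⟨η, fun hg ↦ hx ?_, fun h ↦ hf h⟩
  have hg0 : g = 0 := hg
  simp [hg0]

section ProjectiveLine

/-- The standard affine chart of the projective line. -/
noncomputable def ProjSpace.chart (k : Type) [Field k] :
    Spec (CommRingCat.of (Polynomial k)) ⟶ ProjSpace k 1 :=
  Spec.map (CommRingCat.ofHom (dehomogenize k)) ≫
    Proj.awayι _ (X 0) (isHomogeneous_X_zero k) one_pos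

theorem ProjSpace.isIso_SpecMap_dehomogenize (k : Type) [Field k] :
    IsIso (Spec.map (CommRingCat.ofHom (dehomogenize k))) := by
  have : IsIso (CommRingCat.ofHom (dehomogenize k)) :=
    ⟨CommRingCat.ofHom (homogenize k),
      CommRingCat.hom_ext (RingHom.ext (homogenize_dehomogenize k)),
      CommRingCat.hom_ext (RingHom.ext (dehomogenize_homogenize k))⟩
  infer_instance

instance ProjSpace.isOpenImmersion_chart (k : Type) [Field k] :
    IsOpenImmersion (ProjSpace.chart k) := by
  have := ProjSpace.isIso_SpecMap_dehomogenize k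
  change IsOpenImmersion (Y := Proj (homogeneousSubmodule (Fin 2) k))
    (Spec.map (CommRingCat.ofHom (dehomogenize k)) ≫
      Proj.awayι _ (X 0) (isHomogeneous_X_zero k) one_pos)
  infer_instance

instance ProjSpace.isDominant_chart (k : Type) [Field k] :
    IsDominant (ProjSpace.chart k) := by
  have := ProjSpace.isIso_SpecMap_dehomogenize k
  have : IsDominant (Proj.awayι _ (X 0) (isHomogeneous_X_zero k) one_pos) := by
    constructor
    have h := Proj.opensRange_awayι _ _ (isHomogeneous_X_zero k) one_pos
    have h' : Set.range (Proj.awayι _ _ (isHomogeneous_X_zero k) one_pos) =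
        (Proj.basicOpen (homogeneousSubmodule (Fin 2) k) (X 0) : Set _) :=
      congrArg (SetLike.coe : Scheme.Opens _ → Set _) h
    rw [DenseRange, h']
    exact Proj.dense_basicOpen _ (X_ne_zero 0) (isHomogeneous_X_zero k) one_pos
  change IsDominant (Y := Proj (homogeneousSubmodule (Fin 2) k))
    (Spec.map (CommRingCat.ofHom (dehomogenize k)) ≫
      Proj.awayι _ (X 0) (isHomogeneous_X_zero k) one_pos)
  infer_instance

theorem ProjSpace.chart_str (k : Type) [Field k] :
    ProjSpace.chart k ≫ ProjSpace.str k 1 =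
      Spec.map (CommRingCat.ofHom (Polynomial.C : k →+* Polynomial k)) := by
  have h : (dehomogenize k).comp ((HomogeneousLocalization.fromZeroRingHom _ _).comp
      (constHom k 1)) = Polynomial.C :=
    RingHom.ext (dehomogenize_fromZeroRingHom k)
  rw [← h, CommRingCat.ofHom_comp, CommRingCat.ofHom_comp, Spec.map_comp, Spec.map_comp]
  change (Spec.map (CommRingCat.ofHom (dehomogenize k)) ≫
    Proj.awayι _ (X 0) (isHomogeneous_X_zero k) one_pos) ≫
      Proj.toSpecZero (homogeneousSubmodule (Fin 2) k) ≫
        Spec.map (CommRingCat.ofHom (constHom k 1)) = _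
  rw [← Proj.awayι_toSpecZero _ _ (isHomogeneous_X_zero k) one_pos, Category.assoc]
  rfl

instance ProjSpace.isSeparated_str (k : Type) [CommRing k] (n : ℕ) :
    IsSeparated (ProjSpace.str k n) := by
  unfold ProjSpace.str
  exact MorphismProperty.comp_mem @IsSeparated _ _ (Proj.isSeparated _) inferInstance

theorem IsQuasiProjectiveOver.isSeparated {k : Type} [Field k] {X : Scheme}
    {sX : X ⟶ Spec (CommRingCat.of k)} (h : IsQuasiProjectiveOver k X sX) : IsSeparated sX := by
  obtain ⟨n, f, hf, rfl⟩ := h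
  have : IsSeparated f := inferInstance
  exact MorphismProperty.comp_mem @IsSeparated _ _ inferInstance inferInstance

end ProjectiveLine

section FibreProduct

/-- A chart of a fibre product over a field, built from dense affine charts of the factors. -/
theorem AlgebraicGeometry.exists_dominant_chart_pullback {k : Type} [Field k] {X Y : Scheme}
    (sX : X ⟶ Spec (CommRingCat.of k)) (sY : Y ⟶ Spec (CommRingCat.of k)) {A B T : CommRingCat}
    (f : Spec A ⟶ X) (g : Spec B ⟶ Y) [IsOpenImmersion f] [IsOpenImmersion g] [IsDominant f]
    [IsDominant g] {a : .of k ⟶ A} {b : .of k ⟶ B} (hf : f ≫ sX = Spec.map a)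
    (hg : g ≫ sY = Spec.map b) {a' : A ⟶ T} {b' : B ⟶ T} (h : IsPushout a b a' b') :
    ∃ v : Spec T ⟶ Limits.pullback sX sY, IsOpenImmersion v ∧ IsDominant v ∧
      v ≫ Limits.pullback.fst sX sY = Spec.map a' ≫ f ∧
      v ≫ Limits.pullback.snd sX sY = Spec.map b' ≫ g := by
  have hp := isPullback_SpecMap_of_isPushout _ _ _ _ h
  let m := Limits.pullback.map (Spec.map a) (Spec.map b) sX sY f g (𝟙 _) (by simp [hf])
    (by simp [hg])
  have hm : IsDominant m := by
    constructor
    have h1 := Scheme.Pullback.range_map (Spec.map a) (Spec.map b) sX sY f g (𝟙 _)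
      (by simp [hf]) (by simp [hg])
    have h2 : Dense (Limits.pullback.fst sX sY ⁻¹' Set.range f) :=
      Dense.preimage f.denseRange (Scheme.Hom.isOpenMap _)
    have h3 : Dense (Limits.pullback.snd sX sY ⁻¹' Set.range g) :=
      Dense.preimage g.denseRange (Scheme.Hom.isOpenMap _)
    have h4 : IsOpen (Limits.pullback.fst sX sY ⁻¹' Set.range f) :=
      f.isOpenEmbedding.isOpen_range.preimage (Scheme.Hom.continuous _)
    rw [DenseRange, h1]
    exact h2.inter_of_isOpen_left h3 h4
  have hm' : IsOpenImmersion m := inferInstance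
  refine ⟨hp.isoPullback.hom ≫ m, inferInstance, inferInstance, ?_, ?_⟩
  · rw [Category.assoc, show m ≫ _ = _ from Limits.pullback.lift_fst _ _ _,
      hp.isoPullback_hom_fst_assoc]
  · rw [Category.assoc, show m ≫ _ = _ from Limits.pullback.lift_snd _ _ _,
      hp.isoPullback_hom_snd_assoc]

theorem AlgebraicGeometry.IsOpenImmersion.isDominant {X Y : Scheme} (f : X ⟶ Y)
    [IsOpenImmersion f] [Nonempty X] [IrreducibleSpace Y] : IsDominant f :=
  ⟨f.isOpenEmbedding.isOpen_range.dense (Set.range_nonempty _)⟩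

theorem BirationalOver.of_isOpenImmersion {k : Type} [Field k] {X Y W : Scheme}
    {sX : X ⟶ Spec (CommRingCat.of k)} {sY : Y ⟶ Spec (CommRingCat.of k)} (f : W ⟶ X)
    (g : W ⟶ Y) [IsOpenImmersion f] [IsOpenImmersion g] [IsDominant f] [IsDominant g]
    (h : f ≫ sX = g ≫ sY) : BirationalOver k X Y sX sY := by
  refine ⟨f.opensRange, g.opensRange, f.denseRange, g.denseRange,
    f.isoOpensRange.symm ≪≫ g.isoOpensRange, ?_⟩
  rw [Iso.trans_hom, Iso.symm_hom, Category.assoc, Iso.inv_comp_eq]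
  simp [h]

theorem birationalOver_baseChangeToClosure_of_localization {k : Type} [Field k] {X : Scheme}
    {sX : X ⟶ Spec (CommRingCat.of k)} {B : Type} [CommRing B] [Algebra k B]
    (j : Spec (CommRingCat.of B) ⟶ X) [IsOpenImmersion j] [IsDominant j]
    (hj : j ≫ sX = Spec.map (CommRingCat.ofHom (algebraMap k B)))
    [IsDomain (TensorProduct k (AlgebraicClosure k) B)] {f : TensorProduct k (AlgebraicClosure k) B}
    (hf : f ≠ 0) {g : Polynomial (AlgebraicClosure k)}
    (τ : Localization.Away g →ₐ[AlgebraicClosure k] Localization.Away f) (a : Localization.Away g)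
    (hτ : @IsLocalization.Away _ _ a (Localization.Away f) _ τ.toRingHom.toAlgebra) :
    BirationalOver (AlgebraicClosure k) (BaseChangeToClosure k X sX)
      (ProjSpace (AlgebraicClosure k) 1)
      (BaseChangeToClosure.str k X sX) (ProjSpace.str (AlgebraicClosure k) 1) := by
  have hp := (CommRingCat.isPushout_tensorProduct k (AlgebraicClosure k) B).flip
  obtain ⟨v, hv, hv', -, hv2⟩ := exists_dominant_chart_pullback sX
    (Spec.map (CommRingCat.ofHom (algebraMap k (AlgebraicClosure k)))) j (𝟙 _) hj (by simp) hp
  let l : Spec (.of (Localization.Away f)) ⟶ Spec (.of (TensorProduct k (AlgebraicClosure k) B)) :=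
    Spec.map (CommRingCat.ofHom (algebraMap _ _))
  let m : Spec (.of (Localization.Away g)) ⟶ Spec (.of (Polynomial (AlgebraicClosure k))) :=
    Spec.map (CommRingCat.ofHom (algebraMap _ _))
  let t : Spec (.of (Localization.Away f)) ⟶ Spec (.of (Localization.Away g)) :=
    Spec.map (CommRingCat.ofHom τ.toRingHom)
  have : IsOpenImmersion l := IsOpenImmersion.of_isLocalization f
  have : IsOpenImmersion m := IsOpenImmersion.of_isLocalization g
  have : IsOpenImmersion t := by
    let := τ.toRingHom.toAlgebra
    exact IsOpenImmersion.of_isLocalization a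
  have : Nontrivial (Localization.Away f) :=
    (IsLocalization.isDomain_of_le_nonZeroDivisors _ (M := Submonoid.powers f)
      (powers_le_nonZeroDivisors_of_noZeroDivisors hf)).toNontrivial
  have : Nonempty (Spec (.of (Localization.Away f))) :=
    inferInstanceAs (Nonempty (PrimeSpectrum (Localization.Away f)))
  have : IsDominant l := IsOpenImmersion.isDominant l
  have : IsDominant (t ≫ m) := IsOpenImmersion.isDominant (t ≫ m)
  refine BirationalOver.of_isOpenImmersion (X := Limits.pullback sX _) (l ≫ v)
    ((t ≫ m) ≫ ProjSpace.chart (AlgebraicClosure k)) ?_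
  refine (Category.assoc l v _).trans ?_
  rw [Category.assoc, ProjSpace.chart_str]
  refine (congrArg (l ≫ ·) hv2).trans ?_
  simp only [Category.comp_id, l, t, m, ← Spec.map_comp, ← CommRingCat.ofHom_comp]
  congr 2
  ext x
  exact (τ.commutes x).symm

end FibreProduct

section GenericPoint

theorem AlgebraicGeometry.Scheme.isIso_stalkClosedPointTo_SpecMap {R F : Type} [CommRing R]
    [IsDomain R] [Field F] [Algebra R F] [IsFractionRing R F] :
    IsIso (Scheme.stalkClosedPointTo (Spec.map (CommRingCat.ofHom (algebraMap R F)))) := by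
  set φ := CommRingCat.ofHom (algebraMap R F)
  have hφ : Function.Injective (algebraMap R F) := IsFractionRing.injective R F
  have hσ (s) : (stalkClosedPointTo (Spec.map φ)).hom
      ((Spec (.of R)).presheaf.germ ⊤ _ trivial s) = algebraMap R F ((ΓSpecIso (.of R)).hom s) :=
    congr($(germ_stalkClosedPointTo_Spec φ) s)
  have hinv (a : R) : (ΓSpecIso (.of R)).hom ((ΓSpecIso (.of R)).inv a) = a := by simp
  rw [ConcreteCategory.isIso_iff_bijective]
  constructor
  · refine (injective_iff_map_eq_zero (stalkClosedPointTo (Spec.map φ)).hom).mpr fun y hy ↦ ?_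
    let x : (⊤ : (Spec (.of R)).Opens) := ⟨Spec.map φ (IsLocalRing.closedPoint F), trivial⟩
    have := (isAffineOpen_top (Spec (.of R))).isLocalization_stalk x
    let := TopCat.Presheaf.algebra_section_stalk (Spec (.of R)).presheaf x
    obtain ⟨⟨s, t⟩, h⟩ := IsLocalization.surj
      ((isAffineOpen_top (Spec (.of R))).primeIdealOf x).asIdeal.primeCompl y
    have ht := IsLocalization.map_units ((Spec (.of R)).presheaf.stalk x.1) t
    have h' : y * (Spec (.of R)).presheaf.germ ⊤ _ trivial t.1 =
        (Spec (.of R)).presheaf.germ ⊤ _ trivial s := h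
    have hs : s = 0 := by
      have := congr((stalkClosedPointTo (Spec.map φ)).hom $h')
      rw [_root_.map_mul, hy, zero_mul, hσ] at this
      have h0 := hφ (this.symm.trans (_root_.map_zero _).symm)
      have h1 : (ΓSpecIso (.of R)).inv ((ΓSpecIso (.of R)).hom s) = s := by simp
      rw [← h1, h0, _root_.map_zero]
    rw [hs, _root_.map_zero] at h'
    exact ht.mul_left_eq_zero.mp h'
  · intro z
    obtain ⟨a, b, hb, rfl⟩ := IsFractionRing.div_surjective (A := R) z
    have hb0 : algebraMap R F b ≠ 0 := by simpa using nonZeroDivisors.ne_zero hb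
    have hu : IsUnit ((Spec (.of R)).presheaf.germ ⊤ (Spec.map φ (IsLocalRing.closedPoint F))
        trivial ((ΓSpecIso (.of R)).inv b)) := by
      refine isUnit_of_map_unit (stalkClosedPointTo (Spec.map φ)).hom _ ?_
      rw [hσ, hinv]
      exact hb0.isUnit
    obtain ⟨c, hc⟩ := hu.exists_right_inv
    have hc' := congr((stalkClosedPointTo (Spec.map φ)).hom $hc)
    rw [_root_.map_mul, hσ, hinv, _root_.map_one] at hc'
    refine ⟨(Spec (.of R)).presheaf.germ ⊤ _ trivial ((ΓSpecIso (.of R)).inv a) * c, ?_⟩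
    refine (_root_.map_mul (stalkClosedPointTo (Spec.map φ)).hom _ _).trans ?_
    rw [hσ, hinv, div_eq_mul_inv, eq_inv_of_mul_eq_one_right hc']

theorem AlgebraicGeometry.Scheme.isIso_stalkClosedPointTo_comp {R : CommRingCat} [IsLocalRing R]
    {X Y : Scheme} (f : Spec R ⟶ X) (g : X ⟶ Y) [IsOpenImmersion g]
    [IsIso (stalkClosedPointTo f)] : IsIso (stalkClosedPointTo (f ≫ g)) := by
  rw [stalkClosedPointTo_comp]
  have h : IsIso (g.stalkMap (f (IsLocalRing.closedPoint R))) := inferInstance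
  exact @IsIso.comp_isIso _ _ _ _ _ _ _ h ‹_›

/-- A dominant chart of a scheme birational to `Y` yields a generic point of `Y`. -/
theorem BirationalOver.exists_generic {k : Type} [Field k] {X Y : Scheme}
    {sX : X ⟶ Spec (CommRingCat.of k)} {sY : Y ⟶ Spec (CommRingCat.of k)}
    (h : BirationalOver k X Y sX sY) {R F : Type} [CommRing R] [IsDomain R] [Field F] [Algebra R F]
    [IsFractionRing R F] (v : Spec (.of R) ⟶ Y) [IsOpenImmersion v] [IsDominant v] :
    ∃ j : Spec (.of F) ⟶ X, IsDominant j ∧ IsIso (Scheme.stalkClosedPointTo j) ∧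
      j ≫ sX = Spec.map (CommRingCat.ofHom (algebraMap R F)) ≫ v ≫ sY := by
  obtain ⟨U, V, hU, hV, e, he⟩ := h
  let u : Spec (.of F) ⟶ Spec (.of R) := Spec.map (CommRingCat.ofHom (algebraMap R F))
  have hu : IsIso (Scheme.stalkClosedPointTo u) := Scheme.isIso_stalkClosedPointTo_SpecMap
  have hu' : IsDominant u := by
    constructor
    rw [DenseRange]
    refine (PrimeSpectrum.denseRange_comap_iff_ker_le_nilRadical (algebraMap R F)).mpr ?_
    rw [(RingHom.injective_iff_ker_eq_bot _).mp (IsFractionRing.injective R F)]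
    exact bot_le
  have hY : Nonempty Y := ⟨v (u (IsLocalRing.closedPoint F))⟩
  obtain ⟨y, hy⟩ := hV.nonempty
  have hmem : (u ≫ v) (IsLocalRing.closedPoint F) ∈ V :=
    (Scheme.specializes_of_isDominant (u ≫ v) y).mem_open V.isOpen hy
  have hrange : Set.range (u ≫ v) ⊆ Set.range V.ι := by
    rintro _ ⟨x, rfl⟩
    rw [Subsingleton.elim x (IsLocalRing.closedPoint F)]
    simpa using hmem
  let w : Spec (.of F) ⟶ V := IsOpenImmersion.lift V.ι (u ≫ v) hrange
  have hw : w ≫ V.ι = u ≫ v := IsOpenImmersion.lift_fac _ _ _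
  have hdom : IsDominant (w ≫ V.ι) := hw ▸ inferInstance
  have : IsDominant w := IsDominant.of_comp_of_isOpenImmersion w V.ι
  have : IsDominant U.ι := Opens.isDominant_ι hU
  have hiso : IsIso (Scheme.stalkClosedPointTo (w ≫ V.ι)) :=
    hw ▸ Scheme.isIso_stalkClosedPointTo_comp u v
  have : IsIso (Scheme.stalkClosedPointTo w) := by
    rw [Scheme.stalkClosedPointTo_comp] at hiso
    have h : IsIso (V.ι.stalkMap (w (IsLocalRing.closedPoint F))) := inferInstance
    exact @IsIso.of_isIso_comp_left _ _ _ _ _ _ _ h hiso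
  refine ⟨w ≫ e.inv ≫ U.ι, inferInstance, Scheme.isIso_stalkClosedPointTo_comp w _, ?_⟩
  have he' : e.inv ≫ U.ι ≫ sX = V.ι ≫ sY := by rw [← he, e.inv_hom_id_assoc]
  rw [Category.assoc, Category.assoc, he', ← Category.assoc, hw, Category.assoc]

end GenericPoint

/-- A form of the main theorem in terms of function fields: a group acting on `K(t)` over `k` and
on a function field `F ⊆ K(t)` of a non-rational curve, in such a way that a subgroup of finite
index preserves a point of that curve, is `p`-Jordan. -/
theorem IsPJordan.of_endomorphisms_of_nonrational {p : ℕ} [Fact p.Prime] {k B K O F : Type}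
    [Field k] [CharP k p] [CommRing B] [IsDomain B] [Algebra k B] [Algebra.Smooth k B]
    [Ring.KrullDimLE 1 B] [Field K] [Algebra k K] [Algebra B K] [IsFractionRing B K]
    [IsScalarTower k B K] [Field F] [Algebra k F] [Algebra B F] [IsFractionRing B F]
    [IsScalarTower k B F] [CommRing O] [IsDomain O] [IsLocalRing O] [IsNoetherianRing O]
    [Algebra k O] [Algebra O F] [IsFractionRing O F] [IsScalarTower k O F] (ε : B →ₐ[k] k)
    (hnr : IsDomain (TensorProduct k (AlgebraicClosure k) B) →
      ∀ (f : TensorProduct k (AlgebraicClosure k) B) (g : Polynomial (AlgebraicClosure k))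
        (τ : Localization.Away g →ₐ[AlgebraicClosure k] Localization.Away f)
        (a : Localization.Away g), f ≠ 0 →
          ¬ @IsLocalization.Away _ _ a (Localization.Away f) _ τ.toRingHom.toAlgebra)
    (κ : F →ₐ[k] RatFunc K) (hprin : (IsLocalRing.maximalIdeal O).IsPrincipal)
    [Module.Finite k (IsLocalRing.ResidueField O)] {Γ : Type*} [Group Γ]
    (γ : Γ → RatFunc K →+* RatFunc K) (h₁ : γ 1 = RingHom.id _)
    (hmul : ∀ f g, γ (f * g) = (γ g).comp (γ f)) (hinj : ∀ g, γ g = RingHom.id _ → g = 1)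
    (hΓk : ∀ g c, γ g (algebraMap k (RatFunc K) c) = algebraMap k (RatFunc K) c)
    (Γ₀ : Subgroup Γ) [Γ₀.FiniteIndex]
    (hΓO : ∀ g ∈ Γ₀, ∀ a : O, ∃ b : O,
      κ (algebraMap O F b) = γ g (κ (algebraMap O F a))) : IsPJordan p Γ := by
  have hk : ∀ x : K, IsAlgebraic k x → ∃ c, algebraMap k K c = x :=
    fun x hx ↦ Algebra.Smooth.exists_algebraMap_eq_of_isAlgebraic ε hx
  have hC (x : K) : algebraMap K (RatFunc K) x = RatFunc.C x := by
    rw [RatFunc.algebraMap_eq_C]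
  have hCk (c : k) : algebraMap k (RatFunc K) c = RatFunc.C (algebraMap k K c) := by
    rw [IsScalarTower.algebraMap_apply k K (RatFunc K), hC]
  have hB (b : B) : ∃ c : K, RatFunc.C c = κ (algebraMap B F b) := by
    by_contra! h
    obtain ⟨hd, f, g, τ, a, hf, ha⟩ := exists_common_localization_tensorProduct
      (Ω := AlgebraicClosure k) hk (κ.comp (IsScalarTower.toAlgHom k B F)) (b₀ := b)
      (fun c ↦ by rw [hC]; exact h c)
    exact hnr hd f g τ a hf ha
  have hF (x : F) : ∃ c : K, RatFunc.C c = κ x := by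
    obtain ⟨a, b, -, rfl⟩ := IsFractionRing.div_surjective (A := B) x
    obtain ⟨a', ha⟩ := hB a
    obtain ⟨b', hb⟩ := hB b
    exact ⟨a' / b', by rw [map_div₀, map_div₀, ha, hb]⟩
  obtain ⟨i, hi⟩ := RingHom.exists_comp_eq_of_range_subset (κ : F →+* RatFunc K)
    (RatFunc.C : K →+* RatFunc K) (RingHom.injective _) hF
  have hi' (x : F) : RatFunc.C (i x) = κ x := congr($hi x)
  let i' : F →ₐ[k] K :=
    { i with
      commutes' := fun c ↦ RatFunc.C.injective <| by
        refine (hi' _).trans ?_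
        rw [κ.commutes, hCk] }
  refine IsPJordan.of_endomorphisms_ratFunc (O := O) hk i
    (AlgHom.finite_of_krullDimLE_one B i') (fun c ↦ ?_) hprin γ h₁ hmul hinj
    (fun g c ↦ by rw [← hCk, hΓk]) Γ₀ (fun g hg a ↦ ?_)
  · rw [← IsScalarTower.algebraMap_apply]
    exact i'.commutes c
  · obtain ⟨b, hb⟩ := hΓO g hg a
    exact ⟨b, by rw [hi', hi', hb]⟩

theorem AlgebraicGeometry.Smooth.isReduced {k : Type} [Field k] {X : Scheme}
    (sX : X ⟶ Spec (.of k)) [Smooth sX] : IsReduced X := by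
  have (i : X.affineCover.I₀) : IsReduced (X.affineCover.X i) := by
    let f : X.affineCover.X i ⟶ X := X.affineCover.f i
    have hf : IsOpenImmersion f := inferInstance
    have hU : IsAffineOpen f.opensRange := isAffineOpen_opensRange f
    have hsm := Scheme.smooth_constants sX hU
    let := (Scheme.constants sX f.opensRange).hom.toAlgebra
    have : Algebra.Smooth k Γ(X, f.opensRange) := hsm
    have := Algebra.Smooth.isReduced k Γ(X, f.opensRange)
    have : IsReduced (Spec Γ(X, f.opensRange)) := (affine_isReduced_iff _).mpr this
    exact isReduced_of_isOpenImmersion (f.isoOpensRange ≪≫ hU.isoSpec).hom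
  exact IsReduced.of_openCover X X.affineCover

theorem CommRingCat.isPushout_polynomial (k B : Type) [CommRing k] [CommRing B] [Algebra k B] :
    IsPushout (CommRingCat.ofHom (Polynomial.C : k →+* Polynomial k))
      (CommRingCat.ofHom (algebraMap k B))
      (CommRingCat.ofHom (Polynomial.mapRingHom (algebraMap k B)))
      (CommRingCat.ofHom (Polynomial.C : B →+* Polynomial B)) := by
  let := Polynomial.algebra k B
  exact (CommRingCat.isPushout_iff_isPushout (R := k) (S := B) (R' := Polynomial k)
    (S' := Polynomial B)).mpr inferInstance

theorem BirationalOver.exists_generic_P1Prod {k B K : Type} [Field k] [CommRing B] [IsDomain B]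
    [Algebra k B] [Field K] [Algebra B K] [IsFractionRing B K] [Algebra k K] [IsScalarTower k B K]
    {S E : Scheme} {sS : S ⟶ Spec (.of k)} {sE : E ⟶ Spec (.of k)}
    (u : Spec (.of B) ⟶ E) [IsOpenImmersion u] [IsDominant u]
    (hu : u ≫ sE = Spec.map (CommRingCat.ofHom (algebraMap k B)))
    (h : BirationalOver k S (P1Prod k E sE) sS (P1Prod.str k E sE)) :
    ∃ j : Spec (.of (RatFunc K)) ⟶ S, IsDominant j ∧ IsIso (Scheme.stalkClosedPointTo j) ∧
      j ≫ sS = Spec.map (CommRingCat.ofHom (algebraMap k (RatFunc K))) := by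
  obtain ⟨v, hv₁, hv₂, -, hv⟩ := exists_dominant_chart_pullback (ProjSpace.str k 1) sE
    (ProjSpace.chart k) u (ProjSpace.chart_str k) hu (CommRingCat.isPushout_polynomial k B)
  let := (Polynomial.toRatFunc B K).toAlgebra
  have := Polynomial.isFractionRing_toRatFunc B K
  have : @IsOpenImmersion _ (P1Prod k E sE) v := hv₁
  have : @IsDominant _ (P1Prod k E sE) v := hv₂
  obtain ⟨j, hj₁, hj₂, hj⟩ := h.exists_generic (F := RatFunc K) v
  refine ⟨j, hj₁, hj₂, hj.trans ?_⟩
  have e : v ≫ P1Prod.str k E sE = Spec.map (CommRingCat.ofHom Polynomial.C) ≫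
      Spec.map (CommRingCat.ofHom (algebraMap k B)) := by
    rw [← hu, ← Category.assoc, ← hv]
    exact (Category.assoc ..).symm
  refine (congrArg (_ ≫ ·) e).trans ?_
  rw [← Spec.map_comp, ← Spec.map_comp]
  congr 1
  ext c
  change algebraMap (Polynomial K) (RatFunc K) ((Polynomial.C (algebraMap k B c)).map (algebraMap B K)) =
    algebraMap k (RatFunc K) c
  rw [Polynomial.map_C, ← IsScalarTower.algebraMap_apply,
    IsScalarTower.algebraMap_apply k K (RatFunc K), RatFunc.algebraMap_eq_C]
  exact RatFunc.algebraMap_C _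

theorem AlgebraicGeometry.Scheme.exists_constants_comp_eq_id {k : Type} [Field k] {X : Scheme}
    (sX : X ⟶ Spec (.of k)) (o : Spec (.of k) ⟶ X) (ho : o ≫ sX = 𝟙 _) {U : X.Opens}
    (hU : o (IsLocalRing.closedPoint k) ∈ U) :
    ∃ ε : Γ(X, U) ⟶ .of k, Scheme.constants sX U ≫ ε = 𝟙 _ := by
  refine ⟨X.presheaf.germ U _ hU ≫ Scheme.stalkClosedPointTo o, Spec.map_injective ?_⟩
  rw [← Category.assoc, Scheme.constants_germ, Spec.map_comp, Scheme.SpecMap_stalkConstants,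
    ← Category.assoc, Scheme.Spec_stalkClosedPointTo_fromSpecStalk, ho, Spec.map_id]

/-- Let `S` be a smooth quasi-projective surface over a field `k` of characteristic
`p > 0` birational to `ℙ¹ × E`, where `E` is an elliptic curve, and let `π : S → E` be
the projection.  Let `Γ` be the group of automorphisms of `E` induced by `Aut(S)`
(encoded by a homomorphism `φ` commuting with `π`; since `π` is dominant, such a `φ` is
unique, namely the canonical induced action).  If there exists a nonempty finite subset
`Z ⊆ E` of closed points preserved by `Γ`, then the group `Aut(S)` is `p`-Jordan. -/
theorem isPJordan_aut_of_invariant_finite_set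
    (p : ℕ) (hp : 0 < p) (k : Type) [Field k] [CharP k p]
    (Eℓ : EllipticCurveOver k)
    (S : Scheme) (sS : S ⟶ Spec (CommRingCat.of k))
    (hSsm : IsSmooth sS) (hSqp : IsQuasiProjectiveOver k S sS)
    (hSdim : topologicalKrullDim S = 2)
    (hSbir : BirationalOver k S (P1Prod k Eℓ.X Eℓ.str) sS (P1Prod.str k Eℓ.X Eℓ.str))
    (π : S ⟶ Eℓ.X) (hπ : π ≫ Eℓ.str = sS) [IsDominant π]
    (φ : Aut (Over.mk sS) →* Aut (Over.mk Eℓ.str))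
    (hφ : ∀ g : Aut (Over.mk sS), g.hom.left ≫ π = π ≫ (φ g).hom.left)
    (Z : Set Eℓ.X) (hZfin : Z.Finite) (hZne : Z.Nonempty)
    (hZcl : ∀ z ∈ Z, Scheme.IsClosedPoint z)
    (hZpres : ∀ g : Aut (Over.mk sS), (φ g).hom.left.base '' Z = Z) :
    IsPJordan p (Aut (Over.mk sS)) := by
  have : Fact p.Prime := ⟨(CharP.char_is_prime_or_zero k p).resolve_right hp.ne'⟩
  have : IsIntegral Eℓ.X := Eℓ.integral
  have : Smooth Eℓ.str := Eℓ.smooth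
  have : Smooth sS := hSsm
  have : IsReduced S := Smooth.isReduced sS
  have : IsSeparated sS := hSqp.isSeparated
  obtain ⟨_, ⟨U, hU, rfl⟩, hoU, -⟩ := Eℓ.X.isBasis_affineOpens.exists_subset_of_mem_open
    (Set.mem_univ (Eℓ.origin (IsLocalRing.closedPoint k))) isOpen_univ
  have : Nonempty U := ⟨⟨_, hoU⟩⟩
  obtain ⟨ε, hε⟩ := Scheme.exists_constants_comp_eq_id Eℓ.str Eℓ.origin Eℓ.origin_section hoU
  have hsm := Scheme.smooth_constants Eℓ.str hU
  have hu := Scheme.SpecMap_constants Eℓ.str hU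
  let := (Scheme.constants Eℓ.str U).hom.toAlgebra
  have : Algebra.Smooth k Γ(Eℓ.X, U) := hsm
  have : Ring.KrullDimLE 1 Γ(Eℓ.X, U) := hU.krullDimLE Eℓ.dim_one.le
  have hu' : hU.fromSpec ≫ Eℓ.str = Spec.map (CommRingCat.ofHom (algebraMap k Γ(Eℓ.X, U))) :=
    hu.symm
  have : IsOpenImmersion hU.fromSpec := hU.isOpenImmersion_fromSpec
  have : IsDominant hU.fromSpec := IsOpenImmersion.isDominant _
  let ε' : Γ(Eℓ.X, U) →ₐ[k] k := { ε.hom with commutes' := fun c ↦ congr($hε c) }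
  obtain ⟨j, hj₁, hj₂, hj⟩ := hSbir.exists_generic_P1Prod (K := FractionRing Γ(Eℓ.X, U))
    hU.fromSpec hu'
  obtain ⟨γ, hγ, h₁, hmul, hinj⟩ := exists_endomorphisms_of_isDominant sS j
  have hΓk (g : Aut (Over.mk sS)) (c : k) :
      γ g (algebraMap k (RatFunc (FractionRing Γ(Eℓ.X, U))) c) = algebraMap k _ c := by
    have : CommRingCat.ofHom (algebraMap k (RatFunc (FractionRing Γ(Eℓ.X, U)))) ≫
        CommRingCat.ofHom (γ g) = CommRingCat.ofHom (algebraMap k _) := by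
      refine Spec.map_injective ?_
      have e : g.hom.left ≫ sS = sS := Over.w g.hom
      rw [Spec.map_comp, ← hj, ← Category.assoc, hγ, Category.assoc, e]
    exact congr($this c)
  let ℓ := j ≫ π
  have hℓ : ℓ ≫ Eℓ.str = Spec.map (CommRingCat.ofHom
      (algebraMap k (RatFunc (FractionRing Γ(Eℓ.X, U))))) := by
    rw [← hj, ← hπ]; exact Category.assoc ..
  have hℓs := Scheme.specializes_of_isDominant ℓ
  have hγℓ (g : Aut (Over.mk sS)) :
      Spec.map (CommRingCat.ofHom (γ g)) ≫ ℓ = ℓ ≫ (φ g).hom.left := by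
    refine (Category.assoc ..).symm.trans ?_
    rw [hγ, Category.assoc, hφ]; exact (Category.assoc ..).symm
  have hcomp (x : Eℓ.X) : Scheme.stalkConstants Eℓ.str x ≫
      Scheme.stalkToOfSpecializes ℓ (hℓs x) = CommRingCat.ofHom (algebraMap k _) := by
    refine Spec.map_injective ?_
    rw [Spec.map_comp, Scheme.SpecMap_stalkConstants, ← Category.assoc,
      Scheme.SpecMap_stalkToOfSpecializes, hℓ]
  obtain ⟨z, hz⟩ := hZne
  let F := Eℓ.X.functionField
  let : Algebra k F := (Scheme.stalkConstants Eℓ.str (genericPoint Eℓ.X)).hom.toAlgebra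
  have : IsFractionRing Γ(Eℓ.X, U) F := functionField_isFractionRing_of_isAffineOpen _ U hU
  have : IsScalarTower k Γ(Eℓ.X, U) F := .of_algebraMap_eq' <| congrArg CommRingCat.Hom.hom
    (Scheme.constants_germ Eℓ.str U (genericPoint Eℓ.X) _).symm
  let κ : F →ₐ[k] RatFunc (FractionRing Γ(Eℓ.X, U)) :=
    { (Scheme.stalkToOfSpecializes ℓ (hℓs (genericPoint Eℓ.X))).hom with
      commutes' := fun c ↦ congr($(hcomp (genericPoint Eℓ.X)) c) }
  let O := Eℓ.X.presheaf.stalk z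
  obtain ⟨hprin, hnoeth, hfin⟩ := Smooth.stalk_of_isClosed Eℓ.str Eℓ.dim_one.le (hZcl z hz)
  let : Algebra k O := (Scheme.stalkConstants Eℓ.str z).hom.toAlgebra
  have : Module.Finite k (IsLocalRing.ResidueField O) := hfin
  have hgen : genericPoint Eℓ.X ⤳ z := (genericPoint_spec Eℓ.X).specializes trivial
  have : IsScalarTower k O F := .of_algebraMap_eq' <| congrArg CommRingCat.Hom.hom <|
    show Scheme.stalkConstants Eℓ.str (genericPoint Eℓ.X) =
        Scheme.stalkConstants Eℓ.str z ≫ Eℓ.X.presheaf.stalkSpecializes hgen by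
      refine Spec.map_injective ?_
      rw [Spec.map_comp, Scheme.SpecMap_stalkConstants, Scheme.SpecMap_stalkConstants,
        ← Category.assoc, Scheme.SpecMap_stalkSpecializes_fromSpecStalk]
  have hκ (a : O) : κ (algebraMap O F a) = Scheme.stalkToOfSpecializes ℓ (hℓs z) a :=
    congr($(Scheme.stalkSpecializes_stalkToOfSpecializes ℓ (hℓs (genericPoint Eℓ.X)) hgen) a)
  have hφ₁ (x : Eℓ.X) : (φ 1).hom.left x = x := by
    rw [_root_.map_one]; rfl
  have hφmul (f g : Aut (Over.mk sS)) (x : Eℓ.X) :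
      (φ (f * g)).hom.left x = (φ f).hom.left ((φ g).hom.left x) := by
    rw [_root_.map_mul]; rfl
  let Γ₀ : Subgroup (Aut (Over.mk sS)) :=
    { carrier := {g | (φ g).hom.left z = z}
      one_mem' := hφ₁ z
      mul_mem' := fun {f g} (hf : (φ f).hom.left z = z) (hg : (φ g).hom.left z = z) ↦
        (hφmul f g z).trans (by rw [hg, hf])
      inv_mem' := fun {g} (hg : (φ g).hom.left z = z) ↦ by
        have h := hφmul g⁻¹ g z
        rw [inv_mul_cancel, hφ₁, hg] at h
        exact h.symm }
  have : Γ₀.FiniteIndex := Subgroup.finiteIndex_of_forall_mem_iff Γ₀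
    (fun g x ↦ (φ g).hom.left x) hφ₁ hφmul hZfin (z := z)
    (fun g ↦ (hZpres g).subset ⟨z, hz, rfl⟩) fun g ↦ Iff.rfl
  refine IsPJordan.of_endomorphisms_of_nonrational (B := Γ(Eℓ.X, U)) (O := O) (F := F) ε'
    (fun h f g τ a hf ha ↦ Eℓ.geom_nonrational
      (birationalOver_baseChangeToClosure_of_localization hU.fromSpec hu' hf τ a ha))
    κ hprin γ h₁ hmul hinj hΓk Γ₀ fun g hg a ↦ ?_
  simp only [hκ]
  exact Scheme.exists_stalkToOfSpecializes_eq ℓ (CommRingCat.ofHom (γ g)) (φ g).hom.left (hγℓ g) hg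
    (hℓs z) a
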